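/- For every planar graph G with maximum degree Δ, the 2-distance chromatic number of G is at most 2Δ + 7; that is, there exists a proper coloring of the vertices of G with 2Δ + 7 colors such that any two distinct vertices at distance at most 2 receive different colors. -/

import Mathlib

open SimpleGraph

/-- A simple graph is planar if it admits a topological embedding in the plane:
vertices are mapped injectively to points of `ℝ × ℝ`, each edge is realized by a
path between the images of its endpoints whose interior avoids all vertex images,
and the interiors of paths realizing distinct edges are disjoint. -/
def IsPlanar {V : Type*} (G : SimpleGraph V) : Prop :=
  ∃ (pos : V → ℝ × ℝ) (γ : ∀ u v : V, G.Adj u v → Path (pos u) (pos v)),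
    Function.Injective pos ∧
    (∀ (u v : V) (h : G.Adj u v) (t : unitInterval), (t : ℝ) ∈ Set.Ioo (0 : ℝ) 1 →
        ∀ w : V, γ u v h t ≠ pos w) ∧
    (∀ (u v : V) (h : G.Adj u v) (u' v' : V) (h' : G.Adj u' v'),
        (s(u, v) : Sym2 V) ≠ s(u', v') →
        ∀ s t : unitInterval, (s : ℝ) ∈ Set.Ioo (0 : ℝ) 1 → (t : ℝ) ∈ Set.Ioo (0 : ℝ) 1 →
          γ u v h s ≠ γ u' v' h' t)

/-! ### Counting the classes of a setoid -/

section Classes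
variable {α : Type*}

/-- Adding the single relation `x ~ y` to a setoid. -/
def Setoid.glue (s : Setoid α) (x y : α) : Setoid α where
  r a b := s a b ∨ ((s a x ∨ s a y) ∧ (s b x ∨ s b y))
  iseqv := by
    refine ⟨fun a => Or.inl (s.refl a), ?_, ?_⟩
    · rintro a b (h | h)
      · exact Or.inl (s.symm h)
      · exact Or.inr h.symm
    · rintro a b c (h | ⟨h1, h2⟩) (h' | ⟨h1', h2'⟩)
      · exact Or.inl (s.trans h h')
      · refine Or.inr ⟨h1'.imp (s.trans h) (s.trans h), h2'⟩
      · refine Or.inr ⟨h1, h2.imp (s.trans (s.symm h')) (s.trans (s.symm h'))⟩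
      · exact Or.inr ⟨h1, h2'⟩

theorem Setoid.le_glue (s : Setoid α) (x y : α) : s ≤ s.glue x y := fun _ _ h => Or.inl h

theorem Setoid.glue_rel (s : Setoid α) (x y : α) : s.glue x y x y :=
  Or.inr ⟨Or.inl (s.refl x), Or.inr (s.refl y)⟩

theorem Setoid.glue_le {s t : Setoid α} {x y : α} (h : s ≤ t) (hxy : t x y) :
    s.glue x y ≤ t := by
  have key : ∀ a, (s a x ∨ s a y) → t a x := by
    rintro a (h1 | h1)
    · exact h h1
    · exact t.trans (h h1) (t.symm hxy)
  rintro a b (h1 | ⟨h1, h2⟩)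
  · exact h h1
  · exact t.trans (key a h1) (t.symm (key b h2))

theorem Setoid.glue_eq_self {s : Setoid α} {x y : α} (h : s x y) : s.glue x y = s :=
  le_antisymm (Setoid.glue_le le_rfl h) (s.le_glue x y)

/-- The number of classes of a setoid. -/
noncomputable def Setoid.numClasses (s : Setoid α) : ℕ := Nat.card (Quotient s)

theorem Setoid.numClasses_anti [Finite α] {s t : Setoid α} (h : s ≤ t) :
    t.numClasses ≤ s.numClasses := by
  refine Nat.card_le_card_of_surjective (Quotient.map' id h) ?_
  intro q
  induction q using Quotient.inductionOn with
  | _ a => exact ⟨Quotient.mk'' a, rfl⟩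

theorem Setoid.numClasses_glue [Finite α] {s : Setoid α} {x y : α} (h : ¬ s x y) :
    s.numClasses = (s.glue x y).numClasses + 1 := by
  classical
  have : Nat.card (Quotient s) = Nat.card (Option (Quotient (s.glue x y))) := by
    refine Nat.card_congr ?_
    refine Equiv.ofBijective (fun q => if q = Quotient.mk s x then none
      else some (Quotient.map' id (s.le_glue x y) q)) ⟨?_, ?_⟩
    · intro p q
      induction p, q using Quotient.inductionOn₂ with
      | _ a b =>
        dsimp only
        split_ifs with h1 h2 h2
        · intro _; rw [h1, h2]
        · intro hh; cases hh
        · intro hh; cases hh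
        · intro hh
          have h3 : s.glue x y a b := Quotient.exact (Option.some.inj hh)
          have h1' : ¬ s a x := fun hh => h1 (Quotient.sound hh)
          have h2' : ¬ s b x := fun hh => h2 (Quotient.sound hh)
          apply Quotient.sound
          rcases h3 with h3 | ⟨h3, h4⟩
          · exact h3
          · exact s.trans (h3.resolve_left h1') (s.symm (h4.resolve_left h2'))
    · rintro (_ | q)
      · exact ⟨Quotient.mk s x, if_pos rfl⟩
      · induction q using Quotient.inductionOn with
        | _ a =>
          by_cases ha : s a x
          · refine ⟨Quotient.mk s y, ?_⟩
            have : Quotient.mk s y ≠ Quotient.mk s x := fun hh => h (s.symm (Quotient.exact hh))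
            dsimp only
            rw [if_neg this]
            refine congrArg some (Quotient.sound ?_)
            exact Or.inr ⟨Or.inr (s.refl y), Or.inl ha⟩
          · refine ⟨Quotient.mk s a, ?_⟩
            have : Quotient.mk s a ≠ Quotient.mk s x := fun hh => ha (Quotient.exact hh)
            dsimp only
            rw [if_neg this]
            rfl
  rw [Setoid.numClasses, this, Finite.card_option, Setoid.numClasses]

theorem Setoid.numClasses_eq_sum [Fintype α] (s : Setoid α) :
    (s.numClasses : ℚ) = ∑ a : α, 1 / (Nat.card {b // s b a} : ℚ) := by
  classical
  rw [Setoid.numClasses, Nat.card_eq_fintype_card]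
  have h1 : ∀ a : α, (Nat.card {b // s b a}) =
      (Finset.univ.filter fun b => Quotient.mk s b = Quotient.mk s a).card := by
    intro a
    rw [Nat.card_eq_fintype_card, Fintype.card_subtype]
    congr 1
    ext b
    simp [Quotient.eq]
  rw [← Finset.sum_fiberwise (s := Finset.univ) (g := fun a : α => Quotient.mk s a)]
  rw [← Finset.card_univ, Finset.card_eq_sum_ones, Nat.cast_sum]
  refine Finset.sum_congr rfl fun q _ => ?_
  induction q using Quotient.inductionOn with
  | _ a =>
    have h2 : ∀ c ∈ Finset.univ.filter (fun b => Quotient.mk s b = Quotient.mk s a),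
        1 / (Nat.card {b // s b c} : ℚ) =
        1 / ((Finset.univ.filter fun b => Quotient.mk s b = Quotient.mk s a).card : ℚ) := by
      intro c hc
      rw [h1, (Finset.mem_filter.1 hc).2]
    rw [Finset.sum_congr rfl h2, Finset.sum_const, nsmul_eq_mul]
    have : ((Finset.univ.filter fun b => Quotient.mk s b = Quotient.mk s a).card : ℚ) ≠ 0 := by
      rw [Nat.cast_ne_zero]
      exact Finset.card_ne_zero_of_mem (Finset.mem_filter.2 ⟨Finset.mem_univ a, rfl⟩)
    field_simp
    simp

end Classes

/-! ### Counting the orbits of a permutation -/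

section Orbits
open Equiv Equiv.Perm
variable {α : Type*}

/-- The number of orbits of a permutation. -/
noncomputable def numOrbits (f : Perm α) : ℕ := (SameCycle.setoid f).numClasses

theorem sameCycle_le_of_forall {f : Perm α} {s : Setoid α} (h : ∀ a, s a (f a)) :
    SameCycle.setoid f ≤ s := by
  have hnat : ∀ (n : ℕ) a, s a ((f ^ n) a) := by
    intro n
    induction n with
    | zero => intro a; exact s.refl a
    | succ n ih => intro a; rw [pow_succ']; exact s.trans (ih a) (h _)
  rintro a b ⟨n, rfl⟩
  rcases n with n | n
  · exact hnat n a
  · have := hnat (n + 1) ((f ^ Int.negSucc n) a)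
    rw [← Perm.mul_apply, zpow_negSucc, mul_inv_cancel] at this
    exact s.symm this

variable [DecidableEq α]

theorem glue_swap_mul_le (f : Perm α) (x y : α) :
    (SameCycle.setoid (swap x y * f)).glue x y ≤ (SameCycle.setoid f).glue x y := by
  refine Setoid.glue_le (sameCycle_le_of_forall fun a => ?_) (Setoid.glue_rel _ _ _)
  have h1 : (SameCycle.setoid f).glue x y a (f a) := Or.inl (sameCycle_apply_right.2 (SameCycle.refl f a))
  have hxy := (SameCycle.setoid f).glue_rel x y
  rw [Perm.mul_apply]
  by_cases hx : f a = x
  · rw [hx, swap_apply_left]; rw [hx] at h1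
    exact Setoid.trans' _ h1 hxy
  · by_cases hy : f a = y
    · rw [hy, swap_apply_right]; rw [hy] at h1
      exact Setoid.trans' _ h1 (Setoid.symm' _ hxy)
    · rwa [swap_apply_of_ne_of_ne hx hy]

theorem glue_swap_mul (f : Perm α) (x y : α) :
    (SameCycle.setoid (swap x y * f)).glue x y = (SameCycle.setoid f).glue x y := by
  refine le_antisymm (glue_swap_mul_le f x y) ?_
  have := glue_swap_mul_le (swap x y * f) x y
  rwa [swap_mul_self_mul] at this

theorem not_sameCycle_swap_mul [Finite α] {f : Perm α} {x y : α} (hxy : x ≠ y)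
    (h : SameCycle f x y) : ¬ SameCycle (swap x y * f) x y := by
  classical
  have hex : ∃ m : ℕ, (f ^ m) x = y := by
    obtain ⟨m, -, -, hm⟩ := h.exists_pow_eq''
    exact ⟨m, hm⟩
  let m := Nat.find hex
  have hm : (f ^ m) x = y := Nat.find_spec hex
  have hlt : ∀ j < m, (f ^ j) x ≠ y := fun j hj => Nat.find_min hex hj
  have hm0 : 0 < m := by
    rcases Nat.eq_zero_or_pos m with h0 | h0
    · rw [h0] at hm; exact absurd hm hxy
    · exact h0
  have hnx : ∀ j, 0 < j → j < m → (f ^ j) x ≠ x := by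
    intro j hj0 hjm hjx
    refine hlt (m - j) (by omega) ?_
    rw [← hm]
    conv_lhs => rw [← hjx]
    rw [← Perm.mul_apply, ← pow_add, Nat.sub_add_cancel hjm.le]
  have hiter : ∀ j < m, ((swap x y * f) ^ j) x = (f ^ j) x := by
    intro j
    induction j with
    | zero => intro _; rfl
    | succ j ih =>
      intro hj
      rw [pow_succ', Perm.mul_apply, ih (by omega), Perm.mul_apply, ← Perm.mul_apply f, ← pow_succ',
        swap_apply_of_ne_of_ne (hnx _ (by omega) hj) (hlt _ hj)]
  have hper : ((swap x y * f) ^ m) x = x := by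
    obtain ⟨k, hk⟩ : ∃ k, m = k + 1 := ⟨m - 1, by omega⟩
    rw [hk, pow_succ', Perm.mul_apply, hiter k (by omega), Perm.mul_apply, ← Perm.mul_apply f,
      ← pow_succ', ← hk, hm, swap_apply_right]
  intro hs
  obtain ⟨n, -, -, hn⟩ := hs.exists_pow_eq''
  rw [← Nat.mod_add_div n m, pow_add, pow_mul, Perm.mul_apply] at hn
  have hp : (((swap x y * f) ^ m) ^ (n / m)) x = x := by
    generalize n / m = q
    induction q with
    | zero => rfl
    | succ q ih => rw [pow_succ, Perm.mul_apply, hper, ih]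
  rw [hp, hiter _ (Nat.mod_lt _ hm0)] at hn
  exact hlt _ (Nat.mod_lt _ hm0) hn

theorem sameCycle_swap_mul [Finite α] {f : Perm α} {x y : α}
    (h : ¬ SameCycle f x y) : SameCycle (swap x y * f) x y := by
  classical
  have hex : ∃ m : ℕ, 0 < m ∧ (f ^ m) x = x :=
    ⟨orderOf f, orderOf_pos f, by rw [pow_orderOf_eq_one]; rfl⟩
  let m := Nat.find hex
  obtain ⟨hm0, hm⟩ : 0 < m ∧ (f ^ m) x = x := Nat.find_spec hex
  have hlt : ∀ j < m, 0 < j → (f ^ j) x ≠ x := fun j hj h0 hx => Nat.find_min hex hj ⟨h0, hx⟩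
  have hny : ∀ j : ℕ, (f ^ j) x ≠ y := fun j hj => h ⟨j, by simpa using hj⟩
  have hiter : ∀ j < m, ((swap x y * f) ^ j) x = (f ^ j) x := by
    intro j
    induction j with
    | zero => intro _; rfl
    | succ j ih =>
      intro hj
      rw [pow_succ', Perm.mul_apply, ih (by omega), Perm.mul_apply, ← Perm.mul_apply f, ← pow_succ',
        swap_apply_of_ne_of_ne (hlt _ hj (by omega)) (hny _)]
  refine ⟨(m : ℕ), ?_⟩
  obtain ⟨k, hk⟩ : ∃ k, m = k + 1 := ⟨m - 1, by omega⟩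
  rw [zpow_natCast, hk, pow_succ', Perm.mul_apply, hiter k (by omega), Perm.mul_apply,
    ← Perm.mul_apply f, ← pow_succ', ← hk, hm, swap_apply_left]

theorem numOrbits_swap_mul_of_sameCycle [Finite α] {f : Perm α} {x y : α} (hxy : x ≠ y)
    (h : SameCycle f x y) : numOrbits (swap x y * f) = numOrbits f + 1 := by
  rw [numOrbits, Setoid.numClasses_glue (not_sameCycle_swap_mul hxy h), glue_swap_mul,
    Setoid.glue_eq_self h, numOrbits]

theorem numOrbits_swap_mul_of_not_sameCycle [Finite α] {f : Perm α} {x y : α}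
    (h : ¬ SameCycle f x y) : numOrbits (swap x y * f) + 1 = numOrbits f := by
  rw [numOrbits, numOrbits, Setoid.numClasses_glue (s := SameCycle.setoid f) h, ← glue_swap_mul,
    Setoid.glue_eq_self (sameCycle_swap_mul h)]

/-- Removing the point `v` from a permutation does not affect the orbit relation elsewhere. -/
theorem sameCycle_remove {g : Perm α} {v z w : α} (hz : z ≠ v) (hw : w ≠ v)
    (h : SameCycle g z w) : SameCycle (swap v (g v) * g) z w := by
  have hv : (swap v (g v) * g) v = v := by simp
  have hfix : ∀ a, SameCycle (swap v (g v) * g) a v → a = v := by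
    intro a ha
    exact (ha.symm.eq_of_left hv).symm
  have h1 : (SameCycle.setoid (swap v (g v) * g)).glue v (g v) z w := by
    rw [glue_swap_mul]; exact Or.inl h
  rcases h1 with h1 | ⟨h1, h2⟩
  · exact h1
  · have h1' := h1.resolve_left fun hh => hz (hfix z hh)
    have h2' := h2.resolve_left fun hh => hw (hfix w hh)
    exact SameCycle.trans h1' (SameCycle.symm h2')

end Orbits

/-! ### Rotation systems -/

section Rotation
set_option linter.unusedSectionVars false
open Equiv Equiv.Perm
variable {W : Type*}

/-- `rot u` lists the neighbours of `u` cyclically and fixes every other vertex. -/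
structure IsRotation (H : SimpleGraph W) (rot : W → Perm W) : Prop where
  fixed : ∀ u v, ¬ H.Adj u v → rot u v = v
  cycle : ∀ u v w, H.Adj u v → H.Adj u w → SameCycle (rot u) v w

theorem IsRotation.adj {H : SimpleGraph W} {rot : W → Perm W} (h : IsRotation H rot) {u v : W}
    (huv : H.Adj u v) : H.Adj u (rot u v) := by
  by_contra hn
  have h1 := (rot u).injective (h.fixed u _ hn)
  rw [h1] at hn
  exact hn huv

theorem IsRotation.adj_iff {H : SimpleGraph W} {rot : W → Perm W} (h : IsRotation H rot) {u v : W} :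
    H.Adj u (rot u v) ↔ H.Adj u v := by
  refine ⟨fun hh => ?_, h.adj⟩
  by_contra hn
  rw [h.fixed u v hn] at hh
  exact hn hh

/-- The permutation of ordered pairs whose orbits on darts are the faces. -/
def facePerm (rot : W → Perm W) : Perm (W × W) where
  toFun p := (p.2, rot p.2 p.1)
  invFun p := ((rot p.1).symm p.2, p.1)
  left_inv p := by simp
  right_inv p := by simp

@[simp] theorem facePerm_apply (rot : W → Perm W) (p : W × W) :
    facePerm rot p = (p.2, rot p.2 p.1) := rfl

theorem IsRotation.facePerm_adj {H : SimpleGraph W} {rot : W → Perm W} (h : IsRotation H rot)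
    {p : W × W} (hp : H.Adj p.1 p.2) : H.Adj (facePerm rot p).1 (facePerm rot p).2 :=
  h.adj hp.symm

open Classical in
/-- The number of isolated vertices. -/
noncomputable def numIsolated [Fintype W] (H : SimpleGraph W) : ℕ :=
  ∑ x : W, if ∀ y, ¬ H.Adj x y then 1 else 0

/-- A rotation system of genus zero, by Euler's formula. -/
structure PlanarRot [Fintype W] (H : SimpleGraph W) (rot : W → Perm W) : Prop
    extends IsRotation H rot where
  euler : Fintype.card W * Fintype.card W + 4 * H.reachableSetoid.numClasses ≤
    2 * numOrbits (facePerm rot) + 2 * numIsolated H + Fintype.card W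

/-- `H` arises from `H'` by adding the edge `uv`. -/
structure EdgeExt (H' H : SimpleGraph W) (u v : W) : Prop where
  ne : u ≠ v
  not_adj : ¬ H'.Adj u v
  adj_iff : ∀ x y, H.Adj x y ↔ H'.Adj x y ∨ (x = u ∧ y = v) ∨ (x = v ∧ y = u)

theorem EdgeExt.symm {H' H : SimpleGraph W} {u v : W} (h : EdgeExt H' H u v) :
    EdgeExt H' H v u :=
  ⟨h.ne.symm, fun hh => h.not_adj hh.symm, fun x y => by rw [h.adj_iff]; tauto⟩

theorem EdgeExt.adj {H' H : SimpleGraph W} {u v : W} (h : EdgeExt H' H u v) : H.Adj u v :=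
  (h.adj_iff u v).2 (Or.inr (Or.inl ⟨rfl, rfl⟩))

theorem EdgeExt.le {H' H : SimpleGraph W} {u v : W} (h : EdgeExt H' H u v) : H' ≤ H :=
  fun x y hxy => (h.adj_iff x y).2 (Or.inl hxy)

theorem reachableSetoid_le_of_adj {H : SimpleGraph W} {s : Setoid W}
    (h : ∀ x y, H.Adj x y → s x y) : H.reachableSetoid ≤ s := by
  rintro x y ⟨p⟩
  induction p with
  | nil => exact s.refl _
  | cons hadj _ ih => exact s.trans (h _ _ hadj) ih

theorem EdgeExt.reachableSetoid_eq {H' H : SimpleGraph W} {u v : W} (h : EdgeExt H' H u v) :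
    H.reachableSetoid = H'.reachableSetoid.glue u v := by
  refine le_antisymm (reachableSetoid_le_of_adj fun x y hxy => ?_) (Setoid.glue_le ?_ ?_)
  · rcases (h.adj_iff x y).1 hxy with h1 | ⟨rfl, rfl⟩ | ⟨rfl, rfl⟩
    · exact Or.inl h1.reachable
    · exact Setoid.glue_rel _ _ _
    · exact Setoid.symm' _ (Setoid.glue_rel _ _ _)
  · intro x y hxy
    exact Reachable.mono h.le hxy
  · exact h.adj.reachable

variable [DecidableEq W]

/-- Deleting the edge `uv` from a rotation system. -/
def delRot (rot : W → Perm W) (u v : W) : W → Perm W :=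
  Function.update (Function.update rot u (swap v (rot u v) * rot u)) v
    (swap u (rot v u) * rot v)

/-- Inserting `v` before `c` at `u`, and `u` before `e` at `v`. -/
def addRot (rot : W → Perm W) (u v c e : W) : W → Perm W :=
  Function.update (Function.update rot u (swap v c * rot u)) v (swap u e * rot v)

theorem delRot_left (rot : W → Perm W) {u v : W} (h : u ≠ v) :
    delRot rot u v u = swap v (rot u v) * rot u := by
  rw [delRot, Function.update_of_ne h, Function.update_self]

theorem delRot_right (rot : W → Perm W) (u v : W) :
    delRot rot u v v = swap u (rot v u) * rot v := by
  rw [delRot, Function.update_self]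

theorem delRot_other (rot : W → Perm W) {u v x : W} (h : x ≠ u) (h' : x ≠ v) :
    delRot rot u v x = rot x := by
  rw [delRot, Function.update_of_ne h', Function.update_of_ne h]

theorem addRot_left (rot : W → Perm W) {u v : W} (c e : W) (h : u ≠ v) :
    addRot rot u v c e u = swap v c * rot u := by
  rw [addRot, Function.update_of_ne h, Function.update_self]

theorem addRot_right (rot : W → Perm W) (u v c e : W) :
    addRot rot u v c e v = swap u e * rot v := by
  rw [addRot, Function.update_self]

theorem addRot_other (rot : W → Perm W) {u v x : W} (c e : W) (h : x ≠ u) (h' : x ≠ v) :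
    addRot rot u v c e x = rot x := by
  rw [addRot, Function.update_of_ne h', Function.update_of_ne h]

theorem delRot_addRot {rot : W → Perm W} {u v c e : W} (h : u ≠ v) (hu : rot u v = v)
    (hv : rot v u = u) : delRot (addRot rot u v c e) u v = rot := by
  funext x
  by_cases hxu : x = u
  · subst hxu
    rw [delRot_left _ h, addRot_left _ _ _ h]
    simp [hu]
  · by_cases hxv : x = v
    · subst hxv
      rw [delRot_right, addRot_right]
      simp [hv]
    · rw [delRot_other _ hxu hxv, addRot_other _ _ _ hxu hxv]

theorem IsRotation.del {H H' : SimpleGraph W} {rot : W → Perm W} {u v : W}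
    (h : IsRotation H rot) (hE : EdgeExt H' H u v) : IsRotation H' (delRot rot u v) := by
  have hne := hE.ne
  constructor
  · intro x y hxy
    by_cases hxu : x = u
    · subst hxu
      rw [delRot_left _ hne, Perm.mul_apply]
      by_cases hyv : y = v
      · subst hyv; rw [swap_apply_right]
      · have : ¬ H.Adj x y := by rw [hE.adj_iff]; tauto
        have hv := h.adj hE.adj
        rw [h.fixed x y this, swap_apply_of_ne_of_ne hyv]
        rintro rfl; exact this hv
    · by_cases hxv : x = v
      · subst hxv
        rw [delRot_right, Perm.mul_apply]
        by_cases hyv : y = u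
        · subst hyv; rw [swap_apply_right]
        · have : ¬ H.Adj x y := by rw [hE.adj_iff]; tauto
          have hv := h.adj hE.adj.symm
          rw [h.fixed x y this, swap_apply_of_ne_of_ne hyv]
          rintro rfl; exact this hv
      · rw [delRot_other _ hxu hxv]
        exact h.fixed x y (by rw [hE.adj_iff]; tauto)
  · intro x y z hxy hxz
    have h1 := h.cycle x y z (hE.le hxy) (hE.le hxz)
    by_cases hxu : x = u
    · subst hxu
      rw [delRot_left _ hne]
      refine sameCycle_remove ?_ ?_ h1
      · rintro rfl; exact hE.not_adj hxy
      · rintro rfl; exact hE.not_adj hxz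
    · by_cases hxv : x = v
      · subst hxv
        rw [delRot_right]
        refine sameCycle_remove ?_ ?_ h1
        · rintro rfl; exact hE.not_adj hxy.symm
        · rintro rfl; exact hE.not_adj hxz.symm
      · rwa [delRot_other _ hxu hxv]

theorem sameCycle_insert {g : Perm W} {b c z w : W} (hb : g b = b) (h : SameCycle g z w) :
    SameCycle (swap b c * g) z w := by
  have hbc : SameCycle (swap b c * g) b c := by
    refine ⟨1, ?_⟩
    simp [hb]
  have h1 : (SameCycle.setoid g).glue b c z w := Or.inl h
  rwa [← glue_swap_mul, Setoid.glue_eq_self hbc] at h1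

theorem IsRotation.add {H H' : SimpleGraph W} {rot : W → Perm W} {u v c e : W}
    (h : IsRotation H' rot) (hE : EdgeExt H' H u v)
    (hc : H'.Adj u c ∨ (c = v ∧ ∀ x, ¬ H'.Adj u x))
    (he : H'.Adj v e ∨ (e = u ∧ ∀ x, ¬ H'.Adj v x)) : IsRotation H (addRot rot u v c e) := by
  have aux : ∀ (g : Perm W) (p q f : W), EdgeExt H' H p q → g = rot p →
      (H'.Adj p f ∨ (f = q ∧ ∀ x, ¬ H'.Adj p x)) →
      (∀ y, ¬ H.Adj p y → (swap q f * g) y = y) ∧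
      ∀ y z, H.Adj p y → H.Adj p z → SameCycle (swap q f * g) y z := by
    intro g p q f hE hg hf
    subst hg
    have hq : rot p q = q := h.fixed p q hE.not_adj
    constructor
    · intro y hy
      have hy' : ¬ H'.Adj p y := fun hh => hy (hE.le hh)
      have hyq : y ≠ q := by rintro rfl; exact hy hE.adj
      rw [Perm.mul_apply, h.fixed p y hy']
      refine swap_apply_of_ne_of_ne hyq ?_
      rintro rfl
      rcases hf with hf | hf
      · exact hy' hf
      · exact hyq hf.1
    · have hqf : SameCycle (swap q f * rot p) q f := ⟨1, by simp [hq]⟩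
      have key : ∀ y, H.Adj p y → SameCycle (swap q f * rot p) f y := by
        intro y hy
        rcases (hE.adj_iff p y).1 hy with h1 | h1 | h1
        · rcases hf with hf | hf
          · exact sameCycle_insert hq (h.cycle p f y hf h1)
          · exact absurd h1 (hf.2 y)
        · rw [h1.2]; exact hqf.symm
        · exact absurd h1.1 hE.ne
      intro y z hy hz
      exact (key y hy).symm.trans (key z hz)
  have hU := aux (rot u) u v c hE rfl hc
  have hV := aux (rot v) v u e hE.symm rfl he
  have hoth : ∀ x, x ≠ u → x ≠ v → ∀ y, H.Adj x y ↔ H'.Adj x y := by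
    intro x h1 h2 y; rw [hE.adj_iff]; tauto
  constructor
  · intro x y hxy
    by_cases hxu : x = u
    · subst hxu; rw [addRot_left _ _ _ hE.ne]; exact hU.1 y hxy
    · by_cases hxv : x = v
      · subst hxv; rw [addRot_right]; exact hV.1 y hxy
      · rw [addRot_other _ _ _ hxu hxv]
        exact h.fixed x y (by rwa [← hoth x hxu hxv])
  · intro x y z hxy hxz
    by_cases hxu : x = u
    · subst hxu; rw [addRot_left _ _ _ hE.ne]; exact hU.2 y z hxy hxz
    · by_cases hxv : x = v
      · subst hxv; rw [addRot_right]; exact hV.2 y z hxy hxz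
      · rw [addRot_other _ _ _ hxu hxv]
        exact h.cycle x y z (by rwa [← hoth x hxu hxv]) (by rwa [← hoth x hxu hxv])

theorem facePerm_delRot (rot : W → Perm W) {u v : W} (h : u ≠ v) :
    facePerm (delRot rot u v) =
      swap (u, v) (u, rot u v) * (swap (v, u) (v, rot v u) * facePerm rot) := by
  have swap_pair : ∀ a b c d e : W, swap (a, b) (a, c) (d, e) =
      if d = a then (d, swap b c e) else (d, e) := by
    intro a b c d e
    simp only [swap_apply_def, Prod.mk.injEq]
    grind
  ext1 ⟨p, q⟩
  simp only [facePerm_apply, Perm.mul_apply, swap_pair]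
  by_cases hqu : q = u
  · subst hqu
    rw [delRot_left _ h]
    simp [h]
  · by_cases hqv : q = v
    · subst hqv
      rw [delRot_right]
      simp [hqu]
    · rw [delRot_other _ hqu hqv]
      simp [hqu, hqv]

theorem numOrbits_delRot [Finite W] {rot : W → Perm W} {u v : W} (h : u ≠ v) :
    (SameCycle (facePerm rot) (u, v) (v, u) → numOrbits (facePerm (delRot rot u v)) =
      numOrbits (facePerm rot) + (if rot u v = v then 0 else 1) + (if rot v u = u then 0 else 1)) ∧
    (¬ SameCycle (facePerm rot) (u, v) (v, u) → numOrbits (facePerm (delRot rot u v)) =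
      numOrbits (facePerm rot)) := by
  rw [facePerm_delRot rot h]
  set φ := facePerm rot with hφ
  have hb : φ (u, v) = (v, rot v u) := rfl
  have ha : φ (v, u) = (u, rot u v) := rfl
  have h1 : (swap (v, u) (v, rot v u) * φ) (u, v) = (v, u) := by
    rw [Perm.mul_apply, hb, swap_apply_right]
  have h2 : (swap (v, u) (v, rot v u) * φ) (v, u) = (u, rot u v) := by
    rw [Perm.mul_apply, ha, swap_apply_of_ne_of_ne] <;> simp [h]
  have h3 : SameCycle (swap (v, u) (v, rot v u) * φ) (u, v) (u, rot u v) := by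
    refine ⟨2, ?_⟩
    rw [show (2 : ℤ) = ((2 : ℕ) : ℤ) by rfl, zpow_natCast, pow_two, Perm.mul_apply, h1, h2]
  have hsecond : numOrbits (swap (u, v) (u, rot u v) * (swap (v, u) (v, rot v u) * φ)) =
      numOrbits (swap (v, u) (v, rot v u) * φ) + (if rot u v = v then 0 else 1) := by
    split_ifs with hp
    · rw [hp, swap_self]; rfl
    · exact numOrbits_swap_mul_of_sameCycle (by simpa using fun hh => hp hh.symm) h3
  have hsame : SameCycle φ (v, u) (v, rot v u) ↔ SameCycle φ (u, v) (v, u) := by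
    rw [← hb, sameCycle_apply_right, sameCycle_comm]
  rw [hsecond]
  constructor
  · intro hs
    split_ifs with hp hq hq
    · rw [hq, swap_self]; rfl
    · rw [numOrbits_swap_mul_of_sameCycle (by simpa using fun hh => hq hh.symm) (hsame.2 hs)]
    · rw [hq, swap_self]; rfl
    · rw [numOrbits_swap_mul_of_sameCycle (by simpa using fun hh => hq hh.symm) (hsame.2 hs)]
  · intro hs
    have hp : ¬ rot u v = v := by
      intro hp
      refine hs (SameCycle.symm ⟨1, ?_⟩)
      rw [zpow_one, ha, hp]
    rw [if_neg hp]
    exact numOrbits_swap_mul_of_not_sameCycle fun hh => hs (hsame.1 hh)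

theorem IsRotation.isolated_iff {H H' : SimpleGraph W} {rot : W → Perm W} {u v : W}
    (h : IsRotation H rot) (hE : EdgeExt H' H u v) : (∀ y, ¬ H'.Adj u y) ↔ rot u v = v := by
  constructor
  · intro hh
    have h1 := h.adj hE.adj
    rcases (hE.adj_iff u _).1 h1 with h2 | h2 | h2
    · exact absurd h2 (hh _)
    · exact h2.2
    · exact absurd h2.1 hE.ne
  · intro hh y hy
    have h1 := h.cycle u v y hE.adj (hE.le hy)
    have h2 := h1.eq_of_left hh
    subst h2
    exact hE.not_adj hy

theorem IsRotation.numIsolated_del [Fintype W] {H H' : SimpleGraph W} {rot : W → Perm W} {u v : W}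
    (h : IsRotation H rot) (hE : EdgeExt H' H u v) :
    numIsolated H' = numIsolated H + (if rot u v = v then 1 else 0) +
      (if rot v u = u then 1 else 0) := by
  classical
  have key : ∀ x : W, (if ∀ y, ¬ H'.Adj x y then 1 else 0) = (if ∀ y, ¬ H.Adj x y then 1 else 0) +
      (if x = u then (if rot u v = v then 1 else 0) else 0) +
      (if x = v then (if rot v u = u then 1 else 0) else 0) := by
    intro x
    by_cases hxu : x = u
    · subst hxu
      have : ¬ ∀ y, ¬ H.Adj x y := fun hh => hh v hE.adj
      simp only [h.isolated_iff hE, if_neg this, if_neg hE.ne]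
      simp
    · by_cases hxv : x = v
      · subst hxv
        have : ¬ ∀ y, ¬ H.Adj x y := fun hh => hh u hE.adj.symm
        simp only [h.isolated_iff hE.symm, if_neg this, if_neg hxu]
        simp
      · have : ∀ y, H.Adj x y ↔ H'.Adj x y := by intro y; rw [hE.adj_iff]; tauto
        simp [hxu, hxv, this]
  rw [numIsolated, numIsolated, Finset.sum_congr rfl fun x _ => key x]
  simp [Finset.sum_add_distrib]

/-- If the two sides of an edge are different faces, the edge is not a bridge. -/
theorem IsRotation.reachable_of_not_sameCycle [Finite W] {H H' : SimpleGraph W} {rot : W → Perm W}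
    {u v : W} (h : IsRotation H rot) (hE : EdgeExt H' H u v)
    (hs : ¬ SameCycle (facePerm rot) (u, v) (v, u)) : H'.Reachable u v := by
  classical
  set φ := facePerm rot with hφ
  have hex : ∃ m : ℕ, 0 < m ∧ (φ ^ m) (u, v) = (u, v) :=
    ⟨orderOf φ, orderOf_pos φ, by rw [pow_orderOf_eq_one]; rfl⟩
  obtain ⟨hm0, hm⟩ := Nat.find_spec hex
  have hlt : ∀ j < Nat.find hex, 0 < j → (φ ^ j) (u, v) ≠ (u, v) :=
    fun j hj h0 hx => Nat.find_min hex hj ⟨h0, hx⟩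
  have hadj : ∀ j : ℕ, H.Adj ((φ ^ j) (u, v)).1 ((φ ^ j) (u, v)).2 := by
    intro j
    induction j with
    | zero => exact hE.adj
    | succ j ih => rw [pow_succ', Perm.mul_apply]; exact h.facePerm_adj ih
  have hreach : ∀ j < Nat.find hex, H'.Reachable v ((φ ^ (j + 1)) (u, v)).1 := by
    intro j
    induction j with
    | zero => intro _; exact Reachable.refl _
    | succ j ih =>
      intro hj
      refine (ih (by omega)).trans ?_
      have e1 : ((φ ^ (j + 1 + 1)) (u, v)).1 = ((φ ^ (j + 1)) (u, v)).2 := by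
        rw [pow_succ', Perm.mul_apply]; rfl
      rw [e1]
      refine Adj.reachable ?_
      rcases (hE.adj_iff _ _).1 (hadj (j + 1)) with h1 | h1 | h1
      · exact h1
      · exact absurd (Prod.ext h1.1 h1.2) (hlt (j + 1) hj (by omega))
      · exact absurd ⟨((j + 1 : ℕ) : ℤ), by rw [zpow_natCast]; exact Prod.ext h1.1 h1.2⟩ hs
  have := hreach (Nat.find hex - 1) (by omega)
  rw [Nat.sub_add_cancel hm0, hm] at this
  exact this.symm

variable [Fintype W]

theorem IsRotation.numOrbits_add_numIsolated_del {H H' : SimpleGraph W} {rot : W → Perm W} {u v : W}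
    (h : IsRotation H rot) (hE : EdgeExt H' H u v) :
    numOrbits (facePerm (delRot rot u v)) + numIsolated H' =
      numOrbits (facePerm rot) + numIsolated H + 2 ∨
    (numOrbits (facePerm (delRot rot u v)) + numIsolated H' =
      numOrbits (facePerm rot) + numIsolated H ∧ H'.Reachable u v) := by
  rw [h.numIsolated_del hE]
  by_cases hs : SameCycle (facePerm rot) (u, v) (v, u)
  · left
    rw [(numOrbits_delRot hE.ne).1 hs]
    split_ifs <;> omega
  · right
    refine ⟨?_, h.reachable_of_not_sameCycle hE hs⟩
    have hp : ¬ rot u v = v := by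
      intro hp
      refine hs (SameCycle.symm ⟨1, ?_⟩)
      rw [zpow_one, facePerm_apply, hp]
    have hq : ¬ rot v u = u := by
      intro hp
      refine hs ⟨1, ?_⟩
      rw [zpow_one, facePerm_apply, hp]
    rw [(numOrbits_delRot hE.ne).2 hs, if_neg hp, if_neg hq, add_zero, add_zero]

theorem EdgeExt.numClasses_le {H' H : SimpleGraph W} {u v : W} (hE : EdgeExt H' H u v) :
    H'.reachableSetoid.numClasses ≤ H.reachableSetoid.numClasses + 1 := by
  rw [hE.reachableSetoid_eq]
  by_cases h : H'.reachableSetoid u v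
  · rw [Setoid.glue_eq_self h]; omega
  · rw [← Setoid.numClasses_glue h]

theorem EdgeExt.numClasses_of_reachable {H' H : SimpleGraph W} {u v : W} (hE : EdgeExt H' H u v)
    (h : H'.Reachable u v) :
    H'.reachableSetoid.numClasses = H.reachableSetoid.numClasses := by
  rw [hE.reachableSetoid_eq, Setoid.glue_eq_self h]

theorem EdgeExt.numClasses_of_not_reachable {H' H : SimpleGraph W} {u v : W}
    (hE : EdgeExt H' H u v) (h : ¬ H'.Reachable u v) :
    H'.reachableSetoid.numClasses = H.reachableSetoid.numClasses + 1 := by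
  rw [hE.reachableSetoid_eq, ← Setoid.numClasses_glue h]

theorem PlanarRot.del {H H' : SimpleGraph W} {rot : W → Perm W} {u v : W}
    (h : PlanarRot H rot) (hE : EdgeExt H' H u v) : PlanarRot H' (delRot rot u v) := by
  refine ⟨h.toIsRotation.del hE, ?_⟩
  have h0 := h.euler
  rcases h.toIsRotation.numOrbits_add_numIsolated_del hE with h1 | ⟨h1, h2⟩
  · have := hE.numClasses_le
    omega
  · have := hE.numClasses_of_reachable h2
    omega

/-- Joining two components by an edge. -/
theorem PlanarRot.add_of_not_reachable {H H' : SimpleGraph W} {rot : W → Perm W} {u v c e : W}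
    (h : PlanarRot H' rot) (hE : EdgeExt H' H u v)
    (hc : H'.Adj u c ∨ (c = v ∧ ∀ x, ¬ H'.Adj u x))
    (he : H'.Adj v e ∨ (e = u ∧ ∀ x, ¬ H'.Adj v x)) (hr : ¬ H'.Reachable u v) :
    PlanarRot H (addRot rot u v c e) := by
  have hR := h.toIsRotation.add hE hc he
  refine ⟨hR, ?_⟩
  have h0 := h.euler
  have h1 := hR.numOrbits_add_numIsolated_del hE
  rw [delRot_addRot hE.ne (h.fixed u v hE.not_adj)
    (h.fixed v u fun hh => hE.not_adj hh.symm)] at h1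
  have := hE.numClasses_of_not_reachable hr
  rcases h1 with h1 | ⟨_, h2⟩
  · omega
  · exact absurd h2 hr

/-- Cutting off the corner at `w` between the consecutive neighbours `a` and `rot w a`. -/
theorem PlanarRot.add_triangle {H H' : SimpleGraph W} {rot : W → Perm W} {w a b : W}
    (h : PlanarRot H' rot) (hwa : H'.Adj w a) (hb : rot w a = b) (hE : EdgeExt H' H a b) :
    PlanarRot H (addRot rot a b w (rot b w)) := by
  have hwb : H'.Adj w b := hb ▸ h.toIsRotation.adj hwa
  have hbw : H'.Adj b (rot b w) := h.toIsRotation.adj hwb.symm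
  have hR := h.toIsRotation.add hE (Or.inl hwa.symm) (Or.inl hbw)
  refine ⟨hR, ?_⟩
  have h0 := h.euler
  have hfa : rot a b = b := h.fixed a b hE.not_adj
  have hfb : rot b a = a := h.fixed b a fun hh => hE.not_adj hh.symm
  have hwa' : w ≠ a := hwa.ne
  have hwb' : w ≠ b := hwb.ne
  have hab := hE.ne
  set φ := facePerm (addRot rot a b w (rot b w)) with hφ
  have e1 : φ (b, a) = (a, w) := by
    simp [hφ, addRot_left _ _ _ hab, hfa]
  have e2 : φ (a, w) = (w, b) := by
    simp [hφ, addRot_other _ _ _ hwa' hwb', hb]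
  have e3 : φ (w, b) = (b, a) := by
    simp [hφ, addRot_right]
  have hcl : ∀ n : ℕ, (φ ^ n) (b, a) ∈ ({(b, a), (a, w), (w, b)} : Set (W × W)) := by
    intro n
    induction n with
    | zero => simp
    | succ n ih =>
      rw [pow_succ', Perm.mul_apply]
      rcases ih with ih | ih | ih <;> rw [ih]
      · simp [e1]
      · simp [e2]
      · simp [e3]
  have hns : ¬ SameCycle φ (a, b) (b, a) := by
    intro hs
    obtain ⟨n, -, -, hn⟩ := hs.symm.exists_pow_eq''
    have := hcl n
    rw [hn] at this
    simp [hab, hwa'.symm, hwb'.symm] at this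
  have h1 := (numOrbits_delRot (rot := addRot rot a b w (rot b w)) hab).2 hns
  have h2 := hR.numIsolated_del hE
  rw [delRot_addRot hab hfa hfb] at h1
  have h3 : H.reachableSetoid.numClasses ≤ H'.reachableSetoid.numClasses :=
    Setoid.numClasses_anti fun x y hxy => Reachable.mono hE.le hxy
  have h4 : ¬ addRot rot a b w (rot b w) a b = b := fun hh =>
    ((hR.isolated_iff hE).2 hh) w hwa.symm
  have h5 : ¬ addRot rot a b w (rot b w) b a = a := fun hh =>
    ((hR.isolated_iff hE.symm).2 hh) w hwb.symm
  rw [if_neg h4, if_neg h5] at h2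
  rw [← hφ] at h1
  omega

end Rotation

/-! ### Operations on planar rotation systems -/

section PlanarOps
set_option linter.unusedSectionVars false
open Equiv Equiv.Perm
variable {W : Type*} [DecidableEq W] [Fintype W]

/-- A finite graph is combinatorially planar if it has a rotation system of genus zero. -/
def CombPlanar (H : SimpleGraph W) : Prop := ∃ rot : W → Perm W, PlanarRot H rot

theorem edgeExt_deleteEdges {H : SimpleGraph W} {u v : W} (h : H.Adj u v) :
    EdgeExt (H.deleteEdges {s(u, v)}) H u v := by
  refine ⟨h.ne, by simp, fun x y => ?_⟩
  simp only [deleteEdges_adj, Set.mem_singleton_iff, Sym2.eq_iff]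
  constructor
  · intro hxy; tauto
  · rintro (h1 | ⟨rfl, rfl⟩ | ⟨rfl, rfl⟩)
    · exact h1.1
    · exact h
    · exact h.symm

theorem edgeExt_sup_edge {H : SimpleGraph W} {u v : W} (hne : u ≠ v) (h : ¬ H.Adj u v) :
    EdgeExt H (H ⊔ edge u v) u v := by
  refine ⟨hne, h, fun x y => ?_⟩
  rw [sup_adj, edge_adj]
  constructor
  · tauto
  · rintro (h1 | ⟨rfl, rfl⟩ | ⟨rfl, rfl⟩)
    · exact Or.inl h1
    · exact Or.inr ⟨Or.inl ⟨rfl, rfl⟩, hne⟩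
    · exact Or.inr ⟨Or.inr ⟨rfl, rfl⟩, hne.symm⟩

theorem CombPlanar.mono {H T : SimpleGraph W} (h : CombPlanar H) (hT : T ≤ H) : CombPlanar T := by
  classical
  induction hn : (Finset.univ.filter fun p : W × W => H.Adj p.1 p.2 ∧ ¬ T.Adj p.1 p.2).card
    using Nat.strong_induction_on generalizing H with
  | _ n ih =>
    by_cases hex : ∃ u v, H.Adj u v ∧ ¬ T.Adj u v
    · obtain ⟨u, v, huv, hT'⟩ := hex
      have hE := edgeExt_deleteEdges huv
      obtain ⟨rot, hrot⟩ := h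
      refine ih _ ?_ ⟨_, hrot.del hE⟩ ?_ rfl
      · rw [← hn]
        refine Finset.card_lt_card ⟨?_, ?_⟩
        · intro p hp
          simp only [Finset.mem_filter, Finset.mem_univ, true_and] at hp ⊢
          exact ⟨hE.le hp.1, hp.2⟩
        · intro hsub
          have := hsub (x := (u, v)) (by simp [huv, hT'])
          simp at this
      · intro x y hxy
        have hxy' := hT hxy
        rw [deleteEdges_adj, Set.mem_singleton_iff, Sym2.eq_iff]
        refine ⟨hxy', ?_⟩
        rintro (⟨rfl, rfl⟩ | ⟨rfl, rfl⟩)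
        · exact hT' hxy
        · exact hT' hxy.symm
    · have : T = H := by
        refine le_antisymm hT fun x y hxy => ?_
        by_contra hh
        exact hex ⟨x, y, hxy, hh⟩
      rwa [this]

theorem planarRot_bot : PlanarRot (⊥ : SimpleGraph W) (fun _ => 1) := by
  classical
  refine ⟨⟨fun _ _ _ => rfl, fun _ _ _ h => absurd h (by simp)⟩, ?_⟩
  have h1 : (⊥ : SimpleGraph W).reachableSetoid.numClasses ≤ Fintype.card W := by
    rw [Setoid.numClasses, ← Nat.card_eq_fintype_card]
    exact Nat.card_le_card_of_surjective (fun a => Quotient.mk _ a) Quotient.mk_surjective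
  have h2 : numIsolated (⊥ : SimpleGraph W) = Fintype.card W := by
    simp [numIsolated]
  have hφ : ∀ p : W × W, facePerm (fun _ : W => (1 : Perm W)) p = (p.2, p.1) := fun p => rfl
  have hcl : ∀ p q : W × W, SameCycle (facePerm (fun _ : W => (1 : Perm W))) q p →
      q = p ∨ q = (p.2, p.1) := by
    intro p q hq
    obtain ⟨n, -, -, hn⟩ := hq.symm.exists_pow_eq''
    subst hn
    clear hq
    induction n with
    | zero => left; rfl
    | succ n ih =>
      rw [pow_succ', Perm.mul_apply]
      rcases ih with ih | ih <;> rw [ih, hφ]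
      · right; rfl
      · left; rfl
  have h3 : (Fintype.card W * Fintype.card W + Fintype.card W : ℚ) ≤
      2 * (numOrbits (facePerm (fun _ : W => (1 : Perm W))) : ℚ) := by
    rw [numOrbits, Setoid.numClasses_eq_sum, Finset.mul_sum]
    have key : ∀ p : W × W, (1 + if p.1 = p.2 then 1 else 0 : ℚ) ≤ 2 * (1 / (Nat.card
        {b // SameCycle.setoid (facePerm (fun _ : W => (1 : Perm W))) b p} : ℚ)) := by
      intro p
      have hpos : 0 < Nat.card
          {b // SameCycle.setoid (facePerm (fun _ : W => (1 : Perm W))) b p} := by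
        have : Nonempty {b // SameCycle.setoid (facePerm (fun _ : W => (1 : Perm W))) b p} :=
          ⟨⟨p, Setoid.refl' _ p⟩⟩
        exact Nat.card_pos
      have hle : Nat.card
          {b // SameCycle.setoid (facePerm (fun _ : W => (1 : Perm W))) b p} ≤
          if p.1 = p.2 then 1 else 2 := by
        have : Nat.card
          {b // SameCycle.setoid (facePerm (fun _ : W => (1 : Perm W))) b p} ≤
            ({p, (p.2, p.1)} : Finset (W × W)).card := by
          rw [Nat.card_eq_fintype_card, Fintype.card_subtype]
          refine Finset.card_le_card fun q hq => ?_
          have := hcl p q (Finset.mem_filter.1 hq).2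
          simpa using this
        refine this.trans ?_
        split_ifs with hp
        · have : (p.2, p.1) = p := Prod.ext hp.symm hp
          rw [this]; simp
        · exact Finset.card_le_two
      have hpos' : (0 : ℚ) < (Nat.card
          {b // SameCycle.setoid (facePerm (fun _ : W => (1 : Perm W))) b p} : ℚ) := by
        exact_mod_cast hpos
      have hle' : ((Nat.card {b // SameCycle.setoid (facePerm (fun _ : W => (1 : Perm W))) b p} : ℕ)
          : ℚ) ≤ ((if p.1 = p.2 then 1 else 2 : ℕ) : ℚ) := by exact_mod_cast hle
      rw [mul_one_div, le_div_iff₀ hpos']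
      split_ifs at hle' ⊢ <;> push_cast at hle' <;> linarith
    refine le_trans (le_of_eq ?_) (Finset.sum_le_sum fun p _ => key p)
    rw [Finset.sum_add_distrib, Fintype.sum_prod_type, Fintype.sum_prod_type]
    simp
  have h4 : Fintype.card W * Fintype.card W + Fintype.card W ≤
      2 * numOrbits (facePerm (fun _ : W => (1 : Perm W))) := by exact_mod_cast h3
  omega

/-- Around a vertex all pairs of consecutive neighbours can be joined. -/
theorem PlanarRot.exists_wheel {H : SimpleGraph W} {rot : W → Perm W} (h : PlanarRot H rot) (w : W) :
    ∃ K, CombPlanar K ∧ H ≤ K ∧ ∀ a, H.Adj w a → a ≠ rot w a → K.Adj a (rot w a) := by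
  classical
  suffices hS : ∀ S : Finset W, ∃ K rot', PlanarRot K rot' ∧ H ≤ K ∧ rot' w = rot w ∧
      ∀ a ∈ S, H.Adj w a → a ≠ rot w a → K.Adj a (rot w a) by
    obtain ⟨K, rot', h1, h2, _, h4⟩ := hS Finset.univ
    exact ⟨K, ⟨rot', h1⟩, h2, fun a => h4 a (Finset.mem_univ a)⟩
  intro S
  induction S using Finset.induction_on with
  | empty => exact ⟨H, rot, h, le_rfl, rfl, by simp⟩
  | insert a S _ ih =>
    obtain ⟨K, rot', h1, h2, h3, h4⟩ := ih
    by_cases hskip : H.Adj w a ∧ a ≠ rot w a ∧ ¬ K.Adj a (rot w a)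
    · obtain ⟨hwa, hne, hnadj⟩ := hskip
      have hE := edgeExt_sup_edge hne hnadj
      have hwb : H.Adj w (rot w a) := h.toIsRotation.adj hwa
      refine ⟨_, _, h1.add_triangle (h2 hwa) (by rw [h3]) hE, h2.trans hE.le, ?_, ?_⟩
      · rw [addRot_other _ _ _ hwa.ne hwb.ne, h3]
      · intro c hc hwc hcne
        rcases Finset.mem_insert.1 hc with rfl | hc
        · exact hE.adj
        · exact hE.le (h4 c hc hwc hcne)
    · refine ⟨K, rot', h1, h2, h3, fun c hc hwc hcne => ?_⟩
      rcases Finset.mem_insert.1 hc with rfl | hc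
      · by_contra hh; exact hskip ⟨hwc, hcne, hh⟩
      · exact h4 c hc hwc hcne

theorem CombPlanar.exists_contract {H : SimpleGraph W} (h : CombPlanar H) {u v : W}
    (huv : H.Adj u v) : ∃ K, CombPlanar K ∧ (∀ x y, x ≠ v → y ≠ v → H.Adj x y → K.Adj x y) ∧
      ∀ y, y ≠ u → H.Adj v y → K.Adj u y := by
  classical
  induction hn : (Finset.univ.filter fun y : W => H.Adj v y).card
    using Nat.strong_induction_on generalizing H with
  | _ n ih =>
    obtain ⟨rot, hrot⟩ := h
    by_cases hx : rot v u = u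
    · refine ⟨H, ⟨rot, hrot⟩, fun _ _ _ _ h => h, fun y hy hvy => ?_⟩
      exact absurd ((hrot.cycle v u y huv.symm hvy).eq_of_left hx).symm hy
    · set x := rot v u with hxdef
      have hvx : H.Adj v x := hrot.toIsRotation.adj huv.symm
      obtain ⟨H1, rot1, hrot1, hle, hux, hv⟩ : ∃ H1 rot1, PlanarRot H1 rot1 ∧ H ≤ H1 ∧ H1.Adj u x ∧
          ∀ y, H1.Adj v y ↔ H.Adj v y := by
        by_cases hux : H.Adj u x
        · exact ⟨H, rot, hrot, le_rfl, hux, fun y => Iff.rfl⟩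
        · have hE := edgeExt_sup_edge (Ne.symm hx) hux
          refine ⟨_, _, hrot.add_triangle huv.symm hxdef.symm hE, hE.le, hE.adj, fun y => ?_⟩
          rw [hE.adj_iff]
          have h1 := huv.ne
          have h2 := hvx.ne
          tauto
      have hE := edgeExt_deleteEdges (hle hvx)
      have hdel : ∀ p q, H1.Adj p q → ¬ (p = v ∧ q = x) → ¬ (p = x ∧ q = v) →
          (H1.deleteEdges {s(v, x)}).Adj p q := by
        intro p q hpq h1 h2
        rcases (hE.adj_iff p q).1 hpq with h3 | h3 | h3
        · exact h3
        · exact absurd h3 h1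
        · exact absurd h3 h2
      have huv2 : (H1.deleteEdges {s(v, x)}).Adj u v :=
        hdel u v (hle huv) (fun h => huv.ne h.1) (fun h => hx h.1.symm)
      have hlt : (Finset.univ.filter fun y : W => (H1.deleteEdges {s(v, x)}).Adj v y).card < n := by
        rw [← hn]
        refine Finset.card_lt_card ⟨?_, ?_⟩
        · intro y hy
          simp only [Finset.mem_filter, Finset.mem_univ, true_and] at hy ⊢
          exact (hv y).1 (hE.le hy)
        · intro hsub
          have := hsub (x := x) (by simp [hvx])
          simp at this
      obtain ⟨K, hK, hK1, hK2⟩ := ih _ hlt ⟨_, hrot1.del hE⟩ huv2 (by congr!)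
      refine ⟨K, hK, fun p q hp hq hpq => ?_, fun y hy hvy => ?_⟩
      · exact hK1 p q hp hq (hdel p q (hle hpq) (fun h => hp h.1) (fun h => hq h.2))
      · by_cases hyx : y = x
        · rw [hyx]
          exact hK1 u x huv.ne hvx.ne.symm
            (hdel u x hux (fun h => huv.ne h.1) (fun h => hvx.ne h.2.symm))
        · exact hK2 y hy (hdel v y (hle hvy) (fun h => hyx h.2) (fun h => hvx.ne h.1))

end PlanarOps

/-! ### A planar triangular lattice -/

section Lattice
set_option linter.unusedSectionVars false
open Equiv Equiv.Perm
variable {W : Type*} [DecidableEq W] [Fintype W]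

theorem not_reachable_of_isolated {H : SimpleGraph W} {y z : W} (hne : y ≠ z)
    (hz : ∀ x, ¬ H.Adj z x) : ¬ H.Reachable y z := by
  intro h
  obtain ⟨p⟩ := h.symm
  cases p with
  | nil => exact hne rfl
  | cons hadj _ => exact hz _ hadj

/-- Placing a new vertex `z` over the corner of `y` between `w` and `x = rot y w`. -/
theorem PlanarRot.exists_cap {H : SimpleGraph W} {rot : W → Perm W} (h : PlanarRot H rot)
    {x y w z : W} (hyw : H.Adj y w) (hyx : rot y w = x) (hxw : x ≠ w) (hz : ∀ a, ¬ H.Adj z a) :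
    ∃ H' rot', PlanarRot H' rot' ∧ H ≤ H' ∧ H'.Adj z x ∧ H'.Adj z y ∧ H'.Adj z w ∧
      (∀ a b, H'.Adj a b → H.Adj a b ∨ a = z ∨ b = z) ∧
      (∀ a, H'.Adj z a → a = x ∨ a = y ∨ a = w) ∧ rot' z w = x ∧ rot' x z = rot x y ∧
      (∀ c, rot w c = y → rot' w c = z) ∧
      ∀ v, v ≠ x → v ≠ y → v ≠ w → v ≠ z → rot' v = rot v := by
  have hyx' : H.Adj y x := hyx ▸ h.toIsRotation.adj hyw
  have hyz : y ≠ z := by rintro rfl; exact hz _ hyw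
  have hxz : x ≠ z := by rintro rfl; exact hz _ hyx'.symm
  have hwz : w ≠ z := by rintro rfl; exact hz _ hyw.symm
  have hyw' := hyw.ne
  have hyxn := hyx'.ne
  have hnz : ∀ a, ¬ H.Adj a z := fun a ha => hz a ha.symm
  have E1 := edgeExt_sup_edge hyz (hnz y)
  have P1 := h.add_of_not_reachable (c := x) (e := y) E1 (Or.inl hyx') (Or.inr ⟨rfl, hz⟩)
    (not_reachable_of_isolated hyz hz)
  set H1 := H ⊔ edge y z with hH1
  set rot1 := addRot rot y z x y with hrot1
  have r1y : rot1 y = swap z x * rot y := addRot_left _ _ _ hyz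
  have r1z : rot1 z = rot z := by rw [hrot1, addRot_right, swap_self]; rfl
  have r1o : ∀ v, v ≠ y → v ≠ z → rot1 v = rot v := fun v h1 h2 => addRot_other _ _ _ h1 h2
  have n1 : ¬ H1.Adj z x := by
    rw [E1.adj_iff]
    rintro (h1 | h1 | h1)
    · exact hz _ h1
    · exact hyz h1.1.symm
    · exact hyxn h1.2.symm
  have e1 : rot1 y z = x := by rw [r1y, Perm.mul_apply, h.fixed y z (hnz y), swap_apply_left]
  have E2 := edgeExt_sup_edge hxz.symm n1
  have P2 := P1.add_triangle E1.adj e1 E2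
  set H2 := H1 ⊔ edge z x with hH2
  set rot2 := addRot rot1 z x y (rot1 x y) with hrot2
  have r2z : rot2 z = swap x y * rot z := by rw [hrot2, addRot_left _ _ _ hxz.symm, r1z]
  have r2x : rot2 x = swap z (rot x y) * rot x := by
    rw [hrot2, addRot_right, r1o x hyxn.symm hxz]
  have r2o : ∀ v, v ≠ z → v ≠ x → rot2 v = rot1 v := fun v h1 h2 => addRot_other _ _ _ h1 h2
  have e2 : rot2 y w = z := by
    rw [r2o y hyz hyxn, r1y, Perm.mul_apply, hyx, swap_apply_right]
  have n2 : ¬ H2.Adj w z := by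
    rw [E2.adj_iff, E1.adj_iff]
    rintro ((h1 | h1 | h1) | h1 | h1)
    · exact hnz _ h1
    · exact hyw' h1.1.symm
    · exact hwz h1.1
    · exact hwz h1.1
    · exact hxw h1.1.symm
  have E3 := edgeExt_sup_edge hwz n2
  have P3 := P2.add_triangle (E2.le (E1.le hyw)) e2 E3
  have fz : ∀ a, rot z a = a := fun a => h.fixed z a (hz a)
  have e3 : rot2 z y = x := by rw [r2z, Perm.mul_apply, fz, swap_apply_right]
  rw [e3] at P3
  refine ⟨_, _, P3, (E1.le.trans E2.le).trans E3.le, E3.le E2.adj, E3.le (E2.le E1.adj.symm),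
    E3.adj.symm, ?_, ?_, ?_, ?_, ?_, ?_⟩
  · intro a b hab
    rw [E3.adj_iff, E2.adj_iff, E1.adj_iff] at hab
    tauto
  · intro a ha
    rw [E3.adj_iff, E2.adj_iff, E1.adj_iff] at ha
    have := hz a
    tauto
  · rw [addRot_right, Perm.mul_apply, r2z, Perm.mul_apply, fz,
      swap_apply_of_ne_of_ne hxw.symm hyw'.symm, swap_apply_left]
  · rw [addRot_other _ _ _ hxw hxz, r2x, Perm.mul_apply, h.fixed x z (hnz x), swap_apply_left]
  · intro c hc
    rw [addRot_left _ _ _ hwz, Perm.mul_apply, r2o w hwz hxw.symm, r1o w hyw'.symm hwz, hc,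
      swap_apply_right]
  · intro v h1 h2 h3 h4
    rw [addRot_other _ _ _ h3 h4, r2o v h4 h1, r1o v h2 h4]

/-- A path as a planar rotation system. -/
theorem exists_planarRot_path (q : ℕ → W) (N : ℕ)
    (hq : ∀ i j, i ≤ N → j ≤ N → q i = q j → i = j) :
    ∃ H rot, PlanarRot H rot ∧ (∀ i < N, H.Adj (q i) (q (i + 1))) ∧
      (∀ a b, H.Adj a b → ∃ i ≤ N, a = q i) ∧
      (∀ a, H.Adj (q N) a → ∃ i, i + 1 = N ∧ a = q i) ∧
      ∀ i, i + 1 < N → rot (q (i + 1)) (q (i + 2)) = q i := by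
  induction N with
  | zero =>
    exact ⟨⊥, _, planarRot_bot, by simp, by simp, by simp, by simp⟩
  | succ N ih =>
    obtain ⟨H, rot, h1, h2, h3, h4, h5⟩ := ih fun i j hi hj => hq i j (by omega) (by omega)
    have hz : ∀ a, ¬ H.Adj (q (N + 1)) a := by
      intro a ha
      obtain ⟨i, hi, hi'⟩ := h3 _ _ ha
      have := hq _ _ (by omega) (by omega) hi'
      omega
    have hne : q N ≠ q (N + 1) := fun hh => by
      have := hq _ _ (by omega) (by omega) hh
      omega
    have E := edgeExt_sup_edge hne fun hh => hz _ hh.symm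
    have hN : (∀ x, ¬ H.Adj (q N) x) ∨ ∃ M, M + 1 = N ∧ H.Adj (q N) (q M) := by
      rcases N with _ | M
      · left; intro x hx
        obtain ⟨i, hi, _⟩ := h4 x hx
        omega
      · exact Or.inr ⟨M, rfl, (h2 M (by omega)).symm⟩
    obtain ⟨c, hc, hc'⟩ : ∃ c, (H.Adj (q N) c ∨ (c = q (N + 1) ∧ ∀ x, ¬ H.Adj (q N) x)) ∧
        ∀ M, M + 1 = N → c = q M := by
      rcases hN with hN | ⟨M, hM, hM'⟩
      · refine ⟨q (N + 1), Or.inr ⟨rfl, hN⟩, ?_⟩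
        rintro M rfl
        exact absurd (h2 M (by omega)).symm (hN _)
      · refine ⟨q M, Or.inl hM', ?_⟩
        intro M' hM'
        rw [show M' = M by omega]
    have P := h1.add_of_not_reachable (c := c) (e := q N) E hc (Or.inr ⟨rfl, hz⟩)
      (not_reachable_of_isolated hne hz)
    refine ⟨_, _, P, ?_, ?_, ?_, ?_⟩
    · intro i hi
      by_cases hiN : i = N
      · subst hiN; exact E.adj
      · exact E.le (h2 i (by omega))
    · intro a b hab
      rcases (E.adj_iff a b).1 hab with hh | hh | hh
      · obtain ⟨i, hi, hi'⟩ := h3 _ _ hh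
        exact ⟨i, by omega, hi'⟩
      · exact ⟨N, by omega, hh.1⟩
      · exact ⟨N + 1, le_rfl, hh.1⟩
    · intro a ha
      rcases (E.adj_iff _ a).1 ha with hh | hh | hh
      · exact absurd hh (hz a)
      · exact absurd hh.1.symm hne
      · exact ⟨N, rfl, hh.2⟩
    · intro i hi
      by_cases hiN : i + 1 = N
      · have := hc' i hiN
        subst hiN
        rw [addRot_left _ _ _ hne, Perm.mul_apply, h1.fixed _ _ fun hh => hz _ hh.symm,
          swap_apply_left, this]
      · rw [addRot_other]
        · exact h5 i (by omega)
        · intro hh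
          exact hiN (hq _ _ (by omega) (by omega) hh)
        · intro hh
          have := hq _ _ (by omega) (by omega) hh
          omega

/-- The part of the triangular lattice on and below the frontier `f` has been built. -/
structure LatticeState (P : ℕ → ℕ → W) (N : ℕ) (f : ℕ → ℕ) (H : SimpleGraph W)
    (rot : W → Perm W) : Prop where
  planar : PlanarRot H rot
  parity : ∀ i, f i % 2 = i % 2
  step : ∀ i < N, f (i + 1) = f i + 1 ∨ f i = f (i + 1) + 1
  isolated : ∀ i h, i ≤ N → h ≤ N → f i < h → ∀ a, ¬ H.Adj (P i h) a
  vert : ∀ i h, i ≤ N → h % 2 = i % 2 → h + 2 ≤ f i → H.Adj (P i h) (P i (h + 2))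
  diag : ∀ i h h', i < N → h % 2 = i % 2 → h ≤ f i → h' ≤ f (i + 1) → (h' = h + 1 ∨ h = h' + 1) →
    H.Adj (P i h) (P (i + 1) h')
  front : ∀ i, i + 1 < N → rot (P (i + 1) (f (i + 1))) (P (i + 2) (f (i + 2))) = P i (f i)

theorem LatticeState.raise {P : ℕ → ℕ → W} {N : ℕ} {f : ℕ → ℕ} {H : SimpleGraph W}
    {rot : W → Perm W} (hS : LatticeState P N f H rot)
    (hP : ∀ i j h h', i ≤ N → j ≤ N → h ≤ N → h' ≤ N → P i h = P j h' → i = j ∧ h = h')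
    {k : ℕ} (hk : k + 1 < N) (h0 : f k = f (k + 1) + 1) (h2 : f (k + 2) = f (k + 1) + 1)
    (hN : f (k + 1) + 2 ≤ N) (hfN : ∀ i ≤ N, f i ≤ N) :
    ∃ H' rot', LatticeState P N (Function.update f (k + 1) (f (k + 1) + 2)) H' rot' := by
  set m := f (k + 1) with hm
  have hyw : H.Adj (P (k + 1) m) (P (k + 2) (m + 1)) :=
    hS.diag (k + 1) m (m + 1) hk (by rw [hm]; exact hS.parity _) le_rfl (by rw [h2]) (Or.inl rfl)
  have hyx : rot (P (k + 1) m) (P (k + 2) (m + 1)) = P k (m + 1) := by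
    have := hS.front k hk
    rwa [h2, h0] at this
  have hxw : P k (m + 1) ≠ P (k + 2) (m + 1) := by
    intro hh
    have := (hP _ _ _ _ (by omega) (by omega) (by omega) (by omega) hh).1
    omega
  have hz := hS.isolated (k + 1) (m + 2) (by omega) hN (by omega)
  obtain ⟨H', rot', p1, p2, p3, p4, p5, p6, p7, p8, p9, p10, p11⟩ :=
    hS.planar.exists_cap hyw hyx hxw hz
  have hfne : ∀ i, i ≠ k + 1 → Function.update f (k + 1) (m + 2) i = f i :=
    fun i hi => Function.update_of_ne hi _ _
  have hfk : Function.update f (k + 1) (m + 2) (k + 1) = m + 2 := Function.update_self _ _ _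
  refine ⟨H', rot', p1, ?_, ?_, ?_, ?_, ?_, ?_⟩
  · intro i
    by_cases hi : i = k + 1
    · subst hi
      rw [hfk, Nat.add_mod_right, hm]
      exact hS.parity _
    · rw [hfne i hi]; exact hS.parity i
  · intro i hi
    by_cases hi1 : i = k + 1
    · subst hi1
      rw [hfk, hfne _ (by omega)]
      right; rw [show k + 1 + 1 = k + 2 by rfl, h2]
    · by_cases hi2 : i = k
      · subst hi2
        rw [hfk, hfne _ (by omega)]
        left; rw [h0]
      · rw [hfne i hi1, hfne (i + 1) (by omega)]
        exact hS.step i hi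
  · intro i h hi hh hlt a ha
    have hle : f i < h := by
      by_cases hi1 : i = k + 1
      · subst hi1; rw [hfk] at hlt; omega
      · rwa [hfne i hi1] at hlt
    have hne : P i h ≠ P (k + 1) (m + 2) := by
      intro hh'
      obtain ⟨rfl, rfl⟩ := hP _ _ _ _ hi (by omega) hh hN hh'
      rw [hfk] at hlt
      omega
    rcases p6 _ _ ha with hh' | hh' | hh'
    · exact hS.isolated i h hi hh hle a hh'
    · exact hne hh'
    · rw [hh'] at ha
      rcases p7 _ ha.symm with h' | h' | h'
      · have := hP _ _ _ _ hi (by omega) hh (by omega) h'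
        rw [this.1, this.2, h0] at hle
        omega
      · have := hP _ _ _ _ hi (by omega) hh (by omega) h'
        rw [this.1, this.2] at hle
        omega
      · have := hP _ _ _ _ hi (by omega) hh (by omega) h'
        rw [this.1, this.2, h2] at hle
        omega
  · intro i h hi hpar hle
    by_cases hi1 : i = k + 1
    · subst hi1
      rw [hfk] at hle
      by_cases hhm : h = m
      · subst hhm; exact p4.symm
      · have := hS.parity (k + 1)
        exact p2 (hS.vert _ h hi hpar (by omega))
    · rw [hfne i hi1] at hle
      exact p2 (hS.vert i h hi hpar hle)
  · intro i h h' hi hpar hle hle' hstep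
    have par := hS.parity (k + 1)
    by_cases hi1 : i = k + 1
    · subst hi1
      rw [hfk] at hle
      rw [hfne _ (by omega)] at hle'
      by_cases hhm : h = m + 2
      · subst hhm
        have : h' = m + 1 := by rw [show k + 1 + 1 = k + 2 by rfl, h2] at hle'; omega
        subst this
        exact p5
      · exact p2 (hS.diag _ h h' hi hpar (by omega) hle' hstep)
    · by_cases hi2 : i = k
      · subst hi2
        rw [hfk] at hle'
        rw [hfne _ (by omega)] at hle
        by_cases hhm : h' = m + 2
        · subst hhm
          have : h = m + 1 := by rw [h0] at hle; omega
          subst this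
          exact p3.symm
        · exact p2 (hS.diag _ h h' hi hpar hle (by omega) hstep)
      · rw [hfne i hi1] at hle
        rw [hfne (i + 1) (by omega)] at hle'
        exact p2 (hS.diag i h h' hi hpar hle hle' hstep)
  · intro i hi
    by_cases hi1 : i = k + 1
    · subst hi1
      have hf := hS.front _ hi
      rw [hfk, hfne _ (by omega), hfne _ (by omega)]
      rw [show k + 1 + 1 = k + 2 by rfl, h2] at hf ⊢
      exact p10 _ hf
    · by_cases hi2 : i = k
      · subst hi2
        rw [hfk, hfne _ (by omega), hfne _ (by omega), h0, h2]
        exact p8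
      · by_cases hi3 : i + 1 = k
        · subst hi3
          have hf := hS.front _ hi
          rw [show i + 2 = i + 1 + 1 by rfl] at hf ⊢
          rw [hfne (i + 1) (by omega), hfne i (by omega), hfk, h0, p9, ← hf, h0, hm]
        · rw [hfne _ (by omega), hfne _ (by omega), hfne _ (by omega), p11]
          · exact hS.front i hi
          all_goals
            intro hh
            have := hP _ _ _ _ (by omega) (by omega) (hfN _ (by omega)) (by omega) hh
            omega

theorem exists_latticeState_pyramid (P : ℕ → ℕ → W) (n : ℕ)
    (hP : ∀ i j h h', i ≤ 2 * n → j ≤ 2 * n → h ≤ 2 * n → h' ≤ 2 * n → P i h = P j h' →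
      i = j ∧ h = h') :
    ∃ f H rot, LatticeState P (2 * n) f H rot ∧ ∀ i ≤ 2 * n, f i = min i (2 * n - i) := by
  classical
  suffices hind : ∀ d f H rot, LatticeState P (2 * n) f H rot →
      (∀ i ≤ 2 * n, f i ≤ min i (2 * n - i)) →
      ∑ i ∈ Finset.range (2 * n + 1), (min i (2 * n - i) - f i) = d →
      ∃ f H rot, LatticeState P (2 * n) f H rot ∧ ∀ i ≤ 2 * n, f i = min i (2 * n - i) by
    obtain ⟨H, rot, h1, h2, h3, -, h5⟩ := exists_planarRot_path (fun i => P i (i % 2)) (2 * n)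
      (fun i j hi hj hij => by
        have hi2 : i % 2 ≤ 2 * n := (Nat.mod_le i 2).trans hi
        have hj2 : j % 2 ≤ 2 * n := (Nat.mod_le j 2).trans hj
        exact (hP _ _ _ _ hi hj hi2 hj2 hij).1)
    refine hind _ (fun i => i % 2) H rot ⟨h1, fun i => Nat.mod_mod _ _, ?_, ?_, ?_, ?_, h5⟩ ?_ rfl
    · intro i _; omega
    · intro i h hi hh hlt a ha
      obtain ⟨j, hj, hj'⟩ := h3 _ _ ha
      have := hP _ _ _ _ hi hj hh (by omega) hj'
      rw [this.1, this.2] at hlt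
      omega
    · intro i h _ _ hle
      omega
    · intro i h h' hi hpar hle hle' hs
      rw [show h = i % 2 by omega, show h' = (i + 1) % 2 by omega]
      exact h2 i hi
    · intro i hi; omega
  intro d
  induction d using Nat.strong_induction_on with
  | _ d ih =>
    intro f H rot hS hle hd
    by_cases hex : ∃ i, i ≤ 2 * n ∧ f i < min i (2 * n - i)
    · have hex' : ∃ m, ∃ i, i ≤ 2 * n ∧ f i < min i (2 * n - i) ∧ f i = m :=
        let ⟨i, h1, h2⟩ := hex; ⟨_, i, h1, h2, rfl⟩
      obtain ⟨i, hi, hlt, hmin⟩ := Nat.find_spec hex'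
      have hmin' : ∀ j, j ≤ 2 * n → f j < min j (2 * n - j) → f i ≤ f j := by
        intro j h1 h2
        rw [hmin]
        exact Nat.find_min' hex' ⟨j, h1, h2, rfl⟩
      obtain ⟨k, rfl⟩ : ∃ k, i = k + 1 := ⟨i - 1, by omega⟩
      have hk : k + 1 < 2 * n := by omega
      have pk := hS.parity (k + 1)
      have h0 : f k = f (k + 1) + 1 := by
        rcases hS.step k (by omega) with h | h
        · have := hmin' k (by omega) (by omega)
          omega
        · exact h
      have h2 : f (k + 2) = f (k + 1) + 1 := by
        rcases hS.step (k + 1) hk with h | h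
        · exact h
        · rw [show k + 1 + 1 = k + 2 by rfl] at h
          have := hmin' (k + 2) (by omega) (by omega)
          omega
      obtain ⟨H', rot', hS'⟩ := hS.raise hP hk h0 h2 (by omega)
        (fun i hi => (hle i hi).trans (by omega))
      refine ih _ ?_ _ H' rot' hS' ?_ rfl
      · rw [← hd]
        refine Finset.sum_lt_sum ?_ ⟨k + 1, Finset.mem_range.2 (by omega), ?_⟩
        · intro j _
          by_cases hj : j = k + 1
          · subst hj; rw [Function.update_self]; omega
          · rw [Function.update_of_ne hj]
        · rw [Function.update_self]; omega
      · intro j hj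
        by_cases hj' : j = k + 1
        · subst hj'; rw [Function.update_self]; omega
        · rw [Function.update_of_ne hj']; exact hle j hj
    · refine ⟨f, H, rot, hS, fun i hi => le_antisymm (hle i hi) ?_⟩
      by_contra hh
      exact hex ⟨i, hi, by omega⟩

end Lattice

section Minor

open Equiv Relation

variable {W : Type*} [Fintype W] [DecidableEq W]

/-- Contracting connected branch sets: a minor of a combinatorially planar graph is
combinatorially planar, up to relabelling by representatives. -/
theorem CombPlanar.exists_minor {V : Type*} (G : SimpleGraph V) (k : ℕ) {H : SimpleGraph W}
    (hH : CombPlanar H) (m : W → Option V) (hk : Nat.card {x // m x ≠ none} = k)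
    (hne : ∀ v, ∃ x, m x = some v)
    (hconn : ∀ v x y, m x = some v → m y = some v →
      ReflTransGen (fun a b => H.Adj a b ∧ m a = some v ∧ m b = some v) x y)
    (hadj : ∀ u v, G.Adj u v → ∃ x y, m x = some u ∧ m y = some v ∧ H.Adj x y) :
    ∃ r : V ↪ W, CombPlanar (G.map r) := by
  induction k using Nat.strong_induction_on generalizing H m with
  | _ k ih =>
    by_cases hs : ∃ v x y, m x = some v ∧ m y = some v ∧ x ≠ y
    · obtain ⟨v, x, y, hx, hy, hxy⟩ := hs
      obtain ⟨z, hxz, hz⟩ : ∃ z, H.Adj x z ∧ m z = some v := by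
        rcases (hconn v x y hx hy).cases_head with h | ⟨z, h, -⟩
        · exact absurd h hxy
        · exact ⟨z, h.1, h.2.2⟩
      obtain ⟨K, hK, h1, h2⟩ := hH.exists_contract hxz.symm
      set c : W → W := fun a => if a = x then z else a with hc
      have hzx : z ≠ x := hxz.ne'
      have hcx : c x = z := if_pos rfl
      have hcn : ∀ a, a ≠ x → c a = a := fun a ha => if_neg ha
      have hcm : ∀ a, c a ≠ x := by
        intro a
        by_cases ha : a = x
        · rw [ha, hcx]; exact hzx
        · rwa [hcn a ha]
      have hm' : ∀ a, Function.update m x none (c a) = m a := by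
        intro a
        rw [Function.update_of_ne (hcm a)]
        by_cases ha : a = x
        · rw [ha, hcx, hx, hz]
        · rw [hcn a ha]
      have hstep : ∀ a b, H.Adj a b → c a = c b ∨ K.Adj (c a) (c b) := by
        intro a b hab
        by_cases ha : a = x
        · subst ha
          by_cases hb : b = z
          · subst hb; left; rw [hcx, hcn _ hzx]
          · right; rw [hcx, hcn _ hab.ne']; exact h2 b hb hab
        · by_cases hb : b = x
          · subst hb
            by_cases hb : a = z
            · subst hb; left; rw [hcx, hcn _ hzx]
            · right; rw [hcx, hcn _ hab.ne]; exact (h2 a hb hab.symm).symm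
          · right; rw [hcn a ha, hcn b hb]; exact h1 a b ha hb hab
      have hpre : ∀ a w, Function.update m x none a = some w → c a = a ∧ m a = some w := by
        intro a w ha
        have hax : a ≠ x := by rintro rfl; simp at ha
        rw [Function.update_of_ne hax] at ha
        exact ⟨hcn a hax, ha⟩
      refine ih _ ?_ hK (Function.update m x none) rfl ?_ ?_ ?_
      · rw [← hk]
        rw [Nat.card_eq_fintype_card, Nat.card_eq_fintype_card]
        refine Fintype.card_lt_of_injective_of_notMem
          (fun a : {a // Function.update m x none a ≠ none} =>
            (⟨a.1, fun h => a.2 (by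
              by_cases hax : a.1 = x
              · rw [hax]; simp
              · rw [Function.update_of_ne hax, h])⟩ : {a // m a ≠ none}))
          ?_ (b := ⟨x, by rw [hx]; simp⟩) ?_
        · intro a b hab
          exact Subtype.ext (by simpa using hab)
        · rintro ⟨a, ha⟩
          have : a.1 = x := by simpa using ha
          exact a.2 (by rw [this]; simp)
      · intro w
        obtain ⟨a, ha⟩ := hne w
        exact ⟨c a, by rw [hm', ha]⟩
      · intro w a b ha hb
        obtain ⟨ha1, ha2⟩ := hpre a w ha
        obtain ⟨hb1, hb2⟩ := hpre b w hb
        rw [← ha1, ← hb1]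
        refine (ReflTransGen.lift' c ?_ _ _) (hconn w a b ha2 hb2)
        rintro p q ⟨hpq, hp, hq⟩
        rcases hstep p q hpq with h | h
        · simp only [Function.onFun, h]; exact ReflTransGen.refl
        · exact ReflTransGen.single ⟨h, by rw [hm', hp], by rw [hm', hq]⟩
      · intro u w huw
        obtain ⟨a, b, ha, hb, hab⟩ := hadj u w huw
        refine ⟨c a, c b, by rw [hm', ha], by rw [hm', hb], ?_⟩
        rcases hstep a b hab with h | h
        · have : m a = m b := by rw [← hm' a, ← hm' b, h]
          rw [ha, hb] at this
          exact absurd (Option.some.inj this) huw.ne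
        · exact h
    · push Not at hs
      choose r hr using hne
      have hinj : Function.Injective r := by
        intro u v huv
        have := hr u
        rw [huv, hr v] at this
        exact (Option.some.inj this).symm
      refine ⟨⟨r, hinj⟩, hH.mono ?_⟩
      intro a b hab
      obtain ⟨u, v, huv, rfl, rfl⟩ := (SimpleGraph.map_adj _ _ _ _).1 hab
      obtain ⟨x, y, hx, hy, hxy⟩ := hadj u v huv
      rw [hs u x (r u) hx (hr u), hs v y (r v) hy (hr v)] at hxy
      exact hxy

end Minor

section Minor

open Equiv Relation

variable {W : Type*} [Fintype W] [DecidableEq W]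

/-- A graph drawn with connected branch sets `A` and connected edge sets `P` inside a
combinatorially planar graph is combinatorially planar, up to relabelling. -/
theorem CombPlanar.exists_of_drawing {V : Type*} [LinearOrder V] (G : SimpleGraph V)
    {H : SimpleGraph W} (hH : CombPlanar H) (A : V → Set W) (P : V → V → Set W)
    (hA : ∀ v, (A v).Nonempty)
    (hAconn : ∀ v, ∀ x ∈ A v, ∀ y ∈ A v,
      ReflTransGen (fun a b => H.Adj a b ∧ a ∈ A v ∧ b ∈ A v) x y)
    (hAA : ∀ u v, u ≠ v → Disjoint (A u) (A v))
    (hP : ∀ u v, G.Adj u v → u < v → ∀ x ∈ P u v, ∀ y ∈ P u v,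
      ReflTransGen (fun a b => H.Adj a b ∧ a ∈ P u v ∧ b ∈ P u v) x y)
    (hPl : ∀ u v, G.Adj u v → u < v → (P u v ∩ A u).Nonempty)
    (hPr : ∀ u v, G.Adj u v → u < v → (P u v ∩ A v).Nonempty)
    (hPA : ∀ u v w, G.Adj u v → u < v → w ≠ u → w ≠ v → Disjoint (P u v) (A w))
    (hPP : ∀ u v u' v', G.Adj u v → u < v → G.Adj u' v' → u' < v' → (u ≠ u' ∨ v ≠ v') →
      Disjoint (P u v) (P u' v')) :
    ∃ r : V ↪ W, CombPlanar (G.map r) := by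
  classical
  set S : V → V → Set W := fun u v => {x | ∃ a, a ∈ A u ∧ a ∈ P u v ∧
    ReflTransGen (fun a b => H.Adj a b ∧ (a ∈ P u v ∧ a ∉ A v) ∧ (b ∈ P u v ∧ b ∉ A v)) a x ∧
    x ∈ P u v ∧ x ∉ A v} with hS
  set B : V → Set W := fun v => {x | x ∈ A v ∨ ∃ w, G.Adj v w ∧ v < w ∧ x ∈ S v w} with hB
  have huniq : ∀ u v x, x ∈ B u → x ∈ B v → u = v := by
    have key : ∀ u v x, x ∈ A u → x ∈ B v → u = v := by
      rintro u v x hx (hx' | ⟨w, hw, hvw, a, -, -, -, hxP, hxA⟩)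
      · by_contra h
        exact Set.disjoint_left.1 (hAA u v h) hx hx'
      · by_contra h
        by_cases huw : u = w
        · subst huw; exact hxA hx
        · exact Set.disjoint_left.1 (hPA v w u hw hvw h huw) hxP hx
    rintro u v x (hx | ⟨w, hw, huw, a, ha⟩) hx'
    · exact key u v x hx hx'
    · rcases hx' with hx' | ⟨w', hw', hvw', b, hb⟩
      · exact (key v u x hx' (Or.inr ⟨w, hw, huw, a, ha⟩)).symm
      · by_contra h
        exact Set.disjoint_left.1 (hPP u w v w' hw huw hw' hvw' (Or.inl h)) ha.2.2.2.1
          hb.2.2.2.1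
  set m : W → Option V := fun x => if h : ∃ v, x ∈ B v then some h.choose else none with hm
  have hmB : ∀ x v, m x = some v ↔ x ∈ B v := by
    intro x v
    simp only [hm]
    split_ifs with h
    · constructor
      · intro h'
        rw [← Option.some.inj h']; exact h.choose_spec
      · intro h'
        rw [huniq _ _ x h.choose_spec h']
    · simp only [false_iff]
      exact fun h' => h ⟨v, h'⟩
  have hsub : ∀ v w, G.Adj v w → v < w → ∀ x ∈ S v w, ∃ a ∈ A v,
      ReflTransGen (fun a b => H.Adj a b ∧ a ∈ B v ∧ b ∈ B v) a x := by
    rintro v w hw hvw x ⟨a, haA, haP, hax, hxP, hxA⟩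
    refine ⟨a, haA, ?_⟩
    clear hxP hxA
    induction hax with
    | refl => exact ReflTransGen.refl
    | @tail p q hp hpq ihp =>
      refine ihp.tail ⟨hpq.1, Or.inr ⟨w, hw, hvw, a, haA, haP, hp, hpq.2.1⟩,
        Or.inr ⟨w, hw, hvw, a, haA, haP, hp.tail hpq, hpq.2.2⟩⟩
  have hsymm : ∀ v, Std.Symm (fun a b => H.Adj a b ∧ a ∈ B v ∧ b ∈ B v) :=
    fun v => ⟨fun a b h => ⟨h.1.symm, h.2.2, h.2.1⟩⟩
  have hroot : ∀ v x, x ∈ B v → ∃ a ∈ A v,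
      ReflTransGen (fun a b => H.Adj a b ∧ a ∈ B v ∧ b ∈ B v) a x := by
    rintro v x (hx | ⟨w, hw, hvw, hx⟩)
    · exact ⟨x, hx, ReflTransGen.refl⟩
    · exact hsub v w hw hvw x hx
  refine hH.exists_minor G _ m rfl ?_ ?_ ?_
  · intro v
    obtain ⟨x, hx⟩ := hA v
    exact ⟨x, (hmB x v).2 (Or.inl hx)⟩
  · intro v x y hx hy
    simp only [hmB] at hx hy ⊢
    obtain ⟨a, ha, hax⟩ := hroot v x hx
    obtain ⟨b, hb, hby⟩ := hroot v y hy
    have := hsymm v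
    refine (ReflTransGen.stdSymm.symm _ _ hax).trans (ReflTransGen.trans ?_ hby)
    exact ReflTransGen.mono (fun p q hpq => ⟨hpq.1, Or.inl hpq.2.1, Or.inl hpq.2.2⟩) _ _
      (hAconn v a ha b hb)
  · have key : ∀ u v, G.Adj u v → u < v → ∃ x y, x ∈ B u ∧ y ∈ B v ∧ H.Adj x y := by
      intro u v huv hlt
      obtain ⟨a, haP, haA⟩ := hPl u v huv hlt
      obtain ⟨b, hbP, hbA⟩ := hPr u v huv hlt
      have haS : a ∈ S u v := ⟨a, haA, haP, ReflTransGen.refl, haP,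
        fun h => Set.disjoint_left.1 (hAA u v hlt.ne) haA h⟩
      have : b ∈ S u v ∨ ∃ x y, x ∈ S u v ∧ y ∈ A v ∧ H.Adj x y := by
        have hab := hP u v huv hlt a haP b hbP
        clear hbP hbA
        induction hab with
        | refl => exact Or.inl haS
        | @tail p q hp hpq ihp =>
          rcases ihp with ih | ih
          · by_cases hq : q ∈ A v
            · exact Or.inr ⟨p, q, ih, hq, hpq.1⟩
            · obtain ⟨c, hcA, hcP, hcp, hp'⟩ := ih
              exact Or.inl ⟨c, hcA, hcP, hcp.tail ⟨hpq.1, hp', hpq.2.2, hq⟩, hpq.2.2, hq⟩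
          · exact Or.inr ih
      rcases this with h | ⟨x, y, hx, hy, hxy⟩
      · obtain ⟨-, -, -, -, -, h⟩ := h
        exact absurd hbA h
      · exact ⟨x, y, Or.inr ⟨v, huv, hlt, hx⟩, Or.inl hy, hxy⟩
    intro u v huv
    simp only [hmB]
    rcases lt_or_gt_of_ne huv.ne with hlt | hlt
    · exact key u v huv hlt
    · obtain ⟨x, y, hx, hy, hxy⟩ := key v u huv.symm hlt
      exact ⟨y, x, hy, hx, hxy.symm⟩

/-- The triangular lattice, with bricks `[i, i + 1] × [h, h + 2]`, is combinatorially planar. -/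
theorem exists_lattice (n : ℕ) : ∃ H : SimpleGraph (Fin (2 * n + 1) × Fin (2 * n + 1)),
    CombPlanar H ∧ ∀ i j h h' : ℕ, ∀ (hi : i < 2 * n + 1) (hj : j < 2 * n + 1)
      (hh : h < 2 * n + 1) (hh' : h' < 2 * n + 1), h % 2 = i % 2 → h' % 2 = j % 2 →
      h ≤ min i (2 * n - i) → h' ≤ min j (2 * n - j) →
      i ≤ j + 1 → j ≤ i + 1 → h ≤ h' + 2 → h' ≤ h + 2 → (i ≠ j ∨ h ≠ h') →
      H.Adj (⟨i, hi⟩, ⟨h, hh⟩) (⟨j, hj⟩, ⟨h', hh'⟩) := by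
  obtain ⟨f, H, rot, hS, hf⟩ := exists_latticeState_pyramid
    (W := Fin (2 * n + 1) × Fin (2 * n + 1)) (fun i h => (Fin.ofNat _ i, Fin.ofNat _ h)) n (by
      intro i j h h' hi hj hh hh' heq
      simp only [Prod.mk.injEq, Fin.ext_iff, Fin.val_ofNat] at heq
      rw [Nat.mod_eq_of_lt (by omega), Nat.mod_eq_of_lt (by omega), Nat.mod_eq_of_lt (by omega),
        Nat.mod_eq_of_lt (by omega)] at heq
      exact heq)
  have hof : ∀ i (hi : i < 2 * n + 1), Fin.ofNat (2 * n + 1) i = ⟨i, hi⟩ := by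
    intro i hi
    ext
    simp [Nat.mod_eq_of_lt hi]
  refine ⟨H, ⟨rot, hS.planar⟩, ?_⟩
  intro i j h h' hi hj hh hh' hp hp' hle hle' h1 h2 h3 h4 hne
  have main : H.Adj ((fun i h => (Fin.ofNat _ i, Fin.ofNat _ h) :
      ℕ → ℕ → Fin (2 * n + 1) × Fin (2 * n + 1)) i h)
      ((fun i h => (Fin.ofNat _ i, Fin.ofNat _ h) :
      ℕ → ℕ → Fin (2 * n + 1) × Fin (2 * n + 1)) j h') := by
    rw [← hf i (by omega)] at hle
    rw [← hf j (by omega)] at hle'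
    have hcase : (j = i ∧ h' = h + 2) ∨ (j = i ∧ h = h' + 2) ∨ (j = i + 1) ∨ (i = j + 1) := by
      omega
    rcases hcase with ⟨rfl, rfl⟩ | ⟨rfl, rfl⟩ | rfl | rfl
    · exact hS.vert j h (by omega) hp hle'
    · exact (hS.vert j h' (by omega) hp' hle).symm
    · exact hS.diag i h h' (by omega) hp hle hle' (by omega)
    · exact (hS.diag j h' h (by omega) hp' hle' hle (by omega)).symm
  simpa only [hof _ hi, hof _ hj, hof _ hh, hof _ hh'] using main

end Minor

section Topology

open Filter Topology Relation

/-- The brick `(i, h)` of the brick tiling with scale `k / R`. -/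
def brick (R : ℝ) (k i h : ℕ) : Set (ℝ × ℝ) :=
  {p | ((i : ℝ) ≤ 4 * k + k / R * p.1 ∧ 4 * k + k / R * p.1 ≤ i + 1) ∧
    (h : ℝ) ≤ k + 1 + k / R * p.2 ∧ k + 1 + k / R * p.2 ≤ h + 2}

theorem isClosed_brick (R : ℝ) (k i h : ℕ) : IsClosed (brick R k i h) := by
  have hX : Continuous fun p : ℝ × ℝ => 4 * k + k / R * p.1 := by fun_prop
  have hY : Continuous fun p : ℝ × ℝ => k + 1 + k / R * p.2 := by fun_prop
  exact ((isClosed_le continuous_const hX).inter (isClosed_le hX continuous_const)).inter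
    ((isClosed_le continuous_const hY).inter (isClosed_le hY continuous_const))

/-- The indices of bricks of the pyramid meeting a set. -/
def bricksMeeting (R : ℝ) (k : ℕ) (S : Set (ℝ × ℝ)) :
    Set (Fin (2 * (4 * k) + 1) × Fin (2 * (4 * k) + 1)) :=
  {x | x.2.1 % 2 = x.1.1 % 2 ∧ x.2.1 ≤ min x.1.1 (2 * (4 * k) - x.1.1) ∧
    (brick R k x.1 x.2 ∩ S).Nonempty}

theorem exists_brick {R : ℝ} (hR : 0 < R) {k : ℕ} (hk : 0 < k) {S : Set (ℝ × ℝ)} {p : ℝ × ℝ}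
    (hp : p ∈ S) (hpR : ‖p‖ ≤ R) : ∃ x ∈ bricksMeeting R k S, p ∈ brick R k x.1 x.2 := by
  have hk' : (1 : ℝ) ≤ k := by exact_mod_cast hk
  have key : ∀ a : ℝ, |a| ≤ R → -(k : ℝ) ≤ k / R * a ∧ k / R * a ≤ k := by
    intro a ha
    rw [← abs_le, abs_mul, abs_of_nonneg (by positivity), div_mul_eq_mul_div, div_le_iff₀ hR]
    gcongr
  have h1 := key p.1 ((norm_fst_le p).trans hpR)
  have h2 := key p.2 ((norm_snd_le p).trans hpR)
  set X := 4 * k + k / R * p.1 with hX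
  set Y := k + 1 + k / R * p.2 with hY
  have hX1 : ((3 * k : ℕ) : ℝ) ≤ X := by push_cast; linarith
  have hX2 : X < ((5 * k + 1 : ℕ) : ℝ) := by push_cast; linarith
  have hY1 : ((1 : ℕ) : ℝ) ≤ Y := by push_cast; linarith
  have hY2 : Y < ((2 * k + 2 : ℕ) : ℝ) := by push_cast; linarith
  have hX0 : 0 ≤ X := le_trans (by positivity) hX1
  have hY0 : 0 ≤ Y := le_trans (by positivity) hY1
  have a1 := Nat.le_floor hX1
  have a2 := (Nat.floor_lt hX0).2 hX2
  have b1 := Nat.le_floor hY1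
  have b2 := (Nat.floor_lt hY0).2 hY2
  have a3 := Nat.floor_le hX0
  have a4 := Nat.lt_floor_add_one X
  have b3 := Nat.floor_le hY0
  have b4 := Nat.lt_floor_add_one Y
  set i := ⌊X⌋₊
  set j := ⌊Y⌋₊
  obtain ⟨h, hh1, hh2⟩ : ∃ h, h % 2 = i % 2 ∧ (h = j ∨ h + 1 = j) := by
    by_cases hpar : j % 2 = i % 2
    · exact ⟨j, hpar, Or.inl rfl⟩
    · exact ⟨j - 1, by omega, Or.inr (by omega)⟩
  have hhj : (h : ℝ) ≤ j ∧ (j : ℝ) ≤ h + 1 := by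
    constructor
    · exact_mod_cast (by omega : h ≤ j)
    · exact_mod_cast (by omega : j ≤ h + 1)
  have hb : p ∈ brick R k i h := ⟨⟨a3, a4.le⟩, by linarith, by linarith⟩
  exact ⟨(⟨i, by omega⟩, ⟨h, by omega⟩), ⟨hh1, by simp only; omega, p, hb, hp⟩, hb⟩

theorem dist_le_of_mem_brick {R : ℝ} (hR : 0 < R) {k i h : ℕ} (hk : 0 < k) {p q : ℝ × ℝ}
    (hp : p ∈ brick R k i h) (hq : q ∈ brick R k i h) : dist p q ≤ 2 * R / k := by
  have hk' : (0 : ℝ) < k := by exact_mod_cast hk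
  have key : ∀ a b : ℝ, k / R * a - k / R * b ≤ 2 → a - b ≤ 2 * R / k := by
    intro a b hab
    rw [le_div_iff₀ hk']
    rw [← mul_sub, div_mul_eq_mul_div, div_le_iff₀ hR] at hab
    linarith
  obtain ⟨⟨p1, p2⟩, p3, p4⟩ := hp
  obtain ⟨⟨q1, q2⟩, q3, q4⟩ := hq
  rw [Prod.dist_eq, Real.dist_eq, Real.dist_eq]
  refine max_le (abs_sub_le_iff.2 ⟨key _ _ ?_, key _ _ ?_⟩)
    (abs_sub_le_iff.2 ⟨key _ _ ?_, key _ _ ?_⟩) <;> linarith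

theorem eventually_disjoint_bricksMeeting {R : ℝ} (hR : 0 < R) {S T : Set (ℝ × ℝ)}
    (hS : IsCompact S) (hT : IsClosed T) (hST : Disjoint S T) :
    ∀ᶠ k : ℕ in atTop, Disjoint (bricksMeeting R k S) (bricksMeeting R k T) := by
  obtain ⟨ε, hε, hd⟩ := hST.exists_thickenings hS hT
  have hlim : Tendsto (fun k : ℕ => 2 * R / (k : ℝ)) atTop (𝓝 0) :=
    tendsto_const_div_atTop_nhds_zero_nat _
  filter_upwards [hlim.eventually (gt_mem_nhds hε), eventually_gt_atTop 0] with k hk hk0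
  rw [Set.disjoint_left]
  rintro x ⟨-, -, p, hpb, hpS⟩ ⟨-, -, q, hqb, hqT⟩
  exact Set.disjoint_left.1 hd
    (Metric.mem_thickening_iff.2 ⟨p, hpS, (dist_le_of_mem_brick hR hk0 hqb hpb).trans_lt hk⟩)
    (Metric.self_subset_thickening hε _ hqT)

theorem reflTransGen_bricksMeeting {R : ℝ} (hR : 0 < R) {k : ℕ} (hk : 0 < k)
    {S : Set (ℝ × ℝ)} (hS : IsPreconnected S) (hSR : ∀ p ∈ S, ‖p‖ ≤ R)
    {H : SimpleGraph (Fin (2 * (4 * k) + 1) × Fin (2 * (4 * k) + 1))}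
    (hH : ∀ i j h h' : ℕ, ∀ (hi : i < 2 * (4 * k) + 1) (hj : j < 2 * (4 * k) + 1)
      (hh : h < 2 * (4 * k) + 1) (hh' : h' < 2 * (4 * k) + 1), h % 2 = i % 2 → h' % 2 = j % 2 →
      h ≤ min i (2 * (4 * k) - i) → h' ≤ min j (2 * (4 * k) - j) →
      i ≤ j + 1 → j ≤ i + 1 → h ≤ h' + 2 → h' ≤ h + 2 → (i ≠ j ∨ h ≠ h') →
      H.Adj (⟨i, hi⟩, ⟨h, hh⟩) (⟨j, hj⟩, ⟨h', hh'⟩)) :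
    ∀ x ∈ bricksMeeting R k S, ∀ y ∈ bricksMeeting R k S,
      ReflTransGen (fun a b => H.Adj a b ∧ a ∈ bricksMeeting R k S ∧ b ∈ bricksMeeting R k S)
        x y := by
  intro x hx y hy
  set r : Fin (2 * (4 * k) + 1) × Fin (2 * (4 * k) + 1) →
    Fin (2 * (4 * k) + 1) × Fin (2 * (4 * k) + 1) → Prop :=
    fun a b => H.Adj a b ∧ a ∈ bricksMeeting R k S ∧ b ∈ bricksMeeting R k S with hr
  by_contra hxy
  set T := bricksMeeting R k S
  have hclosed : ∀ I : Set (Fin (2 * (4 * k) + 1) × Fin (2 * (4 * k) + 1)),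
      IsClosed (⋃ z ∈ I, brick R k z.1 z.2) :=
    fun I => I.toFinite.isClosed_biUnion fun z _ => isClosed_brick _ _ _ _
  obtain ⟨p, hpS, hp1, hp2⟩ := isPreconnected_closed_iff.1 hS
    (⋃ z ∈ {z | z ∈ T ∧ ReflTransGen r x z}, brick R k z.1 z.2)
    (⋃ z ∈ {z | z ∈ T ∧ ¬ ReflTransGen r x z}, brick R k z.1 z.2) (hclosed _) (hclosed _)
    (fun p hp => by
      obtain ⟨z, hz, hpz⟩ := exists_brick hR hk hp (hSR p hp)
      by_cases hxz : ReflTransGen r x z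
      · exact Or.inl (Set.mem_biUnion (show z ∈ {z | z ∈ T ∧ ReflTransGen r x z} from ⟨hz, hxz⟩) hpz)
      · exact Or.inr (Set.mem_biUnion
          (show z ∈ {z | z ∈ T ∧ ¬ ReflTransGen r x z} from ⟨hz, hxz⟩) hpz))
    (by
      obtain ⟨p, hp, hpS⟩ := hx.2.2
      exact ⟨p, hpS, Set.mem_biUnion
        (show x ∈ {z | z ∈ T ∧ ReflTransGen r x z} from ⟨hx, ReflTransGen.refl⟩) hp⟩)
    (by
      obtain ⟨p, hp, hpS⟩ := hy.2.2
      exact ⟨p, hpS, Set.mem_biUnion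
        (show y ∈ {z | z ∈ T ∧ ¬ ReflTransGen r x z} from ⟨hy, hxy⟩) hp⟩)
  obtain ⟨z, ⟨hzT, hz⟩, hpz⟩ := Set.mem_iUnion₂.1 hp1
  obtain ⟨w, ⟨hwT, hw⟩, hpw⟩ := Set.mem_iUnion₂.1 hp2
  refine hw (hz.tail ⟨?_, hzT, hwT⟩)
  obtain ⟨⟨z1, z2⟩, z3, z4⟩ := hpz
  obtain ⟨⟨w1, w2⟩, w3, w4⟩ := hpw
  refine hH z.1 w.1 z.2 w.2 z.1.2 w.1.2 z.2.2 w.2.2 hzT.1 hwT.1 hzT.2.1 hwT.2.1 ?_ ?_ ?_ ?_ ?_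
  · have : ((z.1 : ℕ) : ℝ) ≤ (w.1 : ℕ) + 1 := by linarith
    exact_mod_cast this
  · have : ((w.1 : ℕ) : ℝ) ≤ (z.1 : ℕ) + 1 := by linarith
    exact_mod_cast this
  · have : ((z.2 : ℕ) : ℝ) ≤ (w.2 : ℕ) + 2 := by linarith
    exact_mod_cast this
  · have : ((w.2 : ℕ) : ℝ) ≤ (z.2 : ℕ) + 2 := by linarith
    exact_mod_cast this
  · by_contra hcon
    push Not at hcon
    refine hw ?_
    have : w = z := Prod.ext (Fin.ext hcon.1.symm) (Fin.ext hcon.2.symm)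
    rwa [this]

/-- A graph with disjoint compact connected branch sets and edge sets in the plane is
combinatorially planar, up to relabelling. -/
theorem exists_combPlanar_of_regions {V : Type*} [Finite V] [LinearOrder V] (G : SimpleGraph V)
    (A : V → Set (ℝ × ℝ)) (M : V → V → Set (ℝ × ℝ))
    (hA : ∀ v, (A v).Nonempty) (hAc : ∀ v, IsCompact (A v)) (hAp : ∀ v, IsPreconnected (A v))
    (hMc : ∀ u v, IsCompact (M u v)) (hMp : ∀ u v, IsPreconnected (M u v))
    (hAA : ∀ u v, u ≠ v → Disjoint (A u) (A v))
    (hMl : ∀ u v, G.Adj u v → (M u v ∩ A u).Nonempty)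
    (hMr : ∀ u v, G.Adj u v → (M u v ∩ A v).Nonempty)
    (hMA : ∀ u v w, G.Adj u v → w ≠ u → w ≠ v → Disjoint (M u v) (A w))
    (hMM : ∀ u v u' v', G.Adj u v → G.Adj u' v' → s(u, v) ≠ s(u', v') →
      Disjoint (M u v) (M u' v')) :
    ∃ (n : ℕ) (r : V ↪ Fin n × Fin n), CombPlanar (G.map r) := by
  have hbd : Bornology.IsBounded ((⋃ v, A v) ∪ ⋃ u, ⋃ v, M u v) :=
    ((isCompact_iUnion hAc).union (isCompact_iUnion fun u => isCompact_iUnion fun v =>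
      hMc u v)).isBounded
  obtain ⟨R, hR, hRb⟩ := hbd.exists_pos_norm_le
  have hAR : ∀ v, ∀ p ∈ A v, ‖p‖ ≤ R := fun v p hp =>
    hRb p (Or.inl (Set.mem_iUnion.2 ⟨v, hp⟩))
  have hMR : ∀ u v, ∀ p ∈ M u v, ‖p‖ ≤ R := fun u v p hp =>
    hRb p (Or.inr (Set.mem_iUnion₂.2 ⟨u, v, hp⟩))
  have e1 : ∀ᶠ k : ℕ in atTop, ∀ u v, u ≠ v →
      Disjoint (bricksMeeting R k (A u)) (bricksMeeting R k (A v)) := by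
    simp only [eventually_all]
    exact fun u v huv => eventually_disjoint_bricksMeeting hR (hAc u) (hAc v).isClosed (hAA u v huv)
  have e2 : ∀ᶠ k : ℕ in atTop, ∀ u v w, G.Adj u v → w ≠ u → w ≠ v →
      Disjoint (bricksMeeting R k (M u v)) (bricksMeeting R k (A w)) := by
    simp only [eventually_all]
    exact fun u v w h1 h2 h3 => eventually_disjoint_bricksMeeting hR (hMc u v) (hAc w).isClosed
      (hMA u v w h1 h2 h3)
  have e3 : ∀ᶠ k : ℕ in atTop, ∀ u v u' v', G.Adj u v → G.Adj u' v' → s(u, v) ≠ s(u', v') →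
      Disjoint (bricksMeeting R k (M u v)) (bricksMeeting R k (M u' v')) := by
    simp only [eventually_all]
    exact fun u v u' v' h1 h2 h3 => eventually_disjoint_bricksMeeting hR (hMc u v)
      (hMc u' v').isClosed (hMM u v u' v' h1 h2 h3)
  obtain ⟨k, k1, k2, k3, hk⟩ := (e1.and (e2.and (e3.and (eventually_gt_atTop 0)))).exists
  obtain ⟨H, hH, hadj⟩ := exists_lattice (4 * k)
  refine ⟨_, hH.exists_of_drawing G (fun v => bricksMeeting R k (A v))
    (fun u v => bricksMeeting R k (M u v)) ?_ ?_ k1 ?_ ?_ ?_ ?_ ?_⟩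
  · intro v
    obtain ⟨p, hp⟩ := hA v
    obtain ⟨x, hx, -⟩ := exists_brick hR hk hp (hAR v p hp)
    exact ⟨x, hx⟩
  · exact fun v => reflTransGen_bricksMeeting hR hk (hAp v) (hAR v) hadj
  · exact fun u v _ _ => reflTransGen_bricksMeeting hR hk (hMp u v) (hMR u v) hadj
  · intro u v huv _
    obtain ⟨p, hp, hp'⟩ := hMl u v huv
    obtain ⟨x, hx, hpx⟩ := exists_brick hR hk hp (hMR u v p hp)
    exact ⟨x, hx, hx.1, hx.2.1, p, hpx, hp'⟩
  · intro u v huv _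
    obtain ⟨p, hp, hp'⟩ := hMr u v huv
    obtain ⟨x, hx, hpx⟩ := exists_brick hR hk hp (hMR u v p hp)
    exact ⟨x, hx, hx.1, hx.2.1, p, hpx, hp'⟩
  · exact fun u v w h _ h1 h2 => k2 u v w h h1 h2
  · intro u v u' v' h hlt h' hlt' hne
    refine k3 u v u' v' h h' ?_
    intro heq
    rcases Sym2.eq_iff.1 heq with ⟨rfl, rfl⟩ | ⟨rfl, rfl⟩
    · simp at hne
    · exact lt_asymm hlt hlt'

end Topology

section Topology

open Filter Topology

/-- A planar graph admits a family of arcs with a common parametrisation of both orientations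
of every edge. -/
theorem IsPlanar.exists_arcs {V : Type*} [LinearOrder V] {G : SimpleGraph V} (hG : IsPlanar G) :
    ∃ (pos : V → ℝ × ℝ) (α : V → V → ℝ → ℝ × ℝ), Function.Injective pos ∧
      (∀ u v, Continuous (α u v)) ∧ (∀ u v, α u v 0 = pos u) ∧
      (∀ u v, ¬ G.Adj u v → ∀ t, α u v t = pos u) ∧
      (∀ u v, G.Adj u v → ∀ t, α u v (1 - t) = α v u t) ∧
      (∀ u v, G.Adj u v → ∀ t ∈ Set.Ioo (0 : ℝ) 1, ∀ w, α u v t ≠ pos w) ∧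
      ∀ u v u' v', G.Adj u v → G.Adj u' v' → s(u, v) ≠ s(u', v') →
        ∀ s ∈ Set.Ioo (0 : ℝ) 1, ∀ t ∈ Set.Ioo (0 : ℝ) 1, α u v s ≠ α u' v' t := by
  classical
  obtain ⟨pos, γ, hinj, hpos, hdisj⟩ := hG
  set α : V → V → ℝ → ℝ × ℝ := fun u v t =>
    if h : G.Adj u v then
      if u < v then (γ u v h).extend t else (γ v u h.symm).extend (1 - t)
    else pos u with hα
  have hlt : ∀ u v (h : G.Adj u v), u < v → ∀ t, α u v t = (γ u v h).extend t := by
    intro u v h huv t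
    simp only [hα, dif_pos h, if_pos huv]
  have hgt : ∀ u v (h : G.Adj u v), v < u → ∀ t, α u v t = (γ v u h.symm).extend (1 - t) := by
    intro u v h huv t
    simp only [hα, dif_pos h, if_neg huv.not_gt]
  have hIoo : ∀ t ∈ Set.Ioo (0 : ℝ) 1, 1 - t ∈ Set.Ioo (0 : ℝ) 1 := fun t ht =>
    ⟨by linarith [ht.2], by linarith [ht.1]⟩
  -- every value of an arc in the open interval is an interior value of a path of the edge
  have hval : ∀ u v (_ : G.Adj u v) (t : ℝ), t ∈ Set.Ioo (0 : ℝ) 1 →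
      ∃ a b, ∃ h : G.Adj a b, ∃ s : unitInterval, s(a, b) = s(u, v) ∧
        (s : ℝ) ∈ Set.Ioo (0 : ℝ) 1 ∧ α u v t = γ a b h s := by
    intro u v h t ht
    rcases lt_or_gt_of_ne h.ne with huv | huv
    · refine ⟨u, v, h, ⟨t, ht.1.le, ht.2.le⟩, rfl, ht, ?_⟩
      rw [hlt u v h huv, Path.extend_apply _ ⟨ht.1.le, ht.2.le⟩]
    · have ht' := hIoo t ht
      refine ⟨v, u, h.symm, ⟨1 - t, ht'.1.le, ht'.2.le⟩, Sym2.eq_swap, ht', ?_⟩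
      rw [hgt u v h huv, Path.extend_apply _ ⟨ht'.1.le, ht'.2.le⟩]
  refine ⟨pos, α, hinj, ?_, ?_, ?_, ?_, ?_, ?_⟩
  · intro u v
    by_cases h : G.Adj u v
    · rcases lt_or_gt_of_ne h.ne with huv | huv
      · rw [show α u v = _ from funext (hlt u v h huv)]
        exact (γ u v h).continuous_extend
      · rw [show α u v = _ from funext (hgt u v h huv)]
        exact (γ v u h.symm).continuous_extend.comp (continuous_const.sub continuous_id)
    · rw [show α u v = fun _ => pos u from funext fun t => dif_neg h]
      exact continuous_const
  · intro u v
    by_cases h : G.Adj u v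
    · rcases lt_or_gt_of_ne h.ne with huv | huv
      · rw [hlt u v h huv, Path.extend_zero]
      · rw [hgt u v h huv, sub_zero, Path.extend_one]
    · exact dif_neg h
  · intro u v h t
    exact dif_neg h
  · intro u v h t
    rcases lt_or_gt_of_ne h.ne with huv | huv
    · rw [hlt u v h huv, hgt v u h.symm huv]
    · rw [hgt u v h huv, hlt v u h.symm huv, sub_sub_cancel]
  · intro u v h t ht w
    obtain ⟨a, b, hab, s, -, hs, heq⟩ := hval u v h t ht
    rw [heq]
    exact hpos a b hab s hs w
  · intro u v u' v' h h' hne s hs t ht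
    obtain ⟨a, b, hab, s, e1, hs, heq⟩ := hval u v h s hs
    obtain ⟨a', b', hab', t, e2, ht, heq'⟩ := hval u' v' h' t ht
    rw [heq, heq']
    exact hdisj a b hab a' b' hab' (by rwa [e1, e2]) s t hs ht

/-- A topologically planar finite graph is combinatorially planar, up to relabelling. -/
theorem IsPlanar.exists_combPlanar {V : Type*} [Finite V] {G : SimpleGraph V} (hG : IsPlanar G) :
    ∃ (n : ℕ) (r : V ↪ Fin n × Fin n), CombPlanar (G.map r) := by
  classical
  let _ : LinearOrder V := IsWellOrder.linearOrder WellOrderingRel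
  obtain ⟨pos, α, hinj, hcont, h0, hconst, hsymm, hpos, hdisj⟩ := hG.exists_arcs
  have hev : ∀ᶠ δ : ℝ in 𝓝[>] 0, ∀ u v, G.Adj u v → ∀ s ∈ Set.Icc 0 δ, ∀ t ∈ Set.Icc 0 δ,
      α u v s ≠ α v u t := by
    simp only [eventually_all]
    intro u v huv
    have hopen : IsOpen {p : ℝ × ℝ | α u v p.1 ≠ α v u p.2} :=
      isOpen_ne_fun ((hcont u v).comp continuous_fst) ((hcont v u).comp continuous_snd)
    obtain ⟨ε, hε, hball⟩ := Metric.isOpen_iff.1 hopen (0, 0) (by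
      change α u v 0 ≠ α v u 0
      rw [h0, h0]
      exact fun h => huv.ne (hinj h))
    filter_upwards [Ioo_mem_nhdsGT hε] with δ hδ s hs t ht
    refine hball (a := (s, t)) ?_
    rw [Metric.mem_ball, Prod.dist_eq, Real.dist_eq, Real.dist_eq, sub_zero, sub_zero,
      abs_of_nonneg hs.1, abs_of_nonneg ht.1]
    exact max_lt (hs.2.trans_lt hδ.2) (ht.2.trans_lt hδ.2)
  obtain ⟨δ, hδ, hδ0, hδ2⟩ := (hev.and (Ioo_mem_nhdsGT (show (0 : ℝ) < 1 / 2 by norm_num))).exists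
  have hmemA : ∀ v, ∀ p ∈ ⋃ w, α v w '' Set.Icc 0 δ, p = pos v ∨
      ∃ w, G.Adj v w ∧ ∃ t, t ∈ Set.Ioo (0 : ℝ) 1 ∧ t ≤ δ ∧ p = α v w t := by
    intro v p hp
    obtain ⟨w, t, ht, rfl⟩ := Set.mem_iUnion.1 hp
    by_cases hvw : G.Adj v w
    · rcases ht.1.eq_or_lt with h | h
      · left; rw [← h, h0]
      · exact Or.inr ⟨w, hvw, t, ⟨h, by linarith [ht.2]⟩, ht.2, rfl⟩
    · exact Or.inl (hconst v w hvw t)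
  have hmemM : ∀ t ∈ Set.Icc δ (1 - δ), t ∈ Set.Ioo (0 : ℝ) 1 := fun t ht =>
    ⟨by linarith [ht.1], by linarith [ht.2]⟩
  refine exists_combPlanar_of_regions G (fun v => ⋃ w, α v w '' Set.Icc 0 δ)
    (fun u v => α u v '' Set.Icc δ (1 - δ)) ?_ ?_ ?_ ?_ ?_ ?_ ?_ ?_ ?_ ?_
  · exact fun v => ⟨α v v 0, Set.mem_iUnion.2 ⟨v, 0, ⟨le_rfl, hδ0.le⟩, rfl⟩⟩
  · exact fun v => isCompact_iUnion fun w => isCompact_Icc.image (hcont v w)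
  · intro v
    refine isPreconnected_iUnion (Set.nonempty_iInter.2 ⟨pos v, fun w => ?_⟩) fun w =>
      isPreconnected_Icc.image _ (hcont v w).continuousOn
    exact ⟨0, ⟨le_rfl, hδ0.le⟩, h0 v w⟩
  · exact fun u v => isCompact_Icc.image (hcont u v)
  · exact fun u v => isPreconnected_Icc.image _ (hcont u v).continuousOn
  · intro u v huv
    rw [Set.disjoint_left]
    intro p hp hp'
    rcases hmemA u p hp with rfl | ⟨w, hw, t, ht, htδ, rfl⟩
    · rcases hmemA v _ hp' with h | ⟨w', hw', t', ht', -, h⟩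
      · exact huv (hinj h)
      · exact hpos v w' hw' t' ht' u h.symm
    · rcases hmemA v _ hp' with h | ⟨w', hw', t', ht', htδ', h⟩
      · exact hpos u w hw t ht v h
      · by_cases hs : s(u, w) = s(v, w')
        · rcases Sym2.eq_iff.1 hs with ⟨h1, -⟩ | ⟨h1, h2⟩
          · exact huv h1
          · subst h1 h2
            exact hδ _ _ hw t ⟨ht.1.le, htδ⟩ t' ⟨ht'.1.le, htδ'⟩ h
        · exact hdisj u w v w' hw hw' hs t ht t' ht' h
  · intro u v huv
    exact ⟨α u v δ, ⟨δ, ⟨le_rfl, by linarith⟩, rfl⟩,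
      Set.mem_iUnion.2 ⟨v, δ, ⟨hδ0.le, le_rfl⟩, rfl⟩⟩
  · intro u v huv
    exact ⟨α u v (1 - δ), ⟨1 - δ, ⟨by linarith, le_rfl⟩, rfl⟩,
      Set.mem_iUnion.2 ⟨u, δ, ⟨hδ0.le, le_rfl⟩, (hsymm u v huv δ).symm⟩⟩
  · intro u v w huv hwu hwv
    rw [Set.disjoint_left]
    rintro _ ⟨t, ht, rfl⟩ hp
    have ht := hmemM t ht
    rcases hmemA w _ hp with h | ⟨x, hx, t', ht', -, h⟩
    · exact hpos u v huv t ht w h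
    · refine hdisj u v w x huv hx ?_ t ht t' ht' h
      intro hs
      rcases Sym2.eq_iff.1 hs with ⟨h1, -⟩ | ⟨-, h1⟩
      · exact hwu h1.symm
      · exact hwv h1.symm
  · intro u v u' v' h h' hne
    rw [Set.disjoint_left]
    rintro _ ⟨t, ht, rfl⟩ ⟨t', ht', heq⟩
    exact hdisj u v u' v' h h' hne t (hmemM t ht) t' (hmemM t' ht') heq.symm

end Topology

/-! ### Degrees and the discharging form of Euler's formula -/

section EulerCharge
set_option linter.unusedSectionVars false
open Equiv Equiv.Perm
variable {W : Type*} [Fintype W]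

open Classical in
/-- The finset of neighbours of `v`. -/
noncomputable def nbrs (H : SimpleGraph W) (v : W) : Finset W := Finset.univ.filter (H.Adj v)

/-- The degree of `v`. -/
noncomputable def deg (H : SimpleGraph W) (v : W) : ℕ := (nbrs H v).card

open Classical in
/-- The finset of ordered pairs of adjacent vertices. -/
noncomputable def darts (H : SimpleGraph W) : Finset (W × W) :=
  Finset.univ.filter fun p => H.Adj p.1 p.2

@[simp] theorem mem_nbrs {H : SimpleGraph W} {v x : W} : x ∈ nbrs H v ↔ H.Adj v x := by
  simp [nbrs]

@[simp] theorem mem_darts {H : SimpleGraph W} {p : W × W} : p ∈ darts H ↔ H.Adj p.1 p.2 := by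
  simp [darts]

theorem deg_pos_iff {H : SimpleGraph W} {v : W} : 0 < deg H v ↔ ∃ a, H.Adj v a := by
  simp [deg, Finset.card_pos, Finset.Nonempty]

theorem deg_eq_zero_iff {H : SimpleGraph W} {v : W} : deg H v = 0 ↔ ∀ a, ¬ H.Adj v a := by
  simp [deg, Finset.eq_empty_iff_forall_notMem]

theorem sum_darts {M : Type*} [AddCommMonoid M] (H : SimpleGraph W) (f : W × W → M) :
    ∑ x ∈ darts H, f x = ∑ v, ∑ a ∈ nbrs H v, f (a, v) := by
  classical
  rw [Finset.sum_sigma']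
  refine Finset.sum_bij' (fun x _ => ⟨x.2, x.1⟩) (fun s _ => (s.2, s.1)) ?_ ?_ ?_ ?_ ?_
  · intro x hx; simpa using (mem_darts.1 hx).symm
  · intro s hs; simpa using (mem_nbrs.1 (Finset.mem_sigma.1 hs).2).symm
  · intro x _; rfl
  · intro s _; rfl
  · intro x _; rfl

theorem card_darts (H : SimpleGraph W) : (darts H).card = ∑ v, deg H v := by
  rw [Finset.card_eq_sum_ones, sum_darts]
  simp [deg]

theorem sum_darts_fst {M : Type*} [AddCommMonoid M] (H : SimpleGraph W) (f : W → M) :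
    ∑ x ∈ darts H, f x.1 = ∑ v, deg H v • f v := by
  have h1 : ∑ x ∈ darts H, f x.1 = ∑ x ∈ darts H, f x.2 := by
    refine Finset.sum_equiv (Equiv.prodComm W W) (fun x => ?_) (fun x _ => rfl)
    simp [H.adj_comm]
  rw [h1, sum_darts]
  simp [deg]

/-- The number of darts on the face orbit of `x`. -/
noncomputable def faceLen (rot : W → Perm W) (x : W × W) : ℕ :=
  Nat.card {y // SameCycle (facePerm rot) y x}

theorem faceLen_facePerm (rot : W → Perm W) (x : W × W) :
    faceLen rot (facePerm rot x) = faceLen rot x := by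
  unfold faceLen
  simp only [sameCycle_apply_right]

theorem faceLen_eq_of_forall {rot : W → Perm W} {x : W × W} (s : Finset (W × W)) (hx : x ∈ s)
    (hs : ∀ y ∈ s, facePerm rot y ∈ s) (h : ∀ y ∈ s, SameCycle (facePerm rot) x y) :
    faceLen rot x = s.card := by
  classical
  have : ∀ y, SameCycle (facePerm rot) y x ↔ y ∈ s := by
    intro y
    refine ⟨fun hy => ?_, fun hy => (h y hy).symm⟩
    obtain ⟨n, -, hn⟩ := hy.symm.exists_pow_eq'
    rw [← hn]
    clear hn
    induction n with
    | zero => simpa using hx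
    | succ n ih => rw [pow_succ', mul_apply]; exact hs _ ih
  unfold faceLen
  simp only [this]
  simp

theorem faceLen_diag {H : SimpleGraph W} {rot : W → Perm W} (h : IsRotation H rot) (u : W) :
    faceLen rot (u, u) = 1 := by
  rw [faceLen_eq_of_forall {(u, u)} (by simp) (by simp [h.fixed u u (H.loopless.irrefl u)])
    (by simp [SameCycle.refl])]
  simp

theorem faceLen_of_not_adj {H : SimpleGraph W} {rot : W → Perm W} (h : IsRotation H rot)
    {u v : W} (huv : u ≠ v) (hn : ¬ H.Adj u v) : faceLen rot (u, v) = 2 := by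
  classical
  have h1 : facePerm rot (u, v) = (v, u) := by simp [h.fixed v u fun hh => hn hh.symm]
  have h2 : facePerm rot (v, u) = (u, v) := by simp [h.fixed u v hn]
  rw [faceLen_eq_of_forall {(u, v), (v, u)} (by simp)]
  · rw [Finset.card_pair]
    simp [huv]
  · simp only [Finset.mem_insert, Finset.mem_singleton, forall_eq_or_imp, forall_eq]
    rw [h1, h2]; simp
  · simp only [Finset.mem_insert, Finset.mem_singleton, forall_eq_or_imp, forall_eq]
    exact ⟨SameCycle.refl _ _, ⟨1, by rw [zpow_one, h1]⟩⟩

theorem numOrbits_facePerm {H : SimpleGraph W} {rot : W → Perm W} (h : IsRotation H rot) :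
    2 * (numOrbits (facePerm rot) : ℚ) + (darts H).card =
      2 * ∑ x ∈ darts H, 1 / (faceLen rot x : ℚ) +
        (Fintype.card W * Fintype.card W + Fintype.card W) := by
  classical
  have e1 : (numOrbits (facePerm rot) : ℚ) = ∑ x : W × W, 1 / (faceLen rot x : ℚ) :=
    Setoid.numClasses_eq_sum _
  have e2 : ∑ x : W × W, 2 * (1 / (faceLen rot x : ℚ)) = ∑ x : W × W,
      ((if x ∈ darts H then 2 * (1 / (faceLen rot x : ℚ)) - 1 else 0) +
        (1 + if x.1 = x.2 then 1 else 0)) := by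
    refine Finset.sum_congr rfl fun x _ => ?_
    obtain ⟨u, v⟩ := x
    by_cases hd : H.Adj u v
    · simp [hd, hd.ne]
    · by_cases huv : u = v
      · subst huv
        simp [faceLen_diag h]; norm_num
      · simp [hd, huv, faceLen_of_not_adj h huv hd]
  have e3 : ∑ x : W × W, (if x.1 = x.2 then (1 : ℚ) else 0) = Fintype.card W := by
    rw [Fintype.sum_prod_type]
    simp
  rw [e1, Finset.mul_sum, e2, Finset.sum_add_distrib, Finset.sum_add_distrib, e3,
    Finset.sum_ite_mem]
  simp only [Finset.univ_inter, Finset.sum_sub_distrib, ← Finset.mul_sum]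
  simp
  ring

theorem numIsolated_lt_numClasses {H : SimpleGraph W} {u v : W} (huv : H.Adj u v) :
    numIsolated H + 1 ≤ H.reachableSetoid.numClasses := by
  classical
  let S : Finset W := insert u (Finset.univ.filter fun x => ∀ y, ¬ H.Adj x y)
  have hS : S.card = numIsolated H + 1 := by
    rw [Finset.card_insert_of_notMem]
    · rw [numIsolated, Finset.card_filter]
    · simp only [Finset.mem_filter, not_and, not_forall, not_not]
      exact fun _ => ⟨v, huv⟩
  have iso : ∀ {x y : W}, (∀ z, ¬ H.Adj x z) → H.Reachable x y → x = y := by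
    rintro x y hx ⟨p⟩
    cases p with
    | nil => rfl
    | cons hadj _ => exact absurd hadj (hx _)
  have hinj : Set.InjOn (fun x => (Quotient.mk H.reachableSetoid x)) S := by
    intro x hx y hy hxy
    have hr : H.Reachable x y := Quotient.exact hxy
    simp only [S, Finset.coe_insert, Set.mem_insert_iff, Finset.mem_coe, Finset.mem_filter,
      Finset.mem_univ, true_and] at hx hy
    rcases hx with rfl | hx
    · rcases hy with rfl | hy
      · rfl
      · exact (iso hy hr.symm).symm
    · exact iso hx hr
  rw [← hS]
  unfold Setoid.numClasses
  rw [Nat.card_eq_fintype_card]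
  have := Finset.card_le_card_of_injOn (s := S) (t := Finset.univ)
    (fun x => (Quotient.mk H.reachableSetoid x)) (by simp) hinj
  simpa using this

/-- Ten times the charge `2 - 6 / ℓ` of a face corner, rounded down on long faces. -/
noncomputable def cornerCharge (rot : W → Perm W) (x : W × W) : ℕ :=
  if faceLen rot x ≤ 3 then 0 else if faceLen rot x = 4 then 5 else 8

theorem PlanarRot.charge_neg {H : SimpleGraph W} {rot : W → Perm W} (h : PlanarRot H rot)
    {u v : W} (huv : H.Adj u v) (hl : ∀ x ∈ darts H, 3 ≤ faceLen rot x) :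
    ∑ v, (if deg H v = 0 then 0 else 10 * ((deg H v : ℤ) - 6)) +
      ∑ x ∈ darts H, (cornerCharge rot x : ℤ) < 0 := by
  classical
  have h1 := numOrbits_facePerm h.toIsRotation
  have h2 : ((Fintype.card W * Fintype.card W + 4 * H.reachableSetoid.numClasses : ℕ) : ℚ) ≤
    ((2 * numOrbits (facePerm rot) + 2 * numIsolated H + Fintype.card W : ℕ) : ℚ) := by
    exact_mod_cast h.euler
  have h3 : ((numIsolated H + 1 : ℕ) : ℚ) ≤ (H.reachableSetoid.numClasses : ℕ) := by
    exact_mod_cast numIsolated_lt_numClasses huv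
  have h4 : ∑ v, (if deg H v = 0 then (0 : ℚ) else 10 * ((deg H v : ℚ) - 6)) =
      10 * (darts H).card - 60 * Fintype.card W + 60 * numIsolated H := by
    have : ∀ v, (if deg H v = 0 then (0 : ℚ) else 10 * ((deg H v : ℚ) - 6)) =
        10 * deg H v - 60 + 60 * if (∀ y, ¬ H.Adj v y) then 1 else 0 := by
      intro v
      by_cases hv : deg H v = 0
      · rw [if_pos hv, if_pos (deg_eq_zero_iff.1 hv), hv]; norm_num
      · rw [if_neg hv, if_neg fun hh => hv (deg_eq_zero_iff.2 hh)]; ring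
    simp only [this, Finset.sum_add_distrib, Finset.sum_sub_distrib, ← Finset.mul_sum, card_darts,
      numIsolated]
    simp
    ring
  have h5 : ∑ x ∈ darts H, (cornerCharge rot x : ℚ) ≤
      20 * (darts H).card - 60 * ∑ x ∈ darts H, 1 / (faceLen rot x : ℚ) := by
    rw [Finset.mul_sum, Finset.card_eq_sum_ones, Nat.cast_sum, Finset.mul_sum,
      ← Finset.sum_sub_distrib]
    refine Finset.sum_le_sum fun x hx => ?_
    have hx3 := hl x hx
    unfold cornerCharge
    split_ifs with c1 c2
    · rw [le_antisymm c1 hx3]; norm_num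
    · rw [c2]; norm_num
    · have h5 : (5 : ℚ) ≤ faceLen rot x := by exact_mod_cast (by omega : 5 ≤ faceLen rot x)
      have : 1 / (faceLen rot x : ℚ) ≤ 1 / 5 := one_div_le_one_div_of_le (by norm_num) h5
      push_cast
      linarith
  have h6 : (∑ v, (if deg H v = 0 then (0 : ℚ) else 10 * ((deg H v : ℚ) - 6)) +
      ∑ x ∈ darts H, (cornerCharge rot x : ℚ)) < 0 := by
    push_cast at h2 h3
    rw [h4]
    linarith
  exact_mod_cast h6

end EulerCharge

/-! ### The discharging argument -/

section Discharging
set_option linter.unusedSectionVars false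
open Equiv Equiv.Perm
variable {W : Type*} [Fintype W]

/-- Twice the share of a corner charge passed on past a vertex of degree `d`. -/
def shareTwo (d : ℕ) : ℕ := if d < 6 then 1 else 2

/-- The charge received at a corner with face length `l` between neighbours of degrees `da`, `db`;
the flag tells whether the face across the opposite edge is not a triangle. -/
def receipt (D l da db : ℕ) (s : Prop) [Decidable s] : ℕ :=
  if l ≤ 3 then
    10 * ((da - 6) * shareTwo db + (db - 6) * shareTwo da) +
      if 6 ≤ da ∧ 6 ≤ db ∧ s then 10 * D else 0
  else (if l = 4 then 5 else 8) * (shareTwo da + shareTwo db) * D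

/-- The dart with the same ends as the third dart of a face, reversed. -/
def acrossPerm (rot : W → Perm W) : Perm (W × W) :=
  (facePerm rot).trans ((facePerm rot).trans (Equiv.prodComm W W))

open Classical in
/-- The charge received at the corner `x`. -/
noncomputable def cornerReceipt (H : SimpleGraph W) (rot : W → Perm W) (D : ℕ) (x : W × W) : ℕ :=
  receipt D (faceLen rot x) (deg H x.1) (deg H (facePerm rot x).2)
    (4 ≤ faceLen rot (acrossPerm rot x))

theorem facePerm_mem_darts {H : SimpleGraph W} {rot : W → Perm W} (h : IsRotation H rot)
    (x : W × W) : facePerm rot x ∈ darts H ↔ x ∈ darts H := by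
  simp [h.adj_iff, H.adj_comm]

theorem acrossPerm_mem_darts {H : SimpleGraph W} {rot : W → Perm W} (h : IsRotation H rot)
    (x : W × W) : acrossPerm rot x ∈ darts H ↔ x ∈ darts H := by
  have h1 := facePerm_mem_darts h x
  have h2 := facePerm_mem_darts h (facePerm rot x)
  rw [← h1, ← h2]
  simp [acrossPerm, H.adj_comm]

theorem sum_darts_perm {M : Type*} [AddCommMonoid M] {H : SimpleGraph W} (σ : Perm (W × W))
    (hσ : ∀ x, σ x ∈ darts H ↔ x ∈ darts H) (f : W × W → M) :
    ∑ x ∈ darts H, f (σ x) = ∑ x ∈ darts H, f x :=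
  Finset.sum_equiv σ (fun x => (hσ x).symm) (fun _ _ => rfl)

theorem facePerm_pow_faceLen (rot : W → Perm W) (x : W × W) :
    (facePerm rot ^ faceLen rot x) x = x := by
  classical
  have h1 : faceLen rot x = ((facePerm rot).cycleOf x).support.card ∨
      facePerm rot x = x ∧ faceLen rot x = 1 := by
    by_cases hx : facePerm rot x = x
    · right
      refine ⟨hx, ?_⟩
      rw [faceLen_eq_of_forall {x} (by simp) (by simp [hx, - facePerm_apply])
        (by simp [SameCycle.refl])]
      simp
    · left
      refine faceLen_eq_of_forall _ ?_ ?_ ?_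
      · rw [mem_support_cycleOf_iff]
        exact ⟨SameCycle.refl _ _, by simpa [- facePerm_apply] using hx⟩
      · intro y hy
        rw [mem_support_cycleOf_iff] at hy ⊢
        exact ⟨sameCycle_apply_right.2 hy.1, by simpa [- facePerm_apply] using hy.2⟩
      · intro y hy
        exact (mem_support_cycleOf_iff.1 hy).1
  rcases h1 with h1 | ⟨h1, h2⟩
  · rw [h1, ← pow_mod_card_support_cycleOf_self_apply, Nat.mod_self, pow_zero, one_apply]
  · rw [h2, pow_one, h1]

theorem sum_receipt_le {H : SimpleGraph W} {rot : W → Perm W} (h : IsRotation H rot) {D : ℕ}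
    (hD : ∀ v, deg H v ≤ D) (hl : ∀ x ∈ darts H, 3 ≤ faceLen rot x) :
    ∑ x ∈ darts H, (if deg H x.2 < 6 then cornerReceipt H rot D x else 0) ≤
      ∑ x ∈ darts H, 2 * D * cornerCharge rot x + ∑ v, 20 * D * (deg H v - 6) := by
  classical
  let φ := facePerm rot
  let tk : W → ℕ := fun v => if deg H v < 6 then 1 else 0
  let p : W → ℕ := fun v => deg H v - 6
  let s : W → ℕ := fun v => shareTwo (deg H v)
  let c : W × W → ℕ := cornerCharge rot
  let tri : W × W → ℕ := fun x => if faceLen rot x ≤ 3 then 1 else 0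
  let opp : W × W → ℕ := fun y =>
    if 4 ≤ faceLen rot y ∧ 6 ≤ deg H y.1 ∧ 6 ≤ deg H y.2 then 10 * D else 0
  have hc : ∀ x, c (φ x) = c x := fun x => by simp only [c, cornerCharge, φ, faceLen_facePerm]
  have ht : ∀ x, tri (φ x) = tri x := fun x => by simp only [tri, φ, faceLen_facePerm]
  have key : ∀ x ∈ darts H, (if deg H x.2 < 6 then cornerReceipt H rot D x else 0) ≤
      (tk x.2 * c x * s x.1 * D + tk (φ x).1 * c (φ x) * s (φ x).2 * D) +
      (10 * (tri x * tk x.2 * p x.1 * s (φ x).2) +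
        10 * (tri (φ (φ x)) * tk (φ (φ (φ x))).2 * p (φ (φ x)).1 * s (φ (φ x)).2)) +
      opp (acrossPerm rot x) := by
    intro x hx
    rw [hc, ht, ht]
    by_cases hk : deg H x.2 < 6
    · have hk1 : tk x.2 = 1 := if_pos hk
      have hk2 : tk (φ x).1 = 1 := if_pos hk
      rw [if_pos hk, hk1, hk2]
      unfold cornerReceipt receipt
      by_cases h3 : faceLen rot x ≤ 3
      · have h3' : faceLen rot x = 3 := le_antisymm h3 (hl x hx)
        have hpow := facePerm_pow_faceLen rot x
        rw [h3'] at hpow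
        have hpow' : φ (φ (φ x)) = x := hpow
        have hc0 : c x = 0 := if_pos h3
        have ht1 : tri x = 1 := if_pos h3
        have e1 : (φ (φ x)).1 = (φ x).2 := rfl
        have e2 : (φ (φ x)).2 = x.1 := congrArg Prod.fst hpow'
        rw [if_pos h3, hpow', hk1, hc0, ht1, e1, e2]
        have e3 : (if 6 ≤ deg H x.1 ∧ 6 ≤ deg H (facePerm rot x).2 ∧
            4 ≤ faceLen rot (acrossPerm rot x) then 10 * D else 0) ≤ opp (acrossPerm rot x) := by
          have e4 : acrossPerm rot x = (x.1, (φ x).2) :=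
            show ((φ (φ x)).2, (φ (φ x)).1) = _ by rw [e1, e2]
          simp only [opp]
          by_cases hh : 6 ≤ deg H x.1 ∧ 6 ≤ deg H (facePerm rot x).2 ∧
            4 ≤ faceLen rot (acrossPerm rot x)
          · rw [if_pos hh, if_pos]
            refine ⟨hh.2.2, ?_⟩
            rw [e4]
            exact ⟨hh.1, hh.2.1⟩
          · rw [if_neg hh]; exact Nat.zero_le _
        simp only [p, s]
        simp only [φ] at *
        linarith
      · rw [if_neg h3]
        have hc0 : c x = if faceLen rot x = 4 then 5 else 8 := if_neg h3
        rw [hc0]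
        simp only [s]
        refine le_trans (le_of_eq ?_) (le_trans (Nat.le_add_right _ _) (Nat.le_add_right _ _))
        simp only [φ]
        ring
    · rw [if_neg hk]; exact Nat.zero_le _
  refine (Finset.sum_le_sum key).trans ?_
  simp only [Finset.sum_add_distrib]
  rw [sum_darts_perm φ (facePerm_mem_darts h) (fun x => tk x.1 * c x * s x.2 * D),
    sum_darts_perm φ (facePerm_mem_darts h)
      (fun x => 10 * (tri (φ x) * tk (φ (φ x)).2 * p (φ x).1 * s (φ x).2)),
    sum_darts_perm φ (facePerm_mem_darts h)
      (fun x => 10 * (tri x * tk (φ x).2 * p x.1 * s x.2)),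
    sum_darts_perm (acrossPerm rot) (acrossPerm_mem_darts h) opp]
  have hN : ∑ x ∈ darts H, tk x.2 * c x * s x.1 * D + ∑ x ∈ darts H, tk x.1 * c x * s x.2 * D +
      ∑ x ∈ darts H, opp x ≤ ∑ x ∈ darts H, 2 * D * c x := by
    rw [← Finset.sum_add_distrib, ← Finset.sum_add_distrib]
    refine Finset.sum_le_sum fun x _ => ?_
    simp only [tk, s, opp, shareTwo]
    by_cases h1 : deg H x.1 < 6
    · rw [if_neg (show ¬ (4 ≤ faceLen rot x ∧ 6 ≤ deg H x.1 ∧ 6 ≤ deg H x.2) by omega)]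
      by_cases h2 : deg H x.2 < 6 <;> simp [h1, h2] <;> nlinarith
    · by_cases h2 : deg H x.2 < 6
      · rw [if_neg (show ¬ (4 ≤ faceLen rot x ∧ 6 ≤ deg H x.1 ∧ 6 ≤ deg H x.2) by omega)]
        simp [h1, h2]; nlinarith
      · simp only [h1, h2, if_false, zero_mul, zero_add]
        split_ifs with h3
        · have : 5 ≤ c x := by
            simp only [c, cornerCharge]; split_ifs <;> omega
          nlinarith
        · exact Nat.zero_le _
  have hT : ∑ x ∈ darts H, 10 * (tri x * tk x.2 * p x.1 * s (φ x).2) +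
      ∑ x ∈ darts H, 10 * (tri x * tk (φ x).2 * p x.1 * s x.2) ≤ ∑ v, 20 * D * p v := by
    calc _ ≤ ∑ x ∈ darts H, 20 * p x.1 := by
          rw [← Finset.sum_add_distrib]
          refine Finset.sum_le_sum fun x _ => ?_
          simp only [tk, s, tri, shareTwo]
          split_ifs <;> omega
      _ = ∑ v, deg H v • (20 * p v) := sum_darts_fst H fun v => 20 * p v
      _ ≤ _ := by
          refine Finset.sum_le_sum fun v _ => ?_
          rw [smul_eq_mul]
          nlinarith [hD v, Nat.zero_le (p v), Nat.mul_le_mul_right (20 * p v) (hD v)]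
  linarith

/-- If charge is moved between small vertices by `g`, some small vertex stays negative. -/
theorem PlanarRot.exists_small {H : SimpleGraph W} {rot : W → Perm W} (h : PlanarRot H rot)
    {D : ℕ} (hD : ∀ v, deg H v ≤ D) {u v : W} (huv : H.Adj u v)
    (hl : ∀ x ∈ darts H, 3 ≤ faceLen rot x) (g : W × W → ℤ) (hg : ∑ x ∈ darts H, g x ≤ 0)
    (hg6 : ∀ x ∈ darts H, 6 ≤ deg H x.2 → 0 ≤ g x) :
    ∃ w, 0 < deg H w ∧ deg H w < 6 ∧
      ∑ a ∈ nbrs H w, ((cornerReceipt H rot D (a, w) : ℤ) + g (a, w)) <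
        20 * D * (6 - (deg H w : ℤ)) := by
  classical
  by_contra! hcon
  have hD0 : 0 < D := (deg_pos_iff.2 ⟨v, huv⟩).trans_le (hD u)
  have h1 := h.charge_neg huv hl
  have h2 := sum_receipt_le h.toIsRotation hD hl
  have h3 : ∑ w, (if deg H w = 0 ∨ 6 ≤ deg H w then 0 else 20 * D * (6 - (deg H w : ℤ))) ≤
      ∑ x ∈ darts H, ((if deg H x.2 < 6 then cornerReceipt H rot D x else 0 : ℕ) + g x : ℤ) := by
    rw [sum_darts]
    refine Finset.sum_le_sum fun w _ => ?_
    split_ifs with hw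
    · refine Finset.sum_nonneg fun a ha => ?_
      rcases hw with hw | hw
      · exact absurd (mem_nbrs.1 ha) (deg_eq_zero_iff.1 hw a)
      · have := hg6 (a, w) (mem_darts.2 (mem_nbrs.1 ha).symm) hw
        positivity
    · push Not at hw
      refine (hcon w (Nat.pos_of_ne_zero hw.1) hw.2).trans (le_of_eq ?_)
      refine Finset.sum_congr rfl fun a _ => ?_
      rw [if_pos hw.2]
  rw [Finset.sum_add_distrib] at h3
  have h4 : ∑ w, (if deg H w = 0 ∨ 6 ≤ deg H w then 0 else 20 * D * (6 - (deg H w : ℤ))) =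
      ∑ w, (20 * D * (deg H w - 6 : ℕ) : ℤ) - 
        2 * D * ∑ w, (if deg H w = 0 then 0 else 10 * ((deg H w : ℤ) - 6)) := by
    rw [Finset.mul_sum, ← Finset.sum_sub_distrib]
    refine Finset.sum_congr rfl fun w _ => ?_
    by_cases c1 : deg H w = 0
    · simp [c1]
    · by_cases c2 : 6 ≤ deg H w
      · rw [if_pos (Or.inr c2), if_neg c1, Nat.cast_sub c2]; push_cast; ring
      · rw [if_neg (by omega), if_neg c1, Nat.sub_eq_zero_of_le (by omega)]; push_cast; ring
  have h5 : ((∑ x ∈ darts H, (if deg H x.2 < 6 then cornerReceipt H rot D x else 0) : ℕ) : ℤ) ≤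
      ((∑ x ∈ darts H, 2 * D * cornerCharge rot x + ∑ v, 20 * D * (deg H v - 6) : ℕ) : ℤ) := by
    exact_mod_cast h2
  push_cast [← Finset.mul_sum] at h3 h4 h5
  have hD0' : (0 : ℤ) < D := by exact_mod_cast hD0
  nlinarith
end Discharging

/-! ### Neighbours in cyclic order, and short faces -/

section Local
set_option linter.unusedSectionVars false
open Equiv Equiv.Perm

theorem Equiv.Perm.exists_enum {α : Type*} [Finite α] [DecidableEq α] (f : Perm α) {s : Finset α}
    {a : α} (ha : a ∈ s) (hs : ∀ x ∈ s, f x ∈ s) (hc : ∀ x ∈ s, SameCycle f a x) :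
    Function.minimalPeriod f a = s.card ∧ s = (Finset.range s.card).image fun i => (f ^ i) a := by
  have hmem : ∀ i : ℕ, (f ^ i) a ∈ s := by
    intro i
    induction i with
    | zero => simpa using ha
    | succ i ih => rw [pow_succ', mul_apply]; exact hs _ ih
  have hper : a ∈ Function.periodicPts f := by
    obtain ⟨n, hn, h⟩ := isOfFinOrder_iff_pow_eq_one.1 (isOfFinOrder_of_finite f)
    refine ⟨n, hn, ?_⟩
    rw [Function.IsPeriodicPt, Function.IsFixedPt, iterate_eq_pow, h, one_apply]
  have hpos := Function.minimalPeriod_pos_of_mem_periodicPts hper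
  have himg : s = (Finset.range (Function.minimalPeriod f a)).image fun i => (f ^ i) a := by
    ext x
    simp only [Finset.mem_image, Finset.mem_range]
    constructor
    · intro hx
      obtain ⟨n, -, hn⟩ := (hc x hx).exists_pow_eq'
      refine ⟨n % Function.minimalPeriod f a, Nat.mod_lt _ hpos, ?_⟩
      rw [← hn, ← iterate_eq_pow, ← iterate_eq_pow, Function.iterate_mod_minimalPeriod_eq]
    · rintro ⟨i, -, rfl⟩
      exact hmem i
  have hcard : s.card = Function.minimalPeriod f a := by
    conv_lhs => rw [himg]
    rw [Finset.card_image_of_injOn, Finset.card_range]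
    intro i hi j hj hij
    simp only [Finset.coe_range, Set.mem_Iio] at hi hj
    simp only [← iterate_eq_pow] at hij
    exact (Function.iterate_eq_iterate_iff_of_lt_minimalPeriod hi hj).1 hij
  exact ⟨hcard.symm, by rw [hcard]; exact himg⟩

variable {W : Type*} [Fintype W]

theorem IsRotation.minimalPeriod {H : SimpleGraph W} {rot : W → Perm W} (h : IsRotation H rot)
    {v a : W} (ha : H.Adj v a) : Function.minimalPeriod (rot v) a = deg H v := by
  classical
  exact (exists_enum (rot v) (mem_nbrs.2 ha) (fun x hx => mem_nbrs.2 (h.adj (mem_nbrs.1 hx)))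
    fun x hx => h.cycle v a x ha (mem_nbrs.1 hx)).1

theorem IsRotation.nbrs_eq [DecidableEq W] {H : SimpleGraph W} {rot : W → Perm W}
    (h : IsRotation H rot) {v a : W} (ha : H.Adj v a) :
    nbrs H v = (Finset.range (deg H v)).image fun i => (rot v ^ i) a :=
  (exists_enum (rot v) (mem_nbrs.2 ha) (fun _ hx => mem_nbrs.2 (h.adj (mem_nbrs.1 hx)))
    fun x hx => h.cycle v a x ha (mem_nbrs.1 hx)).2

theorem IsRotation.pow_ne {H : SimpleGraph W} {rot : W → Perm W} (h : IsRotation H rot)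
    {v a : W} (ha : H.Adj v a) {i : ℕ} (hi : 0 < i) (hid : i < deg H v) : (rot v ^ i) a ≠ a := by
  intro hh
  have h1 : Function.IsPeriodicPt (rot v) i a := by
    rw [Function.IsPeriodicPt, Function.IsFixedPt, iterate_eq_pow, hh]
  have h2 := h1.minimalPeriod_le hi
  rw [h.minimalPeriod ha] at h2
  omega

theorem IsRotation.pow_deg {H : SimpleGraph W} {rot : W → Perm W} (h : IsRotation H rot)
    {v a : W} (ha : H.Adj v a) : (rot v ^ deg H v) a = a := by
  rw [← h.minimalPeriod ha, ← iterate_eq_pow, Function.iterate_minimalPeriod]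

theorem IsRotation.injOn_pow {H : SimpleGraph W} {rot : W → Perm W} (h : IsRotation H rot)
    {v a : W} (ha : H.Adj v a) :
    Set.InjOn (fun i => (rot v ^ i) a) (Finset.range (deg H v) : Set ℕ) := by
  intro i hi j hj hij
  simp only [Finset.coe_range, Set.mem_Iio] at hi hj
  simp only [← iterate_eq_pow] at hij
  rw [← h.minimalPeriod ha] at hi hj
  exact (Function.iterate_eq_iterate_iff_of_lt_minimalPeriod hi hj).1 hij

theorem IsRotation.sum_nbrs {M : Type*} [AddCommMonoid M] {H : SimpleGraph W} {rot : W → Perm W}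
    (h : IsRotation H rot) {v a : W} (ha : H.Adj v a) (f : W → M) :
    ∑ u ∈ nbrs H v, f u = ∑ i ∈ Finset.range (deg H v), f ((rot v ^ i) a) := by
  classical
  rw [h.nbrs_eq ha, Finset.sum_image (h.injOn_pow ha)]

theorem IsRotation.sum_nbrs_rot {M : Type*} [AddCommMonoid M] {H : SimpleGraph W}
    {rot : W → Perm W} (h : IsRotation H rot) (v : W) (f : W → M) :
    ∑ u ∈ nbrs H v, f (rot v u) = ∑ u ∈ nbrs H v, f u :=
  Finset.sum_equiv (rot v) (fun u => by simp [h.adj_iff]) fun _ _ => rfl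

theorem IsRotation.adj_symm {H : SimpleGraph W} {rot : W → Perm W} (h : IsRotation H rot)
    {v a : W} (ha : H.Adj v a) : H.Adj v ((rot v).symm a) := by
  rw [← h.adj_iff, apply_symm_apply]
  exact ha

theorem IsRotation.rot_ne {H : SimpleGraph W} {rot : W → Perm W} (h : IsRotation H rot)
    {v a : W} (ha : H.Adj v a) (hd : 2 ≤ deg H v) : rot v a ≠ a :=
  h.pow_ne ha (i := 1) (by omega) hd

theorem IsRotation.rot_rot_ne {H : SimpleGraph W} {rot : W → Perm W} (h : IsRotation H rot)
    {v a : W} (ha : H.Adj v a) (hd : 3 ≤ deg H v) : rot v (rot v a) ≠ a :=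
  h.pow_ne ha (i := 2) (by omega) hd

theorem IsRotation.rot_rot_rot_ne {H : SimpleGraph W} {rot : W → Perm W} (h : IsRotation H rot)
    {v a : W} (ha : H.Adj v a) (hd : 4 ≤ deg H v) : rot v (rot v (rot v a)) ≠ a :=
  h.pow_ne ha (i := 3) (by omega) hd

/-- Faces have length at least three when degrees are at least two. -/
theorem IsRotation.three_le_faceLen {H : SimpleGraph W} {rot : W → Perm W} (h : IsRotation H rot)
    {x : W × W} (hx : x ∈ darts H) (hd : 2 ≤ deg H x.2) : 3 ≤ faceLen rot x := by
  obtain ⟨a, v⟩ := x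
  have hav : H.Adj a v := mem_darts.1 hx
  have hpow := facePerm_pow_faceLen rot (a, v)
  have h0 : 0 < faceLen rot (a, v) := by
    have : Nonempty {y // SameCycle (facePerm rot) y (a, v)} := ⟨⟨_, SameCycle.refl _ _⟩⟩
    exact Nat.card_pos
  by_contra! hlt
  generalize faceLen rot (a, v) = l at *
  interval_cases l
  · rw [pow_one, facePerm_apply, Prod.mk.injEq] at hpow
    exact hav.ne hpow.1.symm
  · have h2 : rot v a = a := congrArg Prod.fst hpow
    exact h.rot_ne hav.symm hd h2

theorem triangle_rot {rot : W → Perm W} {a v : W} (h3 : faceLen rot (a, v) = 3) :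
    rot (rot v a) v = a ∧ rot a (rot v a) = v := by
  have hpow := facePerm_pow_faceLen rot (a, v)
  rw [h3] at hpow
  have h1 : rot (rot v a) v = a := congrArg Prod.fst hpow
  have h2 : rot (rot (rot v a) v) (rot v a) = v := congrArg Prod.snd hpow
  rw [h1] at h2
  exact ⟨h1, h2⟩

theorem square_rot {rot : W → Perm W} {a v : W} (h4 : faceLen rot (a, v) = 4) :
    rot (rot (rot v a) v) (rot v a) = a ∧ rot a (rot (rot v a) v) = v := by
  have hpow := facePerm_pow_faceLen rot (a, v)
  rw [h4] at hpow
  have h1 : rot (rot (rot v a) v) (rot v a) = a := congrArg Prod.fst hpow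
  have h2 : rot (rot (rot (rot v a) v) (rot v a)) (rot (rot v a) v) = v := congrArg Prod.snd hpow
  rw [h1] at h2
  exact ⟨h1, h2⟩

theorem IsRotation.adj_of_triangle {H : SimpleGraph W} {rot : W → Perm W} (h : IsRotation H rot)
    {a v : W} (hav : H.Adj v a) (h3 : faceLen rot (a, v) = 3) : H.Adj a (rot v a) := by
  have h1 := h.adj (h.adj hav).symm
  rw [(triangle_rot h3).1] at h1
  exact h1.symm

theorem acrossPerm_of_triangle {rot : W → Perm W} {a v : W} (h3 : faceLen rot (a, v) = 3) :
    acrossPerm rot (a, v) = (a, rot v a) := by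
  change (rot (rot v a) v, rot v a) = _
  rw [(triangle_rot h3).1]

/-- There is an index on the neighbours of `v` increasing along the rotation from `a`. -/
theorem IsRotation.exists_index {H : SimpleGraph W} {rot : W → Perm W} (h : IsRotation H rot)
    {v a : W} (ha : H.Adj v a) : ∃ idx : W → ℕ,
      (∀ u, H.Adj v u → rot v u ≠ a → idx u < idx (rot v u)) ∧
      ∀ u, H.Adj v u → u ≠ a → idx a < idx u := by
  classical
  have hex : ∀ u, ∃ i : ℕ, H.Adj v u → i < deg H v ∧ (rot v ^ i) a = u := by
    intro u
    by_cases hu : H.Adj v u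
    · have := mem_nbrs.2 hu
      rw [h.nbrs_eq ha] at this
      obtain ⟨i, hi, rfl⟩ := Finset.mem_image.1 this
      exact ⟨i, fun _ => ⟨Finset.mem_range.1 hi, rfl⟩⟩
    · exact ⟨0, fun hh => absurd hh hu⟩
  choose idx hidx using hex
  have huniq : ∀ i j, i < deg H v → j < deg H v → (rot v ^ i) a = (rot v ^ j) a → i = j :=
    fun i j hi hj hij => h.injOn_pow ha (by simpa using hi) (by simpa using hj) hij
  have h0 : idx a = 0 := by
    obtain ⟨h1, h2⟩ := hidx a ha
    exact huniq _ _ h1 (by omega) (by simpa using h2)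
  refine ⟨idx, fun u hu hne => ?_, fun u hu hne => ?_⟩
  · obtain ⟨h1, h2⟩ := hidx u hu
    obtain ⟨h3, h4⟩ := hidx _ (h.adj hu)
    have h5 : (rot v ^ (idx u + 1)) a = rot v u := by rw [pow_succ', mul_apply, h2]
    have h6 : idx u + 1 < deg H v := by
      by_contra! h7
      have : idx u + 1 = deg H v := by omega
      rw [this, h.pow_deg ha] at h5
      exact hne h5.symm
    have := huniq _ _ h3 h6 (h4.trans h5.symm)
    omega
  · obtain ⟨h1, h2⟩ := hidx u hu
    rw [h0]
    by_contra! h3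
    rw [Nat.le_zero.1 h3] at h2
    exact hne (by simpa using h2.symm)

end Local

/-! ### Counting vertices at distance at most two -/

section SecondNbrs
set_option linter.unusedSectionVars false
open Equiv Equiv.Perm
variable {W : Type*} [Fintype W]

open Classical in
/-- The vertices at distance one or two from `v`. -/
noncomputable def nbrsTwo (H : SimpleGraph W) (v : W) : Finset W :=
  Finset.univ.filter fun x => x ≠ v ∧ (H.Adj v x ∨ ∃ u, H.Adj v u ∧ H.Adj u x)

theorem mem_nbrsTwo {H : SimpleGraph W} {v x : W} :
    x ∈ nbrsTwo H v ↔ x ≠ v ∧ (H.Adj v x ∨ ∃ u, H.Adj v u ∧ H.Adj u x) := by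
  simp [nbrsTwo]

/-- Vertices seen a second time from a neighbour `u` of `v` may be discounted. -/
theorem card_nbrsTwo_add_le {H : SimpleGraph W} {v : W} (idx : W → ℕ) (R : W → Finset W)
    (hR : ∀ u, H.Adj v u → ∀ x ∈ R u, x ≠ v ∧ H.Adj u x ∧
      (H.Adj v x ∨ ∃ u', H.Adj v u' ∧ idx u' < idx u ∧ H.Adj u' x)) :
    (nbrsTwo H v).card + ∑ u ∈ nbrs H v, (R u).card ≤ ∑ u ∈ nbrs H v, deg H u := by
  classical
  have hsub : nbrsTwo H v ⊆
      nbrs H v ∪ (nbrs H v).biUnion fun u => nbrs H u \ insert v (R u) := by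
    intro x hx
    obtain ⟨hxv, hx⟩ := mem_nbrsTwo.1 hx
    by_cases hvx : H.Adj v x
    · exact Finset.mem_union_left _ (mem_nbrs.2 hvx)
    · refine Finset.mem_union_right _ ?_
      have hex : ∃ n u, idx u = n ∧ H.Adj v u ∧ H.Adj u x := by
        obtain ⟨u, hu⟩ := hx.resolve_left hvx
        exact ⟨_, u, rfl, hu⟩
      obtain ⟨u, hn, hvu, hux⟩ := Nat.find_spec hex
      rw [Finset.mem_biUnion]
      refine ⟨u, mem_nbrs.2 hvu, ?_⟩
      rw [Finset.mem_sdiff, mem_nbrs, Finset.mem_insert]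
      refine ⟨hux, fun hh => ?_⟩
      rcases (hR u hvu x (hh.resolve_left hxv)).2.2 with h1 | ⟨u', h1, h2, h3⟩
      · exact hvx h1
      · rw [hn] at h2
        exact Nat.find_min hex h2 ⟨u', rfl, h1, h3⟩
  have hu : ∀ u ∈ nbrs H v, (nbrs H u \ insert v (R u)).card + (1 + (R u).card) = deg H u := by
    intro u hu
    have hvu := mem_nbrs.1 hu
    have h1 : insert v (R u) ⊆ nbrs H u := by
      intro x hx
      rcases Finset.mem_insert.1 hx with rfl | hx
      · exact mem_nbrs.2 hvu.symm
      · exact mem_nbrs.2 (hR u hvu x hx).2.1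
    have h2 := Finset.card_sdiff_add_card_eq_card h1
    rw [Finset.card_insert_of_notMem fun hh => (hR u hvu v hh).1 rfl] at h2
    rw [deg]
    omega
  calc (nbrsTwo H v).card + ∑ u ∈ nbrs H v, (R u).card
      ≤ ((nbrs H v).card + ∑ u ∈ nbrs H v, (nbrs H u \ insert v (R u)).card) +
          ∑ u ∈ nbrs H v, (R u).card := by
        refine Nat.add_le_add_right ((Finset.card_le_card hsub).trans ?_) _
        refine (Finset.card_union_le _ _).trans (Nat.add_le_add_left ?_ _)
        exact Finset.card_biUnion_le
    _ = ∑ u ∈ nbrs H v, ((nbrs H u \ insert v (R u)).card + (1 + (R u).card)) := by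
        simp only [Finset.sum_add_distrib, Finset.sum_const, smul_eq_mul, mul_one]
        ring
    _ = _ := Finset.sum_congr rfl hu

theorem card_nbrsTwo_le (H : SimpleGraph W) (v : W) :
    (nbrsTwo H v).card ≤ ∑ u ∈ nbrs H v, deg H u := by
  simpa using card_nbrsTwo_add_le (H := H) (v := v) (fun _ => 0) (fun _ => ∅) (by simp)

/-- A corner at `x.2` whose face shows that its two neighbours have another common neighbour. -/
def IsFlagged (H : SimpleGraph W) (rot : W → Perm W) (x : W × W) : Prop :=
  faceLen rot x = 4 ∨
    faceLen rot x = 3 ∧ 4 ≤ deg H (rot x.2 x.1) ∧ faceLen rot (x.1, rot x.2 x.1) = 3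

open Classical in
theorem IsRotation.card_nbrsTwo_add_flags_le {H : SimpleGraph W} {rot : W → Perm W}
    (h : IsRotation H rot) (hd : ∀ u, 0 < deg H u → 3 ≤ deg H u) {v w u₀ : W} (hw : H.Adj v w)
    (hu₀ : rot v w = u₀) :
    (nbrsTwo H v).card + 2 * ∑ u ∈ nbrs H v, (if faceLen rot (u, v) = 3 then 1 else 0) +
      ∑ u ∈ nbrs H v, (if u ≠ u₀ ∧ IsFlagged H rot (u, v) then 1 else 0) +
      (if faceLen rot (w, v) = 4 ∧ faceLen rot (u₀, v) = 4 then 1 else 0) ≤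
      ∑ u ∈ nbrs H v, deg H u := by
  have hu₀v : H.Adj v u₀ := hu₀ ▸ h.adj hw
  obtain ⟨idx, hidx, hidx0⟩ := h.exists_index (h.adj hu₀v)
  have hdv := hd v (deg_pos_iff.2 ⟨w, hw⟩)
  let p : W → W := fun u => (rot v).symm u
  have hp : ∀ u, rot v (p u) = u := fun u => apply_symm_apply _ _
  let A : W → Prop := fun u => faceLen rot (p u, v) = 3 ∨ p u ≠ u₀ ∧ faceLen rot (p u, v) = 4
  let B : W → Prop := fun u => p u ≠ u₀ ∧ faceLen rot (p u, v) = 3 ∧ 4 ≤ deg H u ∧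
    faceLen rot (p u, u) = 3
  let C : W → Prop := fun u => faceLen rot (u, v) = 3 ∨
    u = u₀ ∧ faceLen rot (w, v) = 4 ∧ faceLen rot (u₀, v) = 4
  let R : W → Finset W := fun u => (if A u then {rot u v} else ∅) ∪
    ((if B u then {rot u (rot u v)} else ∅) ∪ if C u then {(rot u).symm v} else ∅)
  have main := card_nbrsTwo_add_le (H := H) (v := v) idx R ?_
  · have hcard : ∀ u ∈ nbrs H v, ((if faceLen rot (p u, v) = 3 then 1 else 0) +
        (if p u ≠ u₀ ∧ IsFlagged H rot (p u, v) then 1 else 0)) +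
        ((if faceLen rot (u, v) = 3 then 1 else 0) +
        (if u = u₀ then (if faceLen rot (w, v) = 4 ∧ faceLen rot (u₀, v) = 4 then 1 else 0)
          else 0)) ≤ (R u).card := by
      intro u hu
      have huv := (mem_nbrs.1 hu).symm
      have hdu := hd u (deg_pos_iff.2 ⟨v, huv⟩)
      have e1 : rot u v ≠ rot u (rot u v) :=
        fun hh => h.rot_ne huv (by omega) ((rot u).injective hh).symm
      have e2 : rot u v ≠ (rot u).symm v := fun hh =>
        h.rot_rot_ne huv hdu (by rw [hh, apply_symm_apply])
      have e3 : B u → rot u (rot u v) ≠ (rot u).symm v := fun hB hh =>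
        h.rot_rot_rot_ne huv hB.2.2.1 (by rw [hh, apply_symm_apply])
      have hcR : (R u).card = (if A u then 1 else 0) + ((if B u then 1 else 0) +
          if C u then 1 else 0) := by
        simp only [R]
        rw [Finset.card_union_of_disjoint, Finset.card_union_of_disjoint]
        · split_ifs <;> rfl
        · by_cases hB : B u
          · have := e3 hB
            split_ifs <;> simp [this]
          · simp [hB]
        · split_ifs <;> simp [e1, e2]
      rw [hcR]
      simp only [A, B, C, IsFlagged, hp]
      by_cases c1 : faceLen rot (p u, v) = 3 <;> by_cases c2 : faceLen rot (u, v) = 3 <;>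
        by_cases c3 : u = u₀ <;> by_cases c4 : p u = u₀ <;>
        by_cases c5 : faceLen rot (p u, v) = 4 <;> simp [c1, c2, c3, c4, c5] <;>
        (try subst c3) <;> (try simp_all) <;> (try split_ifs) <;> (try omega)
    have hsum := Finset.sum_le_sum hcard
    rw [Finset.sum_add_distrib, Finset.sum_add_distrib, Finset.sum_add_distrib] at hsum
    rw [← h.sum_nbrs_rot v fun u => if faceLen rot (p u, v) = 3 then 1 else 0,
      ← h.sum_nbrs_rot v fun u => if p u ≠ u₀ ∧ IsFlagged H rot (p u, v) then 1 else 0,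
      Finset.sum_ite_eq', if_pos (mem_nbrs.2 hu₀v)] at hsum
    simp only [p, symm_apply_apply] at hsum
    omega
  · intro u hvu x hx
    have huv := hvu.symm
    have hdu := hd u (deg_pos_iff.2 ⟨v, huv⟩)
    have hpu : H.Adj v (p u) := h.adj_symm hvu
    have hlt : p u ≠ u₀ → idx (p u) < idx u := by
      intro hne
      have := hidx (p u) hpu
      rw [hp] at this
      exact this fun hh => hne (by simp [p, hh])
    simp only [R, Finset.mem_union] at hx
    rcases hx with hx | hx | hx
    · split_ifs at hx with hA
      · rw [Finset.mem_singleton] at hx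
        subst hx
        refine ⟨h.rot_ne huv (by omega), h.adj huv, ?_⟩
        rcases hA with hA | ⟨hA, hA'⟩
        · left
          have := (triangle_rot hA).1
          rw [hp] at this
          rw [this]
          exact hpu
        · right
          refine ⟨p u, hpu, hlt hA, ?_⟩
          have := (square_rot hA').1
          rw [hp] at this
          have h2 := h.adj (h.adj huv).symm
          rw [this] at h2
          exact h2.symm
      · simp at hx
    · split_ifs at hx with hB
      · rw [Finset.mem_singleton] at hx
        subst hx
        refine ⟨h.rot_rot_ne huv hdu, h.adj (h.adj huv), ?_⟩
        right
        obtain ⟨hB1, hB2, -, hB4⟩ := hB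
        refine ⟨p u, hpu, hlt hB1, ?_⟩
        have h1 := (triangle_rot hB2).1
        rw [hp] at h1
        have h2 := (triangle_rot hB4).1
        rw [h1]
        have h3 := h.adj (h1 ▸ h.adj huv)
        have h4 := h.adj h3.symm
        rw [h2] at h4
        exact h4.symm
      · simp at hx
    · split_ifs at hx with hC
      · rw [Finset.mem_singleton] at hx
        subst hx
        refine ⟨fun hh => h.rot_ne huv (by omega) ((symm_apply_eq _).1 hh).symm,
          h.adj_symm huv, ?_⟩
        rcases hC with hC | ⟨rfl, hC, hC'⟩
        · left
          rw [(symm_apply_eq (rot u)).2 (triangle_rot hC).2.symm]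
          exact h.adj hvu
        · right
          refine ⟨rot v u, h.adj hvu, hidx0 u hvu fun hh => h.rot_ne hvu (by omega) hh.symm, ?_⟩
          rw [(symm_apply_eq (rot u)).2 (square_rot hC').2.symm]
          exact h.adj (h.adj hvu).symm
      · simp at hx

end SecondNbrs

/-! ### The final charge of a small vertex: arithmetic -/

/-- Lower bounds for the receipt `r` at a corner with face length `l` between neighbours of degrees
`da`, `db`, where `f = 1` for flagged corners and `t` counts triangular corners. -/
structure CornerBounds (D l da db t f r : ℕ) : Prop where
  tri : l = 3 → t = 1 ∧ 10 * (da - 6) + 10 * (db - 6) ≤ r ∧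
    (6 ≤ da → 6 ≤ db → 20 * (da - 6) + 20 * (db - 6) ≤ r ∧
      (f = 0 → 20 * (da - 6) + 20 * (db - 6) + 10 * D ≤ r))
  quad : l = 4 → t = 0 ∧ f = 1 ∧ 10 * D ≤ r ∧ (6 ≤ da ∨ 6 ≤ db → 15 * D ≤ r) ∧
    (6 ≤ da → 6 ≤ db → 20 * D ≤ r)
  long : 5 ≤ l → t = 0 ∧ f = 0 ∧ 16 * D ≤ r ∧ (6 ≤ da ∨ 6 ≤ db → 24 * D ≤ r) ∧
    (6 ≤ da → 6 ≤ db → 32 * D ≤ r)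
  three_le : 3 ≤ l
  flag_le : f ≤ 1

theorem receipt_bounds {D l da db : ℕ} {s : Prop} [Decidable s] {f : ℕ} (hl : 3 ≤ l)
    (hf : f ≤ 1) (h4 : l = 4 → f = 1) (h5 : 5 ≤ l → f = 0) (h3 : l = 3 → 4 ≤ db → f = 0 → s) :
    CornerBounds D l da db (if l = 3 then 1 else 0) f (receipt D l da db s) := by
  refine ⟨?_, ?_, ?_, hl, hf⟩
  · rintro rfl
    refine ⟨rfl, ?_, fun ha hb => ?_⟩
    · simp only [receipt, shareTwo]
      split_ifs <;> omega
    · simp only [receipt, shareTwo]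
      have := h3 rfl (by omega)
      rw [if_pos le_rfl, if_neg (by omega : ¬ da < 6), if_neg (by omega : ¬ db < 6)]
      refine ⟨by omega, fun hf0 => ?_⟩
      rw [if_pos ⟨ha, hb, this hf0⟩]
      omega
  · rintro rfl
    refine ⟨rfl, h4 rfl, ?_⟩
    simp only [receipt, shareTwo]
    split_ifs <;> omega
  · intro hl5
    refine ⟨if_neg (by omega), h5 hl5, ?_⟩
    simp only [receipt, shareTwo]
    split_ifs <;> omega

theorem CornerBounds.cases_big {D l da db t f r : ℕ} (h : CornerBounds D l da db t f r)
    (ha : 6 ≤ da) (hb : 6 ≤ db) :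
    (l = 3 ∧ t = 1 ∧ f = 0 ∧ 20 * da + 20 * db + 10 * D ≤ r + 240) ∨
    (l = 3 ∧ t = 1 ∧ f = 1 ∧ 20 * da + 20 * db ≤ r + 240) ∨
    (l = 4 ∧ t = 0 ∧ f = 1 ∧ 20 * D ≤ r) ∨ (5 ≤ l ∧ t = 0 ∧ f = 0 ∧ 32 * D ≤ r) := by
  obtain ⟨T, Q, L, m, n⟩ := h
  simp only [ha, hb, true_or, forall_const] at *
  omega

theorem CornerBounds.cases_left {D l da db t f r : ℕ} (h : CornerBounds D l da db t f r)
    (ha : 6 ≤ da) :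
    (l = 3 ∧ t = 1 ∧ 10 * da ≤ r + 60) ∨
    (l = 4 ∧ t = 0 ∧ f = 1 ∧ 15 * D ≤ r) ∨ (5 ≤ l ∧ t = 0 ∧ f = 0 ∧ 24 * D ≤ r) := by
  obtain ⟨T, Q, L, m, n⟩ := h
  simp only [ha, true_or, forall_const] at *
  omega

theorem CornerBounds.cases_right {D l da db t f r : ℕ} (h : CornerBounds D l da db t f r)
    (hb : 6 ≤ db) :
    (l = 3 ∧ t = 1 ∧ 10 * db ≤ r + 60) ∨
    (l = 4 ∧ t = 0 ∧ f = 1 ∧ 15 * D ≤ r) ∨ (5 ≤ l ∧ t = 0 ∧ f = 0 ∧ 24 * D ≤ r) := by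
  obtain ⟨T, Q, L, m, n⟩ := h
  simp only [hb, or_true, forall_const] at *
  omega

theorem CornerBounds.cases_none {D l da db t f r : ℕ} (h : CornerBounds D l da db t f r) :
    (l = 3 ∧ t = 1) ∨ (l = 4 ∧ t = 0 ∧ f = 1 ∧ 10 * D ≤ r) ∨
      (5 ≤ l ∧ t = 0 ∧ f = 0 ∧ 16 * D ≤ r) := by
  obtain ⟨T, Q, L, m, n⟩ := h
  omega

theorem charge_three {D l₀ l₁ l₂ d₀ d₁ d₂ t₀ t₁ t₂ f₀ f₁ f₂ r₀ r₁ r₂ : ℕ}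
    (h₀ : d₀ ≤ D) (h₁ : d₁ ≤ D) (h₂ : d₂ ≤ D)
    (c₀ : CornerBounds D l₀ d₀ d₁ t₀ f₀ r₀) (c₁ : CornerBounds D l₁ d₁ d₂ t₁ f₁ r₁)
    (c₂ : CornerBounds D l₂ d₂ d₀ t₂ f₂ r₂)
    (e₀ : 2 * D + 7 + 2 * (t₀ + t₁ + t₂) + (f₁ + f₂) +
      (if l₂ = 4 ∧ l₀ = 4 then 1 else 0) ≤ d₀ + d₁ + d₂)
    (e₁ : 2 * D + 7 + 2 * (t₀ + t₁ + t₂) + (f₀ + f₂) +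
      (if l₀ = 4 ∧ l₁ = 4 then 1 else 0) ≤ d₀ + d₁ + d₂)
    (e₂ : 2 * D + 7 + 2 * (t₀ + t₁ + t₂) + (f₀ + f₁) +
      (if l₁ = 4 ∧ l₂ = 4 then 1 else 0) ≤ d₀ + d₁ + d₂) :
    60 * D ≤ r₀ + r₁ + r₂ := by
  have b₀ := c₀.cases_big (by omega) (by omega)
  have b₁ := c₁.cases_big (by omega) (by omega)
  have b₂ := c₂.cases_big (by omega) (by omega)
  clear c₀ c₁ c₂
  rcases b₀ with ⟨rfl, rfl, rfl, b₀⟩ | ⟨rfl, rfl, rfl, b₀⟩ | ⟨rfl, rfl, rfl, b₀⟩ |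
    ⟨x₀, rfl, rfl, b₀⟩ <;>
  rcases b₁ with ⟨rfl, rfl, rfl, b₁⟩ | ⟨rfl, rfl, rfl, b₁⟩ | ⟨rfl, rfl, rfl, b₁⟩ |
    ⟨x₁, rfl, rfl, b₁⟩ <;>
  rcases b₂ with ⟨rfl, rfl, rfl, b₂⟩ | ⟨rfl, rfl, rfl, b₂⟩ | ⟨rfl, rfl, rfl, b₂⟩ |
    ⟨x₂, rfl, rfl, b₂⟩ <;>
  norm_num at e₀ e₁ e₂ <;> omega

theorem charge_four {D l₀ l₁ l₂ l₃ d₀ d₁ d₂ d₃ t₀ t₁ t₂ t₃ f₀ f₁ f₂ f₃ r₀ r₁ r₂ r₃ : ℕ}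
    (hD : 6 ≤ D) (h₀ : d₀ ≤ D) (h₁ : d₁ ≤ D) (h₂ : d₂ ≤ D) (h₃ : d₃ ≤ D) (hl : l₀ = 3)
    (c₀ : CornerBounds D l₀ d₀ d₁ t₀ f₀ r₀) (c₁ : CornerBounds D l₁ d₁ d₂ t₁ f₁ r₁)
    (c₂ : CornerBounds D l₂ d₂ d₃ t₂ f₂ r₂) (c₃ : CornerBounds D l₃ d₃ d₀ t₃ f₃ r₃)
    (e₀ : 2 * D + 7 + 2 * (t₀ + t₁ + t₂ + t₃) + (f₁ + f₂ + f₃) ≤ d₀ + d₁ + d₂ + d₃)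
    (e₁ : 2 * D + 7 + 2 * (t₀ + t₁ + t₂ + t₃) + (f₀ + f₂ + f₃) ≤ d₀ + d₁ + d₂ + d₃)
    (e₂ : 2 * D + 7 + 2 * (t₀ + t₁ + t₂ + t₃) + (f₀ + f₁ + f₃) ≤ d₀ + d₁ + d₂ + d₃)
    (e₃ : 2 * D + 7 + 2 * (t₀ + t₁ + t₂ + t₃) + (f₀ + f₁ + f₂) ≤ d₀ + d₁ + d₂ + d₃) :
    40 * D ≤ r₀ + r₁ + r₂ + r₃ := by
  have t0 := (c₀.tri hl).1
  by_cases g₀ : 6 ≤ d₀ <;> by_cases g₁ : 6 ≤ d₁ <;> by_cases g₂ : 6 ≤ d₂ <;>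
    by_cases g₃ : 6 ≤ d₃
  all_goals
    first
      | have b₀ := c₀.cases_big g₀ g₁
      | have b₀ := c₀.cases_left (g₀)
      | have b₀ := c₀.cases_right (g₁)
      | have b₀ := c₀.cases_none
    first
      | have b₁ := c₁.cases_big g₁ g₂
      | have b₁ := c₁.cases_left (g₁)
      | have b₁ := c₁.cases_right (g₂)
      | have b₁ := c₁.cases_none
    first
      | have b₂ := c₂.cases_big g₂ g₃
      | have b₂ := c₂.cases_left (g₂)
      | have b₂ := c₂.cases_right (g₃)
      | have b₂ := c₂.cases_none
    first
      | have b₃ := c₃.cases_big g₃ g₀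
      | have b₃ := c₃.cases_left (g₃)
      | have b₃ := c₃.cases_right (g₀)
      | have b₃ := c₃.cases_none
    clear c₀ c₁ c₂ c₃
    omega

theorem charge_four_small {D l₀ l₁ l₂ l₃ d₀ d₁ d₂ d₃ t₀ t₁ t₂ t₃ f₀ f₁ f₂ f₃ r₀ r₁ r₂ r₃ e : ℕ}
    (hD : 4 ≤ D) (hD5 : D ≤ 5) (h₀ : d₀ ≤ D) (h₁ : d₁ ≤ D) (h₂ : d₂ ≤ D) (h₃ : d₃ ≤ D)
    (c₀ : CornerBounds D l₀ d₀ d₁ t₀ f₀ r₀) (c₁ : CornerBounds D l₁ d₁ d₂ t₁ f₁ r₁)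
    (c₂ : CornerBounds D l₂ d₂ d₃ t₂ f₂ r₂) (c₃ : CornerBounds D l₃ d₃ d₀ t₃ f₃ r₃)
    (e₀ : 2 * D + 7 + e + 2 * (t₀ + t₁ + t₂ + t₃) + (f₁ + f₂ + f₃) ≤ d₀ + d₁ + d₂ + d₃)
    (e₁ : 2 * D + 7 + e + 2 * (t₀ + t₁ + t₂ + t₃) + (f₀ + f₂ + f₃) ≤ d₀ + d₁ + d₂ + d₃)
    (e₂ : 2 * D + 7 + e + 2 * (t₀ + t₁ + t₂ + t₃) + (f₀ + f₁ + f₃) ≤ d₀ + d₁ + d₂ + d₃)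
    (e₃ : 2 * D + 7 + e + 2 * (t₀ + t₁ + t₂ + t₃) + (f₀ + f₁ + f₂) ≤ d₀ + d₁ + d₂ + d₃) :
    40 * D + 6 * D * e ≤ r₀ + r₁ + r₂ + r₃ := by
  have b₀ := c₀.cases_none
  have b₁ := c₁.cases_none
  have b₂ := c₂.cases_none
  have b₃ := c₃.cases_none
  clear c₀ c₁ c₂ c₃
  obtain rfl | rfl : D = 4 ∨ D = 5 := by omega
  · omega
  · omega

set_option maxHeartbeats 1000000 in
theorem charge_five_small {l₀ l₁ l₂ l₃ l₄ d₀ d₁ d₂ d₃ d₄ t₀ t₁ t₂ t₃ t₄ f₀ f₁ f₂ f₃ f₄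
    r₀ r₁ r₂ r₃ r₄ e : ℕ} (h₀ : d₀ ≤ 5) (h₁ : d₁ ≤ 5) (h₂ : d₂ ≤ 5) (h₃ : d₃ ≤ 5) (h₄ : d₄ ≤ 5)
    (c₀ : CornerBounds 5 l₀ d₀ d₁ t₀ f₀ r₀) (c₁ : CornerBounds 5 l₁ d₁ d₂ t₁ f₁ r₁)
    (c₂ : CornerBounds 5 l₂ d₂ d₃ t₂ f₂ r₂) (c₃ : CornerBounds 5 l₃ d₃ d₄ t₃ f₃ r₃)
    (c₄ : CornerBounds 5 l₄ d₄ d₀ t₄ f₄ r₄)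
    (e₁ : 17 + e + 2 * (t₀ + t₁ + t₂ + t₃ + t₄) + (f₀ + f₂ + f₃ + f₄) ≤ d₀ + d₁ + d₂ + d₃ + d₄)
    (e₂ : 17 + e + 2 * (t₀ + t₁ + t₂ + t₃ + t₄) + (f₀ + f₁ + f₃ + f₄) ≤ d₀ + d₁ + d₂ + d₃ + d₄)
    (e₃ : 17 + e + 2 * (t₀ + t₁ + t₂ + t₃ + t₄) + (f₀ + f₁ + f₂ + f₄) ≤ d₀ + d₁ + d₂ + d₃ + d₄)
    (e₄ : 17 + e + 2 * (t₀ + t₁ + t₂ + t₃ + t₄) + (f₀ + f₁ + f₂ + f₃) ≤ d₀ + d₁ + d₂ + d₃ + d₄)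
    (ht : t₀ + t₁ + t₂ + t₃ + t₄ ≤ 3) :
    100 + 30 * e ≤ r₀ + r₁ + r₂ + r₃ + r₄ := by
  have b₀ := c₀.cases_none
  have b₁ := c₁.cases_none
  have b₂ := c₂.cases_none
  have b₃ := c₃.cases_none
  have b₄ := c₄.cases_none
  clear c₀ c₁ c₂ c₃ c₄
  omega

set_option maxHeartbeats 4000000 in
theorem charge_five {D l₀ l₁ l₂ l₃ l₄ d₀ d₁ d₂ d₃ d₄ t₀ t₁ t₂ t₃ t₄ f₀ f₁ f₂ f₃ f₄
    r₀ r₁ r₂ r₃ r₄ e : ℕ} (hD : 5 ≤ D)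
    (h₀ : d₀ ≤ D) (h₁ : d₁ ≤ D) (h₂ : d₂ ≤ D) (h₃ : d₃ ≤ D) (h₄ : d₄ ≤ D)
    (c₀ : CornerBounds D l₀ d₀ d₁ t₀ f₀ r₀) (c₁ : CornerBounds D l₁ d₁ d₂ t₁ f₁ r₁)
    (c₂ : CornerBounds D l₂ d₂ d₃ t₂ f₂ r₂) (c₃ : CornerBounds D l₃ d₃ d₄ t₃ f₃ r₃)
    (c₄ : CornerBounds D l₄ d₄ d₀ t₄ f₄ r₄) (x₀ : l₀ = 3) (x₁ : l₁ = 3) (x₂ : l₂ = 3) (x₃ : l₃ = 3)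
    (e₀ : 2 * D + 7 + e + 2 * (t₀ + t₁ + t₂ + t₃ + t₄) + (f₁ + f₂ + f₃ + f₄) ≤
      d₀ + d₁ + d₂ + d₃ + d₄)
    (e₁ : 2 * D + 7 + e + 2 * (t₀ + t₁ + t₂ + t₃ + t₄) + (f₀ + f₂ + f₃ + f₄) ≤
      d₀ + d₁ + d₂ + d₃ + d₄)
    (e₂ : 2 * D + 7 + e + 2 * (t₀ + t₁ + t₂ + t₃ + t₄) + (f₀ + f₁ + f₃ + f₄) ≤
      d₀ + d₁ + d₂ + d₃ + d₄)
    (e₃ : 2 * D + 7 + e + 2 * (t₀ + t₁ + t₂ + t₃ + t₄) + (f₀ + f₁ + f₂ + f₄) ≤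
      d₀ + d₁ + d₂ + d₃ + d₄)
    (e₄ : 2 * D + 7 + e + 2 * (t₀ + t₁ + t₂ + t₃ + t₄) + (f₀ + f₁ + f₂ + f₃) ≤
      d₀ + d₁ + d₂ + d₃ + d₄) :
    (20 * D ≤ r₀ + r₁ + r₂ + r₃ + r₄ ∧ (D = 5 → e = 0)) ∨
      (5 ≤ l₄ ∧ d₀ = 5 ∧ d₄ = 5 ∧ 4 ≤ d₁ ∧ f₀ = 0 ∧ f₃ = 0 ∧ e = 0 ∧ 16 * D ≤ r₄) := by
  obtain rfl := (c₀.tri x₀).1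
  obtain rfl := (c₁.tri x₁).1
  obtain rfl := (c₂.tri x₂).1
  obtain rfl := (c₃.tri x₃).1
  have k₀ := c₀.flag_le
  have k₁ := c₁.flag_le
  have k₂ := c₂.flag_le
  have k₃ := c₃.flag_le
  have k₄ := c₄.flag_le
  have E : (2 * D + 7 + e + 2 * (1 + 1 + 1 + 1 + t₄) + (f₀ + f₁ + f₂ + f₃ + f₄) ≤
      d₀ + d₁ + d₂ + d₃ + d₄) ∨ (f₀ = 1 ∧ f₁ = 1 ∧ f₂ = 1 ∧ f₃ = 1 ∧ f₄ = 1 ∧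
      2 * D + 7 + e + 2 * (1 + 1 + 1 + 1 + t₄) + 4 ≤ d₀ + d₁ + d₂ + d₃ + d₄) := by omega
  clear e₀ e₁ e₂ e₃ e₄
  subst x₀ x₁ x₂ x₃
  by_cases g₀ : 6 ≤ d₀ <;> by_cases g₁ : 6 ≤ d₁ <;> by_cases g₂ : 6 ≤ d₂ <;>
    by_cases g₃ : 6 ≤ d₃ <;> by_cases g₄ : 6 ≤ d₄
  all_goals
    first
      | have b₀ := c₀.cases_big g₀ g₁
      | have b₀ := c₀.cases_left (g₀)
      | have b₀ := c₀.cases_right (g₁)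
      | have b₀ := c₀.cases_none
    first
      | have b₁ := c₁.cases_big g₁ g₂
      | have b₁ := c₁.cases_left (g₁)
      | have b₁ := c₁.cases_right (g₂)
      | have b₁ := c₁.cases_none
    first
      | have b₂ := c₂.cases_big g₂ g₃
      | have b₂ := c₂.cases_left (g₂)
      | have b₂ := c₂.cases_right (g₃)
      | have b₂ := c₂.cases_none
    first
      | have b₃ := c₃.cases_big g₃ g₄
      | have b₃ := c₃.cases_left (g₃)
      | have b₃ := c₃.cases_right (g₄)
      | have b₃ := c₃.cases_none
    first
      | have b₄ := c₄.cases_big g₄ g₀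
      | have b₄ := c₄.cases_left (g₄)
      | have b₄ := c₄.cases_right (g₀)
      | have b₄ := c₄.cases_none
    clear c₀ c₁ c₂ c₃ c₄
    simp only [Nat.reduceEqDiff, Nat.reduceLeDiff, false_and, or_false, true_and, and_true, one_ne_zero, and_false] at b₀ b₁ b₂ b₃
    all_goals first
    | (clear b₀ b₁ b₂ b₃ b₄
       omega)
    | (rcases b₄ with b₄ | b₄ | b₄ <;> rcases E with E | E <;> first
       | (clear b₀ b₁ b₂ b₃
          omega)
       | (refine Or.inl ⟨?_, by clear b₀ b₁ b₂ b₃; omega⟩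
          try rcases b₀ with ⟨rfl, b₀⟩ | ⟨rfl, b₀⟩
          all_goals try rcases b₁ with ⟨rfl, b₁⟩ | ⟨rfl, b₁⟩
          all_goals try rcases b₂ with ⟨rfl, b₂⟩ | ⟨rfl, b₂⟩
          all_goals try rcases b₃ with ⟨rfl, b₃⟩ | ⟨rfl, b₃⟩
          all_goals omega))

/-! ### Removing uncoloured vertices -/

section Removal
set_option linter.unusedSectionVars false
open Equiv Equiv.Perm
variable {W : Type*} [Fintype W]

/-- The vertex `w` can be made isolated, keeping the graph planar of maximum degree at most `D` and
all pairs of other vertices at distance at most two within distance two. -/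
def Removable (H : SimpleGraph W) (D : ℕ) (w : W) : Prop :=
  ∃ T : SimpleGraph W, CombPlanar T ∧ (∀ x, deg T x ≤ D) ∧ (∀ x, ¬ T.Adj w x) ∧
    (∀ x y, T.Adj x y → H.Adj x y ∨ H.Adj w x ∧ H.Adj w y) ∧
    (∀ x y, x ≠ w → y ≠ w → H.Adj x y → T.Adj x y) ∧
    ∀ x y, H.Adj w x → H.Adj w y → x ≠ y → T.Adj x y ∨ ∃ z, T.Adj x z ∧ T.Adj z y

theorem Removable.of_relation {H K : SimpleGraph W} {D : ℕ} {w : W} (hK : CombPlanar K)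
    (hHK : ∀ x y, x ≠ w → y ≠ w → H.Adj x y → K.Adj x y) (R : W → W → Prop)
    (hsymm : ∀ x y, R x y → R y x) (hR : ∀ x y, R x y → H.Adj w x ∧ H.Adj w y ∧ K.Adj x y)
    (hD : ∀ x, deg H x ≤ D)
    (hcard : ∀ x, H.Adj w x → ∃ s : Finset W, (∀ y, R x y → ¬ H.Adj x y → y ∈ s) ∧
      deg H x + s.card ≤ D + 1)
    (hpairs : ∀ x y, H.Adj w x → H.Adj w y → x ≠ y → (H.Adj x y ∨ R x y) ∨
      ∃ z, z ≠ w ∧ (H.Adj x z ∨ R x z) ∧ (H.Adj z y ∨ R z y)) : Removable H D w := by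
  classical
  let T : SimpleGraph W :=
    { Adj := fun x y => x ≠ w ∧ y ≠ w ∧ (H.Adj x y ∨ R x y)
      symm := ⟨fun x y ⟨h1, h2, h3⟩ => ⟨h2, h1, h3.imp (fun h => h.symm) (hsymm x y)⟩⟩
      loopless := ⟨fun x ⟨_, _, h3⟩ => h3.elim (fun h => h.ne rfl) fun h => (hR x x h).2.2.ne rfl⟩ }
  have hT : ∀ x y, T.Adj x y ↔ x ≠ w ∧ y ≠ w ∧ (H.Adj x y ∨ R x y) := fun _ _ => Iff.rfl
  refine ⟨T, hK.mono ?_, fun x => ?_, fun x h => h.1 rfl, ?_, fun x y hx hy hxy =>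
    ⟨hx, hy, Or.inl hxy⟩, ?_⟩
  · rintro x y ⟨hx, hy, h | h⟩
    · exact hHK x y hx hy h
    · exact (hR x y h).2.2
  · by_cases hx : H.Adj w x
    · obtain ⟨s, hs, h2⟩ := hcard x hx
      have hsub : nbrs T x ⊆ (nbrs H x).erase w ∪ s := by
        intro y hy
        rw [mem_nbrs, hT] at hy
        simp only [Finset.mem_union, Finset.mem_erase, mem_nbrs]
        have := hs y
        tauto
      have h1 := (Finset.card_le_card hsub).trans (Finset.card_union_le _ _)
      rw [Finset.card_erase_of_mem (mem_nbrs.2 hx.symm)] at h1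
      have h3 : 0 < deg H x := deg_pos_iff.2 ⟨w, hx.symm⟩
      unfold deg at *
      omega
    · refine (Finset.card_le_card fun y hy => ?_).trans (hD x)
      rw [mem_nbrs, hT] at hy
      rw [mem_nbrs]
      exact hy.2.2.resolve_right fun h => hx (hR x y h).1
  · rintro x y ⟨-, -, h | h⟩
    · exact Or.inl h
    · exact Or.inr ⟨(hR x y h).1, (hR x y h).2.1⟩
  · intro x y hx hy hxy
    rcases hpairs x y hx hy hxy with h | ⟨z, hz, h1, h2⟩
    · exact Or.inl ⟨hx.ne', hy.ne', h⟩
    · exact Or.inr ⟨z, ⟨hx.ne', hz, h1⟩, ⟨hz, hy.ne', h2⟩⟩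

open Classical in
/-- Contracting `w` into a neighbour `v` that does not get too many new neighbours. -/
theorem Removable.of_contract {H : SimpleGraph W} {D : ℕ} {w v : W} (h : CombPlanar H)
    (hD : ∀ x, deg H x ≤ D) (hwv : H.Adj w v)
    (hcard : deg H v + deg H w ≤ D + 2 + (nbrs H w ∩ nbrs H v).card) : Removable H D w := by
  obtain ⟨K, hK, hHK, hKv⟩ := h.exists_contract hwv.symm
  refine Removable.of_relation hK hHK
    (fun x y => x ≠ y ∧ (x = v ∧ H.Adj w y ∨ y = v ∧ H.Adj w x)) ?_ ?_ hD ?_ ?_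
  · rintro x y ⟨h1, h2⟩
    exact ⟨h1.symm, h2.symm⟩
  · rintro x y ⟨h1, ⟨rfl, h2⟩ | ⟨rfl, h2⟩⟩
    · exact ⟨hwv, h2, hKv y h1.symm h2⟩
    · exact ⟨h2, hwv, (hKv x h1 h2).symm⟩
  · intro x hx
    by_cases hxv : x = v
    · subst hxv
      refine ⟨(nbrs H w \ nbrs H x).erase x, fun y hy hn => ?_, ?_⟩
      · simp only [Finset.mem_erase, Finset.mem_sdiff, mem_nbrs]
        refine ⟨hy.1.symm, ?_, hn⟩
        rcases hy.2 with ⟨-, h1⟩ | ⟨h1, -⟩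
        · exact h1
        · exact absurd h1.symm hy.1
      · rw [Finset.card_erase_of_mem (by simpa using hx)]
        have h2 := Finset.card_sdiff_add_card_inter (nbrs H w) (nbrs H x)
        have h3 : 0 < (nbrs H w \ nbrs H x).card := Finset.card_pos.2 ⟨x, by simpa using hx⟩
        have h4 : deg H w = (nbrs H w).card := rfl
        omega
    · refine ⟨{v}, fun y hy _ => ?_, ?_⟩
      · rw [Finset.mem_singleton]
        tauto
      · have := hD x
        rw [Finset.card_singleton]
        omega
  · intro x y hx hy hxy
    by_cases hxv : x = v
    · exact Or.inl (Or.inr ⟨hxy, Or.inl ⟨hxv, hy⟩⟩)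
    by_cases hyv : y = v
    · exact Or.inl (Or.inr ⟨hxy, Or.inr ⟨hyv, hx⟩⟩)
    exact Or.inr ⟨v, hwv.ne', Or.inr ⟨hxv, Or.inr ⟨rfl, hx⟩⟩,
      Or.inr ⟨fun h => hyv h.symm, Or.inl ⟨rfl, hy⟩⟩⟩

/-- Joining two consecutive neighbours of `w`. -/
theorem Removable.of_edge {H : SimpleGraph W} {rot : W → Perm W} {D : ℕ} {w a b : W}
    (h : PlanarRot H rot) (hD : ∀ x, deg H x ≤ D) (hwa : H.Adj w a) (hb : rot w a = b)
    (hne : a ≠ b) (hpairs : ∀ x y, H.Adj w x → H.Adj w y → x ≠ y →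
      (H.Adj x y ∨ (x = a ∧ y = b ∨ x = b ∧ y = a)) ∨
      ∃ z, z ≠ w ∧ (H.Adj x z ∨ (x = a ∧ z = b ∨ x = b ∧ z = a)) ∧
        (H.Adj z y ∨ (z = a ∧ y = b ∨ z = b ∧ y = a))) : Removable H D w := by
  classical
  obtain ⟨K, hK, hHK, hKa⟩ := h.exists_wheel w
  have hwb := h.toIsRotation.adj hwa
  have hab := hKa a hwa (by rwa [hb])
  rw [hb] at hwb hab
  refine Removable.of_relation hK (fun x y _ _ hxy => hHK hxy)
    (fun x y => x = a ∧ y = b ∨ x = b ∧ y = a) ?_ ?_ hD ?_ hpairs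
  · rintro x y (⟨h1, h2⟩ | ⟨h1, h2⟩)
    · exact Or.inr ⟨h2, h1⟩
    · exact Or.inl ⟨h2, h1⟩
  · rintro x y (⟨rfl, rfl⟩ | ⟨rfl, rfl⟩)
    · exact ⟨hwa, hwb, hab⟩
    · exact ⟨hwb, hwa, hab.symm⟩
  · intro x hx
    have := hD x
    by_cases hxa : x = a
    · refine ⟨{b}, fun y hy _ => ?_, by rw [Finset.card_singleton]; omega⟩
      rcases hy with hy | hy
      · simpa using hy.2
      · exact absurd (hxa.symm.trans hy.1) hne
    · refine ⟨{a}, fun y hy _ => ?_, by rw [Finset.card_singleton]; omega⟩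
      rcases hy with hy | hy
      · exact absurd hy.1 hxa
      · simpa using hy.2

/-- A quadrilateral corner yields a second common neighbour. -/
theorem IsRotation.exists_of_square {H : SimpleGraph W} {rot : W → Perm W} (h : IsRotation H rot)
    (hd : ∀ u, 0 < deg H u → 3 ≤ deg H u) {v a : W} (ha : H.Adj v a)
    (h4 : faceLen rot (a, v) = 4) : ∃ z, z ≠ v ∧ H.Adj a z ∧ H.Adj z (rot v a) := by
  have hb := h.adj ha
  have hdb : 3 ≤ deg H (rot v a) := hd _ (deg_pos_iff.2 ⟨v, hb.symm⟩)
  have hz := h.adj hb.symm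
  have hz' := h.adj hz.symm
  rw [(square_rot h4).1] at hz'
  exact ⟨rot (rot v a) v, h.rot_ne hb.symm (by omega), hz'.symm, hz.symm⟩

open Classical in
theorem not_removable_deg {H : SimpleGraph W} {D : ℕ} {w v : W} (h : CombPlanar H)
    (hD : ∀ x, deg H x ≤ D) (hw : ¬ Removable H D w) (hwv : H.Adj w v) :
    D + 2 + (nbrs H w ∩ nbrs H v).card < deg H v + deg H w := by
  by_contra! hc
  exact hw (Removable.of_contract h hD hwv hc)

theorem IsRotation.mem_of_deg_three {H : SimpleGraph W} {rot : W → Perm W} (h : IsRotation H rot)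
    {v a x : W} (ha : H.Adj v a) (hd : deg H v = 3) (hx : H.Adj v x) :
    x = a ∨ x = rot v a ∨ x = rot v (rot v a) := by
  classical
  have := mem_nbrs.2 hx
  rw [h.nbrs_eq ha, hd] at this
  obtain ⟨i, hi, rfl⟩ := Finset.mem_image.1 this
  rw [Finset.mem_range] at hi
  interval_cases i <;> simp [pow_succ']

theorem IsRotation.mem_of_deg_five {H : SimpleGraph W} {rot : W → Perm W} (h : IsRotation H rot)
    {v a x : W} (ha : H.Adj v a) (hd : deg H v = 5) (hx : H.Adj v x) :
    x = a ∨ x = rot v a ∨ x = rot v (rot v a) ∨ x = rot v (rot v (rot v a)) ∨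
      x = rot v (rot v (rot v (rot v a))) := by
  classical
  have := mem_nbrs.2 hx
  rw [h.nbrs_eq ha, hd] at this
  obtain ⟨i, hi, rfl⟩ := Finset.mem_image.1 this
  rw [Finset.mem_range] at hi
  interval_cases i <;> simp [pow_succ']

/-- Consecutive corners at a nonremovable vertex of degree three are not both quadrilateral. -/
theorem not_removable_three {H : SimpleGraph W} {rot : W → Perm W} {D : ℕ} {w a : W}
    (h : PlanarRot H rot) (hD : ∀ x, deg H x ≤ D) (hd : ∀ u, 0 < deg H u → 3 ≤ deg H u)
    (hw : ¬ Removable H D w) (hwa : H.Adj w a) (h3 : deg H w = 3)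
    (h1 : faceLen rot (rot w a, w) = 4) : faceLen rot (rot w (rot w a), w) ≠ 4 := by
  intro h2
  have hr := h.toIsRotation
  have hwb := hr.adj hwa
  have hwc := hr.adj hwb
  obtain ⟨y, hy, hby, hyc⟩ := hr.exists_of_square hd hwb h1
  obtain ⟨z, hz, hcz, hza⟩ := hr.exists_of_square hd hwc h2
  have h4 : rot w (rot w (rot w a)) = a := by
    have := hr.pow_deg hwa
    rwa [h3] at this
  rw [h4] at hza
  have hmem := fun x => hr.mem_of_deg_three hwa h3 (x := x)
  refine hw (Removable.of_edge h hD hwa rfl (hr.rot_ne hwa (by omega)).symm fun u v hu hv huv => ?_)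
  rcases hmem u hu with rfl | rfl | rfl <;> rcases hmem v hv with rfl | rfl | rfl
  · exact absurd rfl huv
  · exact Or.inl (Or.inr (Or.inl ⟨rfl, rfl⟩))
  · exact Or.inr ⟨z, hz, Or.inl hza.symm, Or.inl hcz.symm⟩
  · exact Or.inl (Or.inr (Or.inr ⟨rfl, rfl⟩))
  · exact absurd rfl huv
  · exact Or.inr ⟨y, hy, Or.inl hby, Or.inl hyc⟩
  · exact Or.inr ⟨z, hz, Or.inl hcz, Or.inl hza⟩
  · exact Or.inr ⟨y, hy, Or.inl hyc.symm, Or.inl hby.symm⟩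
  · exact absurd rfl huv

/-- A nonremovable vertex of degree five has no four consecutive triangular corners. -/
theorem not_removable_five {H : SimpleGraph W} {rot : W → Perm W} {D : ℕ} {w a b c d e : W}
    (h : PlanarRot H rot) (hD : ∀ x, deg H x ≤ D) (hw : ¬ Removable H D w) (hwa : H.Adj w a)
    (h5 : deg H w = 5) (hb : rot w a = b) (hc : rot w b = c) (hd : rot w c = d) (he : rot w d = e)
    (h1 : faceLen rot (b, w) = 3) (h2 : faceLen rot (c, w) = 3) (h3 : faceLen rot (d, w) = 3) :
    faceLen rot (e, w) ≠ 3 := by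
  intro h4
  have hr := h.toIsRotation
  have hne : a ≠ b := by
    rw [← hb]
    exact (hr.rot_ne hwa (by omega)).symm
  have hwb : H.Adj w b := hb ▸ hr.adj hwa
  have hwc : H.Adj w c := hc ▸ hr.adj hwb
  have hwd : H.Adj w d := hd ▸ hr.adj hwc
  have hwe : H.Adj w e := he ▸ hr.adj hwd
  have hbc : H.Adj b c := hc ▸ hr.adj_of_triangle hwb h1
  have hcd : H.Adj c d := hd ▸ hr.adj_of_triangle hwc h2
  have hde : H.Adj d e := he ▸ hr.adj_of_triangle hwd h3
  have hea : H.Adj e a := by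
    have h6 := hr.adj_of_triangle hwe h4
    have h7 : rot w (rot w (rot w (rot w (rot w a)))) = a := by
      have := hr.pow_deg hwa
      rwa [h5] at this
    rw [hb, hc, hd, he] at h7
    rwa [h7] at h6
  have hmem : ∀ x, H.Adj w x → x = a ∨ x = b ∨ x = c ∨ x = d ∨ x = e := by
    intro x hx
    have := hr.mem_of_deg_five hwa h5 hx
    rwa [hb, hc, hd, he] at this
  refine hw (Removable.of_edge h hD hwa hb hne fun u v hu hv huv => ?_)
  have key : ∀ x y : W, (x = a ∧ y = b ∨ x = b ∧ y = a) ∨ (x = a ∧ y = c ∨ x = c ∧ y = a) ∨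
      (x = b ∧ y = e ∨ x = e ∧ y = b) ∨ H.Adj x y ∨ (∃ z, z ≠ w ∧ H.Adj x z ∧ H.Adj z y) →
      (H.Adj x y ∨ (x = a ∧ y = b ∨ x = b ∧ y = a)) ∨
      ∃ z, z ≠ w ∧ (H.Adj x z ∨ (x = a ∧ z = b ∨ x = b ∧ z = a)) ∧
        (H.Adj z y ∨ (z = a ∧ y = b ∨ z = b ∧ y = a)) := by
    rintro x y (h6 | (⟨rfl, rfl⟩ | ⟨rfl, rfl⟩) | (⟨rfl, rfl⟩ | ⟨rfl, rfl⟩) | h6 | ⟨z, hz, h6, h7⟩)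
    · exact Or.inl (Or.inr h6)
    · exact Or.inr ⟨b, hwb.ne', Or.inr (Or.inl ⟨rfl, rfl⟩), Or.inl hbc⟩
    · exact Or.inr ⟨b, hwb.ne', Or.inl hbc.symm, Or.inr (Or.inr ⟨rfl, rfl⟩)⟩
    · exact Or.inr ⟨a, hwa.ne', Or.inr (Or.inr ⟨rfl, rfl⟩), Or.inl hea.symm⟩
    · exact Or.inr ⟨a, hwa.ne', Or.inl hea, Or.inr (Or.inl ⟨rfl, rfl⟩)⟩
    · exact Or.inl (Or.inl h6)
    · exact Or.inr ⟨z, hz, Or.inl h6, Or.inl h7⟩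
  apply key
  rcases hmem u hu with rfl | rfl | rfl | rfl | rfl <;>
    rcases hmem v hv with rfl | rfl | rfl | rfl | rfl <;>
  first
  | exact absurd rfl huv
  | exact Or.inl (Or.inl ⟨rfl, rfl⟩)
  | exact Or.inl (Or.inr ⟨rfl, rfl⟩)
  | exact Or.inr (Or.inl (Or.inl ⟨rfl, rfl⟩))
  | exact Or.inr (Or.inl (Or.inr ⟨rfl, rfl⟩))
  | exact Or.inr (Or.inr (Or.inl (Or.inl ⟨rfl, rfl⟩)))
  | exact Or.inr (Or.inr (Or.inl (Or.inr ⟨rfl, rfl⟩)))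
  | exact Or.inr (Or.inr (Or.inr (Or.inl (by first | assumption | (symm; assumption)))))
  | exact Or.inr (Or.inr (Or.inr (Or.inr ⟨_, hwc.ne', by first | assumption | (symm; assumption), by first | assumption | (symm; assumption)⟩)))
  | exact Or.inr (Or.inr (Or.inr (Or.inr ⟨_, hwd.ne', by first | assumption | (symm; assumption), by first | assumption | (symm; assumption)⟩)))
  | exact Or.inr (Or.inr (Or.inr (Or.inr ⟨_, hwe.ne', by first | assumption | (symm; assumption), by first | assumption | (symm; assumption)⟩)))

end Removal

/-! ### Critical configurations -/

section Critical
set_option linter.unusedSectionVars false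
open Equiv Equiv.Perm
variable {W : Type*} [Fintype W]

open Classical in
/-- A configuration in which the set `U` of coloured vertices cannot be reduced. -/
structure Critical (H : SimpleGraph W) (rot : W → Perm W) (U : Finset W) (D : ℕ) : Prop where
  planar : PlanarRot H rot
  deg_le : ∀ v, deg H v ≤ D
  mem_or_mem : ∀ x y, H.Adj x y → x ∈ U ∨ y ∈ U
  heavy : ∀ v ∈ U, 2 * D + 7 + (nbrsTwo H v \ U).card ≤ (nbrsTwo H v).card
  not_removable : ∀ w, w ∉ U → 0 < deg H w → ¬ Removable H D w

variable {H : SimpleGraph W} {rot : W → Perm W} {U : Finset W} {D : ℕ}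

theorem Critical.three_le_deg (h : Critical H rot U D) (u : W) (hu : 0 < deg H u) :
    3 ≤ deg H u := by
  classical
  by_cases hU : u ∈ U
  · have h1 := h.heavy u hU
    have h2 := card_nbrsTwo_le H u
    have h3 : ∑ a ∈ nbrs H u, deg H a ≤ deg H u * D := by
      refine (Finset.sum_le_card_nsmul _ _ D fun a _ => h.deg_le a).trans_eq ?_
      rw [smul_eq_mul]
      rfl
    by_contra! h4
    have h5 : deg H u * D ≤ 2 * D := Nat.mul_le_mul_right D (by omega)
    omega
  · obtain ⟨a, ha⟩ := deg_pos_iff.1 hu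
    have h1 := not_removable_deg ⟨rot, h.planar⟩ h.deg_le (h.not_removable u hU hu) ha
    have h2 := h.deg_le a
    omega

theorem Critical.three_le_faceLen (h : Critical H rot U D) (x : W × W) (hx : x ∈ darts H) :
    3 ≤ faceLen rot x := by
  refine h.planar.toIsRotation.three_le_faceLen hx ?_
  have := h.three_le_deg x.2 (deg_pos_iff.2 ⟨x.1, (mem_darts.1 hx).symm⟩)
  omega

open Classical in
theorem Critical.cornerBounds (h : Critical H rot U D) {v a : W} (ha : H.Adj v a) :
    CornerBounds D (faceLen rot (a, v)) (deg H a) (deg H (rot v a))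
      (if faceLen rot (a, v) = 3 then 1 else 0) (if IsFlagged H rot (a, v) then 1 else 0)
      (cornerReceipt H rot D (a, v)) := by
  refine receipt_bounds (h.three_le_faceLen _ (by simpa using ha.symm)) (by split_ifs <;> simp)
    (fun h4 => if_pos (Or.inl h4)) (fun h5 => if_neg ?_) fun h3 hd hf => ?_
  · rintro (h4 | ⟨h4, -⟩) <;> omega
  · have hd' : 4 ≤ deg H (rot v a) := hd
    rw [acrossPerm_of_triangle h3]
    have h1 := h.planar.toIsRotation.adj_of_triangle ha h3
    have h2 := h.three_le_faceLen (a, rot v a) (by simpa using h1)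
    have h4 : faceLen rot (a, rot v a) ≠ 3 := by
      intro h5
      have hfl : IsFlagged H rot (a, v) := Or.inr ⟨h3, hd', h5⟩
      rw [if_pos hfl] at hf
      exact one_ne_zero hf
    omega

open Classical in
theorem Critical.heavy_flags (h : Critical H rot U D) {v w : W} (hv : v ∈ U) (hw : H.Adj v w) :
    2 * D + 7 + (nbrsTwo H v \ U).card +
      2 * ∑ u ∈ nbrs H v, (if faceLen rot (u, v) = 3 then 1 else 0) +
      ∑ u ∈ nbrs H v, (if IsFlagged H rot (u, v) then 1 else 0) +
      (if faceLen rot (w, v) = 4 ∧ faceLen rot (rot v w, v) = 4 then 1 else 0) ≤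
    ∑ u ∈ nbrs H v, deg H u + (if IsFlagged H rot (rot v w, v) then 1 else 0) := by
  have h1 := h.planar.toIsRotation.card_nbrsTwo_add_flags_le h.three_le_deg hw rfl
  have h2 := h.heavy v hv
  have h3 : ∑ u ∈ nbrs H v, (if IsFlagged H rot (u, v) then 1 else 0) ≤
      ∑ u ∈ nbrs H v, (if u ≠ rot v w ∧ IsFlagged H rot (u, v) then 1 else 0) +
        (if IsFlagged H rot (rot v w, v) then 1 else 0) := by
    have h4 : (if IsFlagged H rot (rot v w, v) then 1 else 0) = ∑ u ∈ nbrs H v,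
        (if u = rot v w then (if IsFlagged H rot (rot v w, v) then 1 else 0) else 0) := by
      rw [Finset.sum_ite_eq', if_pos (mem_nbrs.2 (h.planar.toIsRotation.adj hw))]
    rw [h4, ← Finset.sum_add_distrib]
    refine Finset.sum_le_sum fun u _ => ?_
    by_cases hu : u = rot v w
    · subst hu
      simp
    · simp [hu]
  omega

/-- The corner `(a, v)` lies on a long face between two vertices of degree five that can afford to
support `v`. -/
def IsSupported (H : SimpleGraph W) (rot : W → Perm W) (U : Finset W) (x : W × W) : Prop :=
  5 ≤ faceLen rot x ∧
  (deg H x.1 = 5 ∧ x.1 ∈ U ∧ (∀ y, H.Adj x.1 y → y ∈ U) ∧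
    4 ≤ faceLen rot (rot x.1 x.2, x.1)) ∧
  (deg H (rot x.2 x.1) = 5 ∧ rot x.2 x.1 ∈ U ∧ (∀ y, H.Adj (rot x.2 x.1) y → y ∈ U) ∧
    4 ≤ faceLen rot ((rot (rot x.2 x.1)).symm ((rot (rot x.2 x.1)).symm x.2), rot x.2 x.1))

open Classical in
/-- The charge moved to the corner `x` from the corners next to it on its face. -/
noncomputable def faceTransfer (H : SimpleGraph W) (rot : W → Perm W) (U : Finset W) (D : ℕ)
    (x : W × W) : ℤ :=
  4 * D * (if IsSupported H rot U x then 1 else 0) -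
    2 * D * (if IsSupported H rot U (facePerm rot x) then 1 else 0) -
    2 * D * (if IsSupported H rot U ((facePerm rot).symm x) then 1 else 0)

open Classical in
/-- The charge moved along the dart `x` to an uncoloured vertex, when degrees are small. -/
noncomputable def gift (U : Finset W) (D : ℕ) (x : W × W) : ℤ :=
  if D ≤ 5 then
    6 * D * ((if x.1 ∈ U ∧ x.2 ∉ U then 1 else 0) - (if x.1 ∉ U ∧ x.2 ∈ U then 1 else 0))
  else 0

theorem sum_faceTransfer (h : IsRotation H rot) (U : Finset W) (D : ℕ) :
    ∑ x ∈ darts H, faceTransfer H rot U D x = 0 := by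
  classical
  simp only [faceTransfer, Finset.sum_sub_distrib, ← Finset.mul_sum]
  rw [sum_darts_perm (facePerm rot) (facePerm_mem_darts h)
      (fun x => if IsSupported H rot U x then (1 : ℤ) else 0),
    sum_darts_perm (facePerm rot).symm
      (fun x => by rw [← facePerm_mem_darts h, apply_symm_apply])
      (fun x => if IsSupported H rot U x then (1 : ℤ) else 0)]
  ring

theorem sum_gift (H : SimpleGraph W) (U : Finset W) (D : ℕ) : ∑ x ∈ darts H, gift U D x = 0 := by
  classical
  unfold gift
  split_ifs
  · simp only [← Finset.mul_sum, Finset.sum_sub_distrib]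
    rw [← sum_darts_perm (Equiv.prodComm W W) (fun x => by simp [H.adj_comm])
      (fun x => if x.1 ∉ U ∧ x.2 ∈ U then (1 : ℤ) else 0)]
    simp [and_comm]
  · simp

/-- The vertex `v` can afford to support corners next to it: a loss at the corner of `a` comes with
a long face there and another face that is not a triangle. -/
theorem supported_facePerm {v a : W} (hs : IsSupported H rot U (facePerm rot (a, v))) :
    deg H v = 5 ∧ v ∈ U ∧ (∀ y, H.Adj v y → y ∈ U) ∧ 5 ≤ faceLen rot (a, v) ∧
      4 ≤ faceLen rot (rot v (rot v a), v) := by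
  obtain ⟨h1, ⟨h2, h3, h4, h5⟩, -⟩ := hs
  rw [faceLen_facePerm] at h1
  exact ⟨h2, h3, h4, h1, h5⟩

theorem supported_facePerm_symm {v a : W}
    (hs : IsSupported H rot U ((facePerm rot).symm (a, v))) :
    deg H v = 5 ∧ v ∈ U ∧ (∀ y, H.Adj v y → y ∈ U) ∧ 5 ≤ faceLen rot (a, v) ∧
      4 ≤ faceLen rot ((rot v).symm ((rot v).symm a), v) := by
  obtain ⟨⟨y, z⟩, hy⟩ : ∃ y, (facePerm rot).symm (a, v) = y := ⟨_, rfl⟩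
  rw [hy] at hs
  rw [Equiv.symm_apply_eq] at hy
  obtain ⟨h1, -, h2, h3, h4, h5⟩ := hs
  rw [hy, faceLen_facePerm]
  rw [facePerm_apply, Prod.mk.injEq] at hy
  obtain ⟨rfl, rfl⟩ := hy
  exact ⟨h2, h3, h4, h1, h5⟩

theorem faceTransfer_nonneg {v a : W} (h1 : ¬ IsSupported H rot U (facePerm rot (a, v)))
    (h2 : ¬ IsSupported H rot U ((facePerm rot).symm (a, v))) :
    0 ≤ faceTransfer H rot U D (a, v) := by
  classical
  unfold faceTransfer
  rw [if_neg h1, if_neg h2]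
  split_ifs <;> simp

theorem Critical.transfer_nonneg (h : Critical H rot U D) (x : W × W) (hx : 6 ≤ deg H x.2) :
    0 ≤ faceTransfer H rot U D x + gift U D x := by
  obtain ⟨a, v⟩ := x
  simp only at hx
  have h5 : deg H v ≠ 5 := by omega
  have h1 := faceTransfer_nonneg (rot := rot) (U := U) (D := D) (v := v) (a := a)
    (fun hs => h5 (supported_facePerm hs).1) (fun hs => h5 (supported_facePerm_symm hs).1)
  have h2 := h.deg_le v
  rw [gift, if_neg (by omega), add_zero]
  exact h1

end Critical

/-! ### Final charges of small vertices -/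

section FinalCharge
set_option linter.unusedSectionVars false
open Equiv Equiv.Perm
variable {W : Type*} [Fintype W] {H : SimpleGraph W} {rot : W → Perm W} {U : Finset W} {D : ℕ}

theorem IsRotation.sum_nbrs_three {M : Type*} [AddCommMonoid M] (h : IsRotation H rot)
    {v a b c : W} (ha : H.Adj v a) (hd : deg H v = 3) (hb : rot v a = b) (hc : rot v b = c)
    (f : W → M) : ∑ u ∈ nbrs H v, f u = f a + f b + f c := by
  subst hb hc
  rw [h.sum_nbrs ha, hd]
  simp [Finset.sum_range_succ, pow_succ']

theorem IsRotation.sum_nbrs_four {M : Type*} [AddCommMonoid M] (h : IsRotation H rot)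
    {v a b c d : W} (ha : H.Adj v a) (hd : deg H v = 4) (hb : rot v a = b) (hc : rot v b = c)
    (hd' : rot v c = d) (f : W → M) : ∑ u ∈ nbrs H v, f u = f a + f b + f c + f d := by
  subst hb hc hd'
  rw [h.sum_nbrs ha, hd]
  simp [Finset.sum_range_succ, pow_succ']

theorem IsRotation.sum_nbrs_five {M : Type*} [AddCommMonoid M] (h : IsRotation H rot)
    {v a b c d e : W} (ha : H.Adj v a) (hd : deg H v = 5) (hb : rot v a = b) (hc : rot v b = c)
    (hd' : rot v c = d) (he : rot v d = e) (f : W → M) :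
    ∑ u ∈ nbrs H v, f u = f a + f b + f c + f d + f e := by
  subst hb hc hd' he
  rw [h.sum_nbrs ha, hd]
  simp [Finset.sum_range_succ, pow_succ']

theorem IsRotation.exists_cycle_three (h : IsRotation H rot) {v a : W} (ha : H.Adj v a)
    (hd : deg H v = 3) : ∃ b c, rot v a = b ∧ rot v b = c ∧ rot v c = a ∧ H.Adj v b ∧ H.Adj v c := by
  refine ⟨_, _, rfl, rfl, ?_, h.adj ha, h.adj (h.adj ha)⟩
  have := h.pow_deg ha
  rw [hd] at this
  simpa [pow_succ'] using this

theorem IsRotation.exists_cycle_four (h : IsRotation H rot) {v a : W} (ha : H.Adj v a)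
    (hd : deg H v = 4) : ∃ b c d, rot v a = b ∧ rot v b = c ∧ rot v c = d ∧ rot v d = a ∧
      H.Adj v b ∧ H.Adj v c ∧ H.Adj v d := by
  refine ⟨_, _, _, rfl, rfl, rfl, ?_, h.adj ha, h.adj (h.adj ha), h.adj (h.adj (h.adj ha))⟩
  have := h.pow_deg ha
  rw [hd] at this
  simpa [pow_succ'] using this

theorem IsRotation.exists_cycle_five (h : IsRotation H rot) {v a : W} (ha : H.Adj v a)
    (hd : deg H v = 5) : ∃ b c d e, rot v a = b ∧ rot v b = c ∧ rot v c = d ∧ rot v d = e ∧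
      rot v e = a ∧ H.Adj v b ∧ H.Adj v c ∧ H.Adj v d ∧ H.Adj v e := by
  refine ⟨_, _, _, _, rfl, rfl, rfl, rfl, ?_, h.adj ha, h.adj (h.adj ha),
    h.adj (h.adj (h.adj ha)), h.adj (h.adj (h.adj (h.adj ha)))⟩
  have := h.pow_deg ha
  rw [hd] at this
  simpa [pow_succ'] using this

/-- The charge of the corner `x` after all transfers. -/
noncomputable def finalCharge (H : SimpleGraph W) (rot : W → Perm W) (U : Finset W) (D : ℕ)
    (x : W × W) : ℤ :=
  cornerReceipt H rot D x + (faceTransfer H rot U D x + gift U D x)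

theorem le_faceTransfer (D : ℕ) (x : W × W) : -(4 * D : ℤ) ≤ faceTransfer H rot U D x := by
  unfold faceTransfer
  split_ifs <;> simp <;> omega

theorem gift_eq_zero {a v : W} (ha : a ∈ U) (hv : v ∈ U) : gift U D (a, v) = 0 := by
  simp [gift, ha, hv]

theorem Critical.receipt_of_four_le (h : Critical H rot U D) {v a : W} (ha : H.Adj v a)
    (h4 : 4 ≤ faceLen rot (a, v)) : 10 * D ≤ cornerReceipt H rot D (a, v) := by
  have := (h.cornerBounds ha).cases_none
  omega

theorem Critical.receipt_of_five_le (h : Critical H rot U D) {v a : W} (ha : H.Adj v a)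
    (h5 : 5 ≤ faceLen rot (a, v)) : 16 * D ≤ cornerReceipt H rot D (a, v) := by
  have := (h.cornerBounds ha).cases_none
  omega

/-- At each corner, either the face transfer is nonnegative, or the face is long. -/
theorem faceTransfer_nonneg_or (D : ℕ) {v : W} (a : W) :
    0 ≤ faceTransfer H rot U D (a, v) ∨ 5 ≤ faceLen rot (a, v) := by
  by_cases h1 : IsSupported H rot U (facePerm rot (a, v))
  · exact Or.inr (supported_facePerm h1).2.2.2.1
  by_cases h2 : IsSupported H rot U ((facePerm rot).symm (a, v))
  · exact Or.inr (supported_facePerm_symm h2).2.2.2.1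
  exact Or.inl (faceTransfer_nonneg h1 h2)

theorem Critical.finalCharge_of_mem (h : Critical H rot U D) {v a : W} (hv : v ∈ U) (ha : a ∈ U)
    (hva : H.Adj v a) : 0 ≤ finalCharge H rot U D (a, v) ∧
      (4 ≤ faceLen rot (a, v) → 10 * (D : ℤ) ≤ finalCharge H rot U D (a, v)) ∧
      (5 ≤ faceLen rot (a, v) → 12 * (D : ℤ) ≤ finalCharge H rot U D (a, v)) := by
  have h1 := h.receipt_of_four_le hva
  have h2 := h.receipt_of_five_le hva
  have h3 := faceTransfer_nonneg_or (H := H) (rot := rot) (U := U) D (v := v) a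
  have h4 := le_faceTransfer (H := H) (rot := rot) (U := U) D (a, v)
  unfold finalCharge
  rw [gift_eq_zero ha hv]
  refine ⟨?_, fun h5 => ?_, fun h5 => ?_⟩
  · rcases h3 with h3 | h3
    · omega
    · specialize h2 h3
      omega
  · specialize h1 h5
    rcases h3 with h3 | h3
    · omega
    · specialize h2 h3
      omega
  · specialize h2 h5
    omega

theorem Critical.charge_of_long (h : Critical H rot U D) {v a b : W} (hv : v ∈ U)
    (hU : ∀ y, H.Adj v y → y ∈ U) (ha : H.Adj v a) (hb : H.Adj v b) (hab : a ≠ b)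
    (h5 : 5 ≤ faceLen rot (a, v)) (h4 : 4 ≤ faceLen rot (b, v)) :
    20 * (D : ℤ) ≤ ∑ u ∈ nbrs H v, finalCharge H rot U D (u, v) := by
  classical
  have h1 : ∑ u ∈ ({a, b} : Finset W), finalCharge H rot U D (u, v) ≤
      ∑ u ∈ nbrs H v, finalCharge H rot U D (u, v) := by
    refine Finset.sum_le_sum_of_subset_of_nonneg ?_ fun u hu _ =>
      (h.finalCharge_of_mem hv (hU u (mem_nbrs.1 hu)) (mem_nbrs.1 hu)).1
    intro u hu
    rcases Finset.mem_insert.1 hu with rfl | hu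
    · exact mem_nbrs.2 ha
    · rw [Finset.mem_singleton.1 hu]
      exact mem_nbrs.2 hb
  rw [Finset.sum_pair hab] at h1
  have h2 := (h.finalCharge_of_mem hv (hU a ha) ha).2.2 h5
  have h3 := (h.finalCharge_of_mem hv (hU b hb) hb).2.1 h4
  omega

/-- A vertex that supports a neighbour keeps enough charge, and other vertices do not lose any
charge along faces. -/
theorem Critical.not_isSupported_or_charge (h : Critical H rot U D) (v : W) :
    (∀ a, H.Adj v a → ¬ IsSupported H rot U (facePerm rot (a, v)) ∧
        ¬ IsSupported H rot U ((facePerm rot).symm (a, v))) ∨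
      v ∈ U ∧ deg H v = 5 ∧
        20 * (D : ℤ) ≤ ∑ u ∈ nbrs H v, finalCharge H rot U D (u, v) := by
  have hr := h.planar.toIsRotation
  by_contra! hc
  obtain ⟨⟨a, ha, hlt⟩, hc⟩ := hc
  by_cases h1 : IsSupported H rot U (facePerm rot (a, v))
  · obtain ⟨h5, hv, hU, hl, hl'⟩ := supported_facePerm h1
    exact (hc hv h5).not_ge (h.charge_of_long hv hU ha (hr.adj (hr.adj ha))
      (hr.rot_rot_ne ha (by omega)).symm hl hl')
  · obtain ⟨h5, hv, hU, hl, hl'⟩ := supported_facePerm_symm (hlt h1)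
    refine (hc hv h5).not_ge (h.charge_of_long hv hU ha (hr.adj_symm (hr.adj_symm ha)) ?_ hl hl')
    intro he
    refine hr.rot_rot_ne ha (by omega) ?_
    nth_rewrite 1 [he]
    simp

theorem Critical.exists_triangle_or (h : Critical H rot U D) {v : W} (hv : 0 < deg H v) :
    ∃ a, H.Adj v a ∧ (faceLen rot (a, v) = 3 ∨ ∀ u, H.Adj v u → 4 ≤ faceLen rot (u, v)) := by
  by_cases ht : ∃ a, H.Adj v a ∧ faceLen rot (a, v) = 3
  · obtain ⟨a, ha, h3⟩ := ht
    exact ⟨a, ha, Or.inl h3⟩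
  · push Not at ht
    obtain ⟨a, ha⟩ := deg_pos_iff.1 hv
    refine ⟨a, ha, Or.inr fun u hu => ?_⟩
    have h3 := h.three_le_faceLen (u, v) (by simpa using hu.symm)
    have h4 := ht u hu
    omega

end FinalCharge

/-! ### Final charges of coloured vertices -/

section Coloured
set_option linter.unusedSectionVars false
open Equiv Equiv.Perm
variable {W : Type*} [Fintype W] {H : SimpleGraph W} {rot : W → Perm W} {U : Finset W} {D : ℕ}

open Classical in
theorem le_charge_of_mem {v : W} (hv : v ∈ U)
    (hl : ∀ a, H.Adj v a → ¬ IsSupported H rot U (facePerm rot (a, v)) ∧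
      ¬ IsSupported H rot U ((facePerm rot).symm (a, v))) :
    ((∑ u ∈ nbrs H v, cornerReceipt H rot D (u, v) : ℕ) : ℤ) -
      (if D ≤ 5 then 6 * D * ((nbrsTwo H v \ U).card : ℤ) else 0) ≤
    ∑ u ∈ nbrs H v, finalCharge H rot U D (u, v) := by
  unfold finalCharge
  rw [Finset.sum_add_distrib, Finset.sum_add_distrib]
  have h1 : 0 ≤ ∑ u ∈ nbrs H v, faceTransfer H rot U D (u, v) := Finset.sum_nonneg fun u hu =>
    faceTransfer_nonneg (hl u (mem_nbrs.1 hu)).1 (hl u (mem_nbrs.1 hu)).2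
  have h2 : -(if D ≤ 5 then 6 * D * ((nbrsTwo H v \ U).card : ℤ) else 0) ≤
      ∑ u ∈ nbrs H v, gift U D (u, v) := by
    unfold gift
    split_ifs with hD
    · have h3 : (nbrs H v).filter (· ∉ U) ⊆ nbrsTwo H v \ U := by
        intro u hu
        obtain ⟨h4, h5⟩ := Finset.mem_filter.1 hu
        exact Finset.mem_sdiff.2 ⟨(mem_nbrsTwo).2 ⟨(mem_nbrs.1 h4).ne', Or.inl (mem_nbrs.1 h4)⟩, h5⟩
      have h6 := Finset.card_le_card h3
      rw [← Finset.mul_sum, ← mul_neg]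
      refine mul_le_mul_of_nonneg_left ?_ (by positivity)
      simp only [hv, not_true_eq_false, and_false, if_false, and_true, zero_sub,
        Finset.sum_neg_distrib, Finset.sum_boole]
      omega
    · simp
  push_cast
  omega

open Classical in
/-- With no uncoloured vertex near `v`, a supported corner gives extra charge. -/
theorem Critical.le_charge_of_isSupported (h : Critical H rot U D) {v a : W} (hv : v ∈ U)
    (hl : ∀ a, H.Adj v a → ¬ IsSupported H rot U (facePerm rot (a, v)) ∧
      ¬ IsSupported H rot U ((facePerm rot).symm (a, v))) (hU : ∀ u, H.Adj v u → u ∈ U)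
    (ha : H.Adj v a) (hs : IsSupported H rot U (a, v))
    (hc : 16 * D ≤ cornerReceipt H rot D (a, v)) :
    20 * (D : ℤ) ≤ ∑ u ∈ nbrs H v, finalCharge H rot U D (u, v) := by
  have h1 : finalCharge H rot U D (a, v) ≤ ∑ u ∈ nbrs H v, finalCharge H rot U D (u, v) :=
    Finset.single_le_sum (f := fun u => finalCharge H rot U D (u, v)) (fun u hu =>
      (h.finalCharge_of_mem hv (hU u (mem_nbrs.1 hu)) (mem_nbrs.1 hu)).1) (mem_nbrs.2 ha)
  refine le_trans ?_ h1
  rw [finalCharge, gift_eq_zero (hU a ha) hv, faceTransfer, if_pos hs, if_neg (hl a ha).1,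
    if_neg (hl a ha).2]
  omega

theorem Critical.charge_three_of_mem (h : Critical H rot U D) {v : W} (hv : v ∈ U)
    (hd : deg H v = 3)
    (hl : ∀ a, H.Adj v a → ¬ IsSupported H rot U (facePerm rot (a, v)) ∧
      ¬ IsSupported H rot U ((facePerm rot).symm (a, v))) :
    60 * (D : ℤ) ≤ ∑ u ∈ nbrs H v, finalCharge H rot U D (u, v) := by
  classical
  have hr := h.planar.toIsRotation
  have h1 := le_charge_of_mem (D := D) hv hl
  obtain ⟨a, ha⟩ := deg_pos_iff.1 (by omega : 0 < deg H v)
  obtain ⟨b, c, hab, hbc, hca, hb, hc⟩ := hr.exists_cycle_three ha hd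
  have ca := h.cornerBounds ha
  have cb := h.cornerBounds hb
  have cc := h.cornerBounds hc
  have ea := h.heavy_flags hv ha
  have eb := h.heavy_flags hv hb
  have ec := h.heavy_flags hv hc
  rw [hab] at ca ea
  rw [hbc] at cb eb
  rw [hca] at cc ec
  simp only [hr.sum_nbrs_three ha hd hab hbc] at h1 ea eb ec ⊢
  have da := h.deg_le a
  have db := h.deg_le b
  have dc := h.deg_le c
  have key := charge_three da db dc ca cb cc (by omega) (by omega) (by omega)
  rw [if_neg (by omega)] at h1
  push_cast at h1 ⊢
  omega

theorem Critical.charge_four_of_mem (h : Critical H rot U D) {v : W} (hv : v ∈ U)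
    (hd : deg H v = 4)
    (hl : ∀ a, H.Adj v a → ¬ IsSupported H rot U (facePerm rot (a, v)) ∧
      ¬ IsSupported H rot U ((facePerm rot).symm (a, v))) :
    40 * (D : ℤ) ≤ ∑ u ∈ nbrs H v, finalCharge H rot U D (u, v) := by
  classical
  have hr := h.planar.toIsRotation
  have h1 := le_charge_of_mem (D := D) hv hl
  have hDv := h.deg_le v
  obtain ⟨a, ha, hta⟩ := h.exists_triangle_or (v := v) (by omega)
  obtain ⟨b, c, d, hab, hbc, hcd, hda, hb, hc, hd'⟩ := hr.exists_cycle_four ha hd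
  have ca := h.cornerBounds ha
  have cb := h.cornerBounds hb
  have cc := h.cornerBounds hc
  have cd := h.cornerBounds hd'
  have ea := h.heavy_flags hv ha
  have eb := h.heavy_flags hv hb
  have ec := h.heavy_flags hv hc
  have ed := h.heavy_flags hv hd'
  rw [hab] at ca ea
  rw [hbc] at cb eb
  rw [hcd] at cc ec
  rw [hda] at cd ed
  simp only [hr.sum_nbrs_four ha hd hab hbc hcd] at h1 ea eb ec ed ⊢
  have da := h.deg_le a
  have db := h.deg_le b
  have dc := h.deg_le c
  have dd := h.deg_le d
  by_cases hD : D ≤ 5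
  · have key := charge_four_small (e := (nbrsTwo H v \ U).card) (by omega) hD da db dc dd ca cb cc cd
      (by omega) (by omega) (by omega) (by omega)
    rw [if_pos hD] at h1
    zify at key
    push_cast at h1 ⊢
    linarith
  · rw [if_neg hD] at h1
    have key : 40 * D ≤ cornerReceipt H rot D (a, v) + cornerReceipt H rot D (b, v) +
        cornerReceipt H rot D (c, v) + cornerReceipt H rot D (d, v) := by
      rcases hta with hta | hta
      · exact charge_four (by omega) da db dc dd hta ca cb cc cd
          (by omega) (by omega) (by omega) (by omega)
      · have ra := h.receipt_of_four_le ha (hta a ha)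
        have rb := h.receipt_of_four_le hb (hta b hb)
        have rc := h.receipt_of_four_le hc (hta c hc)
        have rd := h.receipt_of_four_le hd' (hta d hd')
        omega
    push_cast at h1 ⊢
    omega

end Coloured

section ColouredFive
set_option linter.unusedSectionVars false
open Equiv Equiv.Perm
variable {W : Type*} [Fintype W] {H : SimpleGraph W} {rot : W → Perm W} {U : Finset W} {D : ℕ}

theorem Critical.isSupported_of_triangles (h : Critical H rot U D) {v a b d e : W} (hv : v ∈ U)
    (hN : nbrsTwo H v ⊆ U) (ha : H.Adj v a) (hd : H.Adj v d) (hab : rot v a = b)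
    (hde : rot v d = e) (hea : rot v e = a) (ta : faceLen rot (a, v) = 3)
    (td : faceLen rot (d, v) = 3) (hb4 : 4 ≤ deg H b) (hfa : ¬ IsFlagged H rot (a, v))
    (hfd : ¬ IsFlagged H rot (d, v)) (ha5 : deg H a = 5) (he5 : deg H e = 5)
    (hl : 5 ≤ faceLen rot (e, v)) : IsSupported H rot U (e, v) := by
  have hr := h.planar.toIsRotation
  have hb : H.Adj v b := hab ▸ hr.adj ha
  have he : H.Adj v e := hde ▸ hr.adj hd
  have hmem : ∀ u, H.Adj v u → u ∈ U ∧ ∀ y, H.Adj u y → y ∈ U := by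
    refine fun u hu => ⟨hN (mem_nbrsTwo.2 ⟨hu.ne', Or.inl hu⟩), fun y hy => ?_⟩
    by_cases hyv : y = v
    · rw [hyv]
      exact hv
    · exact hN (mem_nbrsTwo.2 ⟨hyv, Or.inr ⟨u, hu, hy⟩⟩)
  have fa : faceLen rot (a, b) ≠ 3 := fun hf => hfa (Or.inr ⟨ta, by simpa [hab] using hb4,
    by simpa [hab] using hf⟩)
  have fd : faceLen rot (d, e) ≠ 3 := fun hf => hfd (Or.inr ⟨td, by simp [hde, he5],
    by simpa [hde] using hf⟩)
  have hadj1 := hr.adj_of_triangle ha ta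
  have hadj2 := hr.adj_of_triangle hd td
  have ra := (triangle_rot ta).2
  have rd := (triangle_rot td).1
  rw [hab] at ra hadj1
  rw [hde] at rd hadj2
  have l1 := h.three_le_faceLen (a, b) (by simpa using hadj1)
  have l2 := h.three_le_faceLen (d, e) (by simpa using hadj2)
  refine ⟨hl, ⟨he5, (hmem e he).1, (hmem e he).2, ?_⟩, ?_⟩
  · simp only [rd]
    omega
  · simp only [hea]
    refine ⟨ha5, (hmem a ha).1, (hmem a ha).2, ?_⟩
    have hs : (rot a).symm v = b := by rw [Equiv.symm_apply_eq, ra]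
    rw [hs, ← faceLen_facePerm, facePerm_apply]
    simp only [apply_symm_apply]
    omega

theorem Critical.charge_five_of_mem (h : Critical H rot U D) {v : W} (hv : v ∈ U)
    (hd : deg H v = 5)
    (hl : ∀ a, H.Adj v a → ¬ IsSupported H rot U (facePerm rot (a, v)) ∧
      ¬ IsSupported H rot U ((facePerm rot).symm (a, v))) :
    20 * (D : ℤ) ≤ ∑ u ∈ nbrs H v, finalCharge H rot U D (u, v) := by
  classical
  have hr := h.planar.toIsRotation
  have h1 := le_charge_of_mem (D := D) hv hl
  have hDv := h.deg_le v
  obtain ⟨a, ha, hta⟩ : ∃ a, H.Adj v a ∧ ((faceLen rot (a, v) = 3 ∧ faceLen rot (rot v a, v) = 3 ∧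
      faceLen rot (rot v (rot v a), v) = 3 ∧ faceLen rot (rot v (rot v (rot v a)), v) = 3) ∨
      ∀ u, H.Adj v u → ¬ (faceLen rot (u, v) = 3 ∧ faceLen rot (rot v u, v) = 3 ∧
        faceLen rot (rot v (rot v u), v) = 3 ∧ faceLen rot (rot v (rot v (rot v u)), v) = 3)) := by
    by_cases ht : ∃ a, H.Adj v a ∧ faceLen rot (a, v) = 3 ∧ faceLen rot (rot v a, v) = 3 ∧
      faceLen rot (rot v (rot v a), v) = 3 ∧ faceLen rot (rot v (rot v (rot v a)), v) = 3
    · obtain ⟨a, ha, h3⟩ := ht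
      exact ⟨a, ha, Or.inl h3⟩
    · obtain ⟨a, ha⟩ := deg_pos_iff.1 (by omega : 0 < deg H v)
      exact ⟨a, ha, Or.inr fun u hu hu' => ht ⟨u, hu, hu'⟩⟩
  obtain ⟨b, c, d, e, hab, hbc, hcd, hde, hea, hb, hc, hd', he⟩ := hr.exists_cycle_five ha hd
  have ca := h.cornerBounds ha
  have cb := h.cornerBounds hb
  have cc := h.cornerBounds hc
  have cd := h.cornerBounds hd'
  have ce := h.cornerBounds he
  have ea := h.heavy_flags hv ha
  have eb := h.heavy_flags hv hb
  have ec := h.heavy_flags hv hc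
  have ed := h.heavy_flags hv hd'
  have ee := h.heavy_flags hv he
  rw [hab] at ca ea
  rw [hbc] at cb eb
  rw [hcd] at cc ec
  rw [hde] at cd ed
  rw [hea] at ce ee
  have da := h.deg_le a
  have db := h.deg_le b
  have dc := h.deg_le c
  have dd := h.deg_le d
  have de := h.deg_le e
  simp only [hr.sum_nbrs_five ha hd hab hbc hcd hde _] at ea eb ec ed ee
  rcases hta with ⟨ta, tb, tc, td⟩ | hta
  · rw [hab] at tb tc td
    rw [hbc] at tc td
    rw [hcd] at td
    rcases charge_five (e := (nbrsTwo H v \ U).card) (by omega) da db dc dd de ca cb cc cd ce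
      ta tb tc td (by omega) (by omega) (by omega) (by omega) (by omega) with
      ⟨key, h0⟩ | ⟨k1, k2, k3, k4, k5, k6, k7, k8⟩
    · simp only [hr.sum_nbrs_five ha hd hab hbc hcd hde] at h1 ⊢
      have h2 : (if D ≤ 5 then 6 * D * ((nbrsTwo H v \ U).card : ℤ) else 0) = 0 := by
        split_ifs with h5
        · rw [h0 (by omega)]
          simp
        · rfl
      rw [h2] at h1
      push_cast at h1 ⊢
      omega
    · have hN : nbrsTwo H v ⊆ U := by
        rwa [Finset.card_eq_zero, Finset.sdiff_eq_empty_iff_subset] at k7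
      have hs := h.isSupported_of_triangles hv hN ha hd' hab hde hea ta td k4
        (fun hf => by simp [hf] at k5) (fun hf => by simp [hf] at k6) k2 k3 k1
      exact h.le_charge_of_isSupported hv hl
        (fun u hu => hN (mem_nbrsTwo.2 ⟨hu.ne', Or.inl hu⟩)) he hs k8
  · have na := hta a ha
    have nb := hta b hb
    have nc := hta c hc
    have nd := hta d hd'
    have ne := hta e he
    simp only [hab, hbc, hcd, hde, hea] at na nb nc nd ne
    simp only [hr.sum_nbrs_five ha hd hab hbc hcd hde] at h1 ⊢
    have ht : (if faceLen rot (a, v) = 3 then 1 else 0) + (if faceLen rot (b, v) = 3 then 1 else 0) +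
        (if faceLen rot (c, v) = 3 then 1 else 0) + (if faceLen rot (d, v) = 3 then 1 else 0) +
        (if faceLen rot (e, v) = 3 then 1 else 0) ≤ 3 := by
      clear ea eb ec ed ee h1
      split_ifs <;> omega
    by_cases hD : D ≤ 5
    · obtain rfl : D = 5 := by omega
      have key := charge_five_small (e := (nbrsTwo H v \ U).card) da db dc dd de ca cb cc cd ce
        (by omega) (by omega) (by omega) (by omega) ht
      rw [if_pos hD] at h1
      push_cast at h1 ⊢
      omega
    · rw [if_neg hD] at h1
      have ra := ca.cases_none
      have rb := cb.cases_none
      have rc := cc.cases_none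
      have rd := cd.cases_none
      have re := ce.cases_none
      push_cast at h1 ⊢
      omega

end ColouredFive

/-! ### Final charges of uncoloured vertices -/

section Uncoloured
set_option linter.unusedSectionVars false
open Equiv Equiv.Perm
variable {W : Type*} [Fintype W] {H : SimpleGraph W} {rot : W → Perm W} {U : Finset W} {D : ℕ}

theorem Critical.le_charge_of_notMem (h : Critical H rot U D) {v : W} (hv : v ∉ U) :
    ((∑ u ∈ nbrs H v, cornerReceipt H rot D (u, v) : ℕ) : ℤ) +
      (if D ≤ 5 then 6 * D * (deg H v : ℤ) else 0) ≤
    ∑ u ∈ nbrs H v, finalCharge H rot U D (u, v) := by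
  have hU : ∀ u ∈ nbrs H v, u ∈ U := fun u hu =>
    (h.mem_or_mem v u (mem_nbrs.1 hu)).resolve_left hv
  have hl := (h.not_isSupported_or_charge v).resolve_right fun h1 => hv h1.1
  unfold finalCharge
  rw [Finset.sum_add_distrib, Finset.sum_add_distrib]
  have h1 : 0 ≤ ∑ u ∈ nbrs H v, faceTransfer H rot U D (u, v) := Finset.sum_nonneg fun u hu =>
    faceTransfer_nonneg (hl u (mem_nbrs.1 hu)).1 (hl u (mem_nbrs.1 hu)).2
  have h2 : ∑ u ∈ nbrs H v, gift U D (u, v) = if D ≤ 5 then 6 * D * (deg H v : ℤ) else 0 := by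
    split_ifs with hD
    · have h3 : ∀ u ∈ nbrs H v, gift U D (u, v) = 6 * D := fun u hu => by
        simp [gift, hD, hU u hu, hv]
      rw [Finset.sum_congr rfl h3, Finset.sum_const, nsmul_eq_mul, mul_comm]
      rfl
    · exact Finset.sum_eq_zero fun u _ => by simp [gift, hD]
  rw [h2]
  push_cast
  omega

open Classical in
theorem Critical.deg_of_notMem (h : Critical H rot U D) {v a : W} (hv : v ∉ U) (ha : H.Adj v a) :
    D + 2 + (nbrs H v ∩ nbrs H a).card < deg H a + deg H v :=
  not_removable_deg ⟨rot, h.planar⟩ h.deg_le (h.not_removable v hv (deg_pos_iff.2 ⟨a, ha⟩)) ha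

open Classical in
/-- A triangle at the corner of `a` gives a common neighbour at both of its ends. -/
theorem Critical.common_of_triangle (h : Critical H rot U D) {v a b : W} (ha : H.Adj v a)
    (hab : rot v a = b) (ht : faceLen rot (a, v) = 3) :
    b ∈ nbrs H v ∩ nbrs H a ∧ a ∈ nbrs H v ∩ nbrs H b := by
  have h1 := h.planar.toIsRotation.adj_of_triangle ha ht
  have h2 := h.planar.toIsRotation.adj ha
  rw [hab] at h1 h2
  simp only [Finset.mem_inter, mem_nbrs]
  exact ⟨⟨h2, h1⟩, ha, h1.symm⟩

theorem Critical.charge_three_of_notMem (h : Critical H rot U D) {v : W} (hv : v ∉ U)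
    (hd : deg H v = 3) :
    60 * (D : ℤ) ≤ ∑ u ∈ nbrs H v, finalCharge H rot U D (u, v) := by
  classical
  have hr := h.planar.toIsRotation
  have h1 := h.le_charge_of_notMem hv
  obtain ⟨a, ha⟩ := deg_pos_iff.1 (by omega : 0 < deg H v)
  obtain ⟨b, c, hab, hbc, hca, hb, hc⟩ := hr.exists_cycle_three ha hd
  have hdeg : ∀ u, H.Adj v u → deg H u = D ∧ faceLen rot (u, v) ≠ 3 := by
    intro u hu
    have h2 := h.deg_of_notMem hv hu
    have h3 := h.deg_le u
    refine ⟨by omega, fun ht => ?_⟩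
    have := Finset.card_pos.2 ⟨_, (h.common_of_triangle hu rfl ht).1⟩
    omega
  have ca := h.cornerBounds ha
  have cb := h.cornerBounds hb
  have cc := h.cornerBounds hc
  rw [hab] at ca
  rw [hbc] at cb
  rw [hca] at cc
  obtain ⟨da, ta⟩ := hdeg a ha
  obtain ⟨db, tb⟩ := hdeg b hb
  obtain ⟨dc, tc⟩ := hdeg c hc
  have hw := h.not_removable v hv (by omega)
  simp only [hr.sum_nbrs_three ha hd hab hbc] at h1 ⊢
  by_cases hD : D ≤ 5
  · rw [if_pos hD] at h1
    have n1 := not_removable_three h.planar h.deg_le h.three_le_deg hw ha hd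
    have n2 := not_removable_three h.planar h.deg_le h.three_le_deg hw hb hd
    have n3 := not_removable_three h.planar h.deg_le h.three_le_deg hw hc hd
    simp only [hab, hbc, hca] at n1 n2 n3
    have ra := ca.cases_none
    have rb := cb.cases_none
    have rc := cc.cases_none
    rw [hd] at h1
    push_cast at h1 ⊢
    omega
  · rw [if_neg hD] at h1
    have ra := ca.cases_big (by omega) (by omega)
    have rb := cb.cases_big (by omega) (by omega)
    have rc := cc.cases_big (by omega) (by omega)
    push_cast at h1 ⊢
    omega

theorem Critical.charge_four_of_notMem (h : Critical H rot U D) {v : W} (hv : v ∉ U)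
    (hd : deg H v = 4) :
    40 * (D : ℤ) ≤ ∑ u ∈ nbrs H v, finalCharge H rot U D (u, v) := by
  classical
  have hr := h.planar.toIsRotation
  have h1 := h.le_charge_of_notMem hv
  obtain ⟨a, ha, hta⟩ := h.exists_triangle_or (v := v) (by omega)
  obtain ⟨b, c, d, hab, hbc, hcd, hda, hb, hc, hd'⟩ := hr.exists_cycle_four ha hd
  have hcons : ∀ u, H.Adj v u → faceLen rot (u, v) = 3 → faceLen rot (rot v u, v) ≠ 3 := by
    intro u hu ht ht'
    have h2 := h.deg_of_notMem hv (hr.adj hu)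
    have h3 := h.deg_le (rot v u)
    have h4 := (h.common_of_triangle hu rfl ht).2
    have h5 := (h.common_of_triangle (hr.adj hu) rfl ht').1
    have h6 := Finset.one_lt_card.2 ⟨_, h4, _, h5, (hr.rot_rot_ne hu (by omega)).symm⟩
    omega
  have hdeg : ∀ u w, H.Adj v u → rot v u = w → faceLen rot (u, v) = 3 →
      deg H u = D ∧ deg H w = D := by
    intro u w hu hw ht
    have hvw : H.Adj v w := hw ▸ hr.adj hu
    have h2 := h.common_of_triangle hu hw ht
    have h3 := Finset.card_pos.2 ⟨_, h2.1⟩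
    have h4 := Finset.card_pos.2 ⟨_, h2.2⟩
    have h5 := h.deg_of_notMem hv hu
    have h6 := h.deg_of_notMem hv hvw
    have h7 := h.deg_le u
    have h8 := h.deg_le w
    omega
  have ca := h.cornerBounds ha
  have cb := h.cornerBounds hb
  have cc := h.cornerBounds hc
  have cd := h.cornerBounds hd'
  have na := hcons a ha
  have nb := hcons b hb
  have nc := hcons c hc
  have nd := hcons d hd'
  rw [hab] at ca na
  rw [hbc] at cb nb
  rw [hcd] at cc nc
  rw [hda] at cd nd
  have ea := hdeg a b ha hab
  have eb := hdeg b c hb hbc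
  have ec := hdeg c d hc hcd
  have ed := hdeg d a hd' hda
  simp only [hr.sum_nbrs_four ha hd hab hbc hcd] at h1 ⊢
  have ra := ca.cases_none
  have rb := cb.cases_none
  have rc := cc.cases_none
  have rd := cd.cases_none
  by_cases hD : D ≤ 5
  · rw [if_pos hD, hd] at h1
    push_cast at h1 ⊢
    omega
  · rw [if_neg hD] at h1
    rcases hta with hta | hta
    · have ha6 : 6 ≤ deg H a := by omega
      have hb6 : 6 ≤ deg H b := by omega
      have rb' := cb.cases_left hb6
      have rd' := cd.cases_right ha6
      by_cases tc : faceLen rot (c, v) = 3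
      · have rb'' := cb.cases_big hb6 (by omega)
        have rd'' := cd.cases_big (by omega) ha6
        push_cast at h1 ⊢
        omega
      · push_cast at h1 ⊢
        omega
    · have la := hta a ha
      have lb := hta b hb
      have lc := hta c hc
      have ld := hta d hd'
      push_cast at h1 ⊢
      omega

theorem Critical.charge_five_of_notMem (h : Critical H rot U D) {v : W} (hv : v ∉ U)
    (hd : deg H v = 5) :
    20 * (D : ℤ) ≤ ∑ u ∈ nbrs H v, finalCharge H rot U D (u, v) := by
  classical
  have hr := h.planar.toIsRotation
  have h1 := h.le_charge_of_notMem hv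
  obtain ⟨a, ha⟩ := deg_pos_iff.1 (by omega : 0 < deg H v)
  obtain ⟨b, c, d, e, hab, hbc, hcd, hde, hea, hb, hc, hd', he⟩ := hr.exists_cycle_five ha hd
  have hw := h.not_removable v hv (by omega)
  have na := not_removable_five h.planar h.deg_le hw ha hd hab hbc hcd hde
  have nb := not_removable_five h.planar h.deg_le hw hb hd hbc hcd hde hea
  have nc := not_removable_five h.planar h.deg_le hw hc hd hcd hde hea hab
  have nd := not_removable_five h.planar h.deg_le hw hd' hd hde hea hab hbc
  have ne := not_removable_five h.planar h.deg_le hw he hd hea hab hbc hcd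
  have ra := (h.cornerBounds ha).cases_none
  have rb := (h.cornerBounds hb).cases_none
  have rc := (h.cornerBounds hc).cases_none
  have rd := (h.cornerBounds hd').cases_none
  have re := (h.cornerBounds he).cases_none
  have h2 : (0 : ℤ) ≤ if D ≤ 5 then 6 * D * (deg H v : ℤ) else 0 := by split_ifs <;> positivity
  simp only [hr.sum_nbrs_five ha hd hab hbc hcd hde] at h1 ⊢
  push_cast at h1 ⊢
  omega

end Uncoloured

/-! ### Colouring by induction -/

section Induction
set_option linter.unusedSectionVars false
open Equiv Equiv.Perm
variable {W : Type*} [Fintype W] {H : SimpleGraph W} {rot : W → Perm W} {U : Finset W} {D : ℕ}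

theorem Critical.not_adj (h : Critical H rot U D) (u v : W) : ¬ H.Adj u v := by
  intro huv
  obtain ⟨w, h0, h6, hlt⟩ := h.planar.exists_small h.deg_le huv h.three_le_faceLen
    (fun x => faceTransfer H rot U D x + gift U D x)
    (by rw [Finset.sum_add_distrib, sum_faceTransfer h.planar.toIsRotation, sum_gift, add_zero])
    fun x _ hx => h.transfer_nonneg x hx
  refine hlt.not_ge ?_
  change _ ≤ ∑ a ∈ nbrs H w, finalCharge H rot U D (a, w)
  have h3 := h.three_le_deg w h0
  have hcases : deg H w = 3 ∨ deg H w = 4 ∨ deg H w = 5 := by omega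
  by_cases hw : w ∈ U
  · rcases h.not_isSupported_or_charge w with hl | ⟨-, h5, hc⟩
    · rcases hcases with hd | hd | hd <;> rw [hd]
      · have := h.charge_three_of_mem hw hd hl
        push_cast
        linarith
      · have := h.charge_four_of_mem hw hd hl
        push_cast
        linarith
      · have := h.charge_five_of_mem hw hd hl
        push_cast
        linarith
    · rw [h5]
      push_cast
      linarith
  · rcases hcases with hd | hd | hd <;> rw [hd]
    · have := h.charge_three_of_notMem hw hd
      push_cast
      linarith
    · have := h.charge_four_of_notMem hw hd
      push_cast
      linarith
    · have := h.charge_five_of_notMem hw hd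
      push_cast
      linarith

/-- Vertices of `U` that are adjacent or have a common neighbour in `H` get distinct colours. -/
def IsTwoColouring (H : SimpleGraph W) (U : Finset W) {α : Type*} (c : W → α) : Prop :=
  ∀ x ∈ U, ∀ y ∈ U, x ≠ y → (H.Adj x y ∨ ∃ z, H.Adj x z ∧ H.Adj z y) → c x ≠ c y

open Classical in
theorem IsTwoColouring.extend {k : ℕ} {v : W} {c : W → Fin k} (h : IsTwoColouring H (U.erase v) c)
    (hv : (nbrsTwo H v ∩ U).card < k) : ∃ c : W → Fin k, IsTwoColouring H U c := by
  obtain ⟨i, -, hi⟩ := Finset.exists_mem_notMem_of_card_lt_card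
    (s := (nbrsTwo H v ∩ U).image c) (t := Finset.univ)
    (by simpa using Finset.card_image_le.trans_lt hv)
  have hi' : ∀ y ∈ U, y ≠ v → (H.Adj v y ∨ ∃ z, H.Adj v z ∧ H.Adj z y) → c y ≠ i := by
    intro y hy hyv hadj he
    exact hi (Finset.mem_image.2 ⟨y, Finset.mem_inter.2 ⟨mem_nbrsTwo.2 ⟨hyv, hadj⟩, hy⟩, he⟩)
  refine ⟨Function.update c v i, fun x hx y hy hxy hadj => ?_⟩
  by_cases hxv : x = v
  · subst hxv
    rw [Function.update_self, Function.update_of_ne hxy.symm]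
    exact (hi' y hy hxy.symm hadj).symm
  rw [Function.update_of_ne hxv]
  by_cases hyv : y = v
  · subst hyv
    rw [Function.update_self]
    refine hi' x hx hxy (hadj.imp (fun h => h.symm) ?_)
    rintro ⟨z, h1, h2⟩
    exact ⟨z, h2.symm, h1.symm⟩
  · rw [Function.update_of_ne hyv]
    exact h x (Finset.mem_erase.2 ⟨hxv, hx⟩) y (Finset.mem_erase.2 ⟨hyv, hy⟩) hxy hadj

theorem deg_le_deg {T : SimpleGraph W} (hT : T ≤ H) (v : W) : deg T v ≤ deg H v :=
  Finset.card_le_card fun _ hx => mem_nbrs.2 (hT (mem_nbrs.1 hx))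

open Classical in
/-- The vertices that matter: coloured ones count twice, isolated uncoloured ones do not count. -/
noncomputable def measureOf (H : SimpleGraph W) (U : Finset W) : ℕ :=
  2 * U.card + (Finset.univ.filter fun w => w ∉ U ∧ 0 < deg H w).card

open Classical in
theorem measureOf_erase_lt {v : W} (hv : v ∈ U) : measureOf H (U.erase v) < measureOf H U := by
  unfold measureOf
  have h1 := Finset.card_erase_add_one hv
  have h2 : (Finset.univ.filter fun w => w ∉ U.erase v ∧ 0 < deg H w) ⊆
      insert v (Finset.univ.filter fun w => w ∉ U ∧ 0 < deg H w) := by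
    intro w hw
    simp only [Finset.mem_filter, Finset.mem_univ, true_and, Finset.mem_erase, not_and,
      Finset.mem_insert] at hw ⊢
    by_cases hwv : w = v
    · exact Or.inl hwv
    · exact Or.inr ⟨hw.1 hwv, hw.2⟩
  have h3 := (Finset.card_le_card h2).trans (Finset.card_insert_le _ _)
  omega

theorem measureOf_mono {T : SimpleGraph W} (hT : T ≤ H) (U : Finset W) :
    measureOf T U ≤ measureOf H U := by
  classical
  refine Nat.add_le_add_left (Finset.card_le_card ?_) _
  intro w hw
  simp only [Finset.mem_filter, Finset.mem_univ, true_and] at hw ⊢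
  exact ⟨hw.1, hw.2.trans_le (deg_le_deg hT w)⟩

theorem measureOf_lt_of_removable {T : SimpleGraph W} {w : W} (hw : w ∉ U) (hpos : 0 < deg H w)
    (hiso : ∀ x, ¬ T.Adj w x)
    (hadj : ∀ x y, T.Adj x y → H.Adj x y ∨ H.Adj w x ∧ H.Adj w y) :
    measureOf T U < measureOf H U := by
  classical
  refine Nat.add_lt_add_left (Finset.card_lt_card (Finset.ssubset_iff_of_subset ?_ |>.2 ?_)) _
  · intro x hx
    simp only [Finset.mem_filter, Finset.mem_univ, true_and] at hx ⊢
    refine ⟨hx.1, ?_⟩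
    obtain ⟨y, hy⟩ := deg_pos_iff.1 hx.2
    rcases hadj x y hy with h1 | ⟨h1, -⟩
    · exact deg_pos_iff.2 ⟨y, h1⟩
    · exact deg_pos_iff.2 ⟨w, h1.symm⟩
  · refine ⟨w, by simpa using ⟨hw, hpos⟩, ?_⟩
    simp only [Finset.mem_filter, Finset.mem_univ, true_and, not_and]
    intro _ h1
    obtain ⟨y, hy⟩ := deg_pos_iff.1 h1
    exact hiso y hy

/-- The graph without the edges between vertices outside `U`. -/
def trim (H : SimpleGraph W) (U : Finset W) : SimpleGraph W where
  Adj x y := H.Adj x y ∧ (x ∈ U ∨ y ∈ U)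
  symm := ⟨fun _ _ h => ⟨h.1.symm, h.2.symm⟩⟩
  loopless := ⟨fun x h => H.loopless.irrefl x h.1⟩

theorem trim_le (H : SimpleGraph W) (U : Finset W) : trim H U ≤ H := fun _ _ h => h.1

theorem IsTwoColouring.of_trim {α : Type*} {c : W → α} (h : IsTwoColouring (trim H U) U c) :
    IsTwoColouring H U c := by
  intro x hx y hy hxy hadj
  refine h x hx y hy hxy (hadj.imp (fun h1 => ⟨h1, Or.inl hx⟩) ?_)
  rintro ⟨z, h1, h2⟩
  exact ⟨z, ⟨h1, Or.inl hx⟩, h2, Or.inr hy⟩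

theorem exists_isTwoColouring (h : CombPlanar H) (hD : ∀ v, deg H v ≤ D) (U : Finset W) :
    ∃ c : W → Fin (2 * D + 7), IsTwoColouring H U c := by
  classical
  induction hn : measureOf H U using Nat.strong_induction_on generalizing H U with
  | _ n ih =>
    subst hn
    have hle := measureOf_mono (trim_le H U) U
    have hD' : ∀ v, deg (trim H U) v ≤ D := fun v => (deg_le_deg (trim_le H U) v).trans (hD v)
    have h' := h.mono (trim_le H U)
    by_cases hlight : ∃ v ∈ U, (nbrsTwo (trim H U) v ∩ U).card < 2 * D + 7
    · obtain ⟨v, hv, hcard⟩ := hlight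
      obtain ⟨c, hc⟩ := ih _ ((measureOf_erase_lt hv).trans_le hle) h' hD' (U.erase v) rfl
      obtain ⟨c', hc'⟩ := hc.extend hcard
      exact ⟨c', hc'.of_trim⟩
    by_cases hrem : ∃ w, w ∉ U ∧ 0 < deg (trim H U) w ∧ Removable (trim H U) D w
    · obtain ⟨w, hw, hpos, T, hT, hTD, hiso, hTadj, hTof, hTw⟩ := hrem
      obtain ⟨c, hc⟩ := ih _ ((measureOf_lt_of_removable hw hpos hiso hTadj).trans_le hle) hT hTD U
        rfl
      refine ⟨c, IsTwoColouring.of_trim fun x hx y hy hxy hadj => hc x hx y hy hxy ?_⟩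
      have hxw : x ≠ w := fun he => hw (he ▸ hx)
      have hyw : y ≠ w := fun he => hw (he ▸ hy)
      rcases hadj with h1 | ⟨z, h1, h2⟩
      · exact Or.inl (hTof x y hxw hyw h1)
      · by_cases hz : z = w
        · subst hz
          exact hTw x y h1.symm h2 hxy
        · exact Or.inr ⟨z, hTof x z hxw hz h1, hTof z y hz hyw h2⟩
    · push Not at hlight hrem
      obtain ⟨rot, hrot⟩ := h'
      have hcrit : Critical (trim H U) rot U D :=
        { planar := hrot
          deg_le := hD'
          mem_or_mem := fun x y hxy => hxy.2
          heavy := fun v hv => by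
            have h1 := hlight v hv
            have h2 := Finset.card_inter_add_card_sdiff (nbrsTwo (trim H U) v) U
            omega
          not_removable := hrem }
      refine ⟨fun _ => ⟨0, by omega⟩, IsTwoColouring.of_trim fun x _ y _ _ hadj => ?_⟩
      rcases hadj with h1 | ⟨z, h1, -⟩
      · exact (hcrit.not_adj x y h1).elim
      · exact (hcrit.not_adj x z h1).elim

end Induction

theorem deg_map_le {V W : Type*} [Fintype V] [Fintype W] (G : SimpleGraph V) [DecidableRel G.Adj]
    (r : V ↪ W) (x : W) : deg (G.map r) x ≤ G.maxDegree := by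
  by_cases hx : 0 < deg (G.map r) x
  · obtain ⟨y, hy⟩ := deg_pos_iff.1 hx
    obtain ⟨u, v, huv, rfl, rfl⟩ := (SimpleGraph.map_adj r G _ _).1 hy
    refine le_trans ?_ (G.degree_le_maxDegree u)
    rw [← G.card_neighborFinset_eq_degree, ← Finset.card_map r]
    refine Finset.card_le_card fun z hz => ?_
    obtain ⟨u', w, huw, hu, rfl⟩ := (SimpleGraph.map_adj r G _ _).1 (mem_nbrs.1 hz)
    rw [r.injective hu] at huw
    exact Finset.mem_map_of_mem r ((G.mem_neighborFinset u w).2 huw)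
  · omega

/-- Every planar graph admits a 2-distance coloring with `2Δ + 7` colors: a coloring
of the vertices with `2 * Δ + 7` colors in which any two distinct vertices at
distance at most 2 (i.e. at distance exactly 1 or 2) receive different colors. -/
theorem planar_twoDistance_coloring {V : Type*} [Fintype V]
    (G : SimpleGraph V) [DecidableRel G.Adj] (hG : IsPlanar G) :
    ∃ c : V → Fin (2 * G.maxDegree + 7),
      ∀ u v : V, (G.dist u v = 1 ∨ G.dist u v = 2) → c u ≠ c v := by
  obtain ⟨n, r, hr⟩ := hG.exists_combPlanar
  obtain ⟨c, hc⟩ := exists_isTwoColouring hr (deg_map_le G r) Finset.univ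
  refine ⟨fun v => c (r v), fun u v huv => hc _ (Finset.mem_univ _) _ (Finset.mem_univ _) ?_ ?_⟩
  · intro he
    rw [r.injective he, SimpleGraph.dist_self] at huv
    omega
  · rcases huv with h1 | h2
    · exact Or.inl (SimpleGraph.map_adj_apply.2 (SimpleGraph.dist_eq_one_iff_adj.1 h1))
    · have hreach : G.Reachable u v := SimpleGraph.Reachable.of_dist_ne_zero (by omega)
      obtain ⟨p, hp⟩ := hreach.exists_walk_length_eq_dist
      rw [h2] at hp
      match p, hp with
      | .cons h1 (.cons h2 .nil), _ =>
        exact Or.inr ⟨_, SimpleGraph.map_adj_apply.2 h1, SimpleGraph.map_adj_apply.2 h2⟩
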